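/- arXiv:1409.6090 — 7 statements merged into one kernel-verified Lean document; each statement's English description precedes it below -/
import Mathlib

section
/- Hasse's theorem for elliptic curves: if K is a finite field with q elements and W is a smooth Weierstrass curve over K (discriminant Δ(W) ≠ 0), then the number N of K-rational points of W satisfies |N − (q + 1)| ≤ 2√q; equivalently, ((N : ℤ) − (q + 1))² ≤ 4q. -/
/-- The number of `K`-rational points of a Weierstrass curve `W` over `K`:
the affine solutions `(x, y)` of `y² + a₁xy + a₃y = x³ + a₂x² + a₄x + a₆`
together with a single point at infinity. -/
noncomputable def WeierstrassCurve.ptCount (K : Type*) [Field K] (W : WeierstrassCurve K) : ℕ :=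
  1 + Nat.card {P : K × K //
    P.2 ^ 2 + W.a₁ * P.1 * P.2 + W.a₃ * P.2
      = P.1 ^ 3 + W.a₂ * P.1 ^ 2 + W.a₄ * P.1 + W.a₆}

namespace WeierstrassCurve

section Identities

variable {R : Type*} [CommRing R] (W : WeierstrassCurve R) {x₁ y₁ x₂ y₂ : R}

/-- The numerator of the `x`-coordinate of the sum of two affine points over the denominator
`(x₁ - x₂) ^ 2`. -/
def addXNum (x₁ y₁ x₂ y₂ : R) : R :=
  (y₁ - y₂) ^ 2 + W.a₁ * (y₁ - y₂) * (x₁ - x₂) - (W.a₂ + x₁ + x₂) * (x₁ - x₂) ^ 2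

/-- The part of `addXNum` that depends only on the `x`-coordinates. -/
def addXNumEven (x₁ x₂ : R) : R :=
  (x₁ ^ 3 + W.a₂ * x₁ ^ 2 + W.a₄ * x₁ + W.a₆) + (x₂ ^ 3 + W.a₂ * x₂ ^ 2 + W.a₄ * x₂ + W.a₆)
    - (W.a₂ + x₁ + x₂) * (x₁ - x₂) ^ 2

variable {W}

theorem addXNum_eq_even_sub (h₁ : Affine.Equation W x₁ y₁) (h₂ : Affine.Equation W x₂ y₂) :
    W.addXNum x₁ y₁ x₂ y₂ = W.addXNumEven x₁ x₂ -
      ((W.a₁ * x₂ + W.a₃) * y₁ + (W.a₁ * x₁ + W.a₃) * y₂ + 2 * y₁ * y₂) := by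
  rw [Affine.equation_iff] at h₁ h₂
  rw [addXNum, addXNumEven]
  linear_combination h₁ + h₂

theorem addXNum_add_addXNum_negY (h₁ : Affine.Equation W x₁ y₁) (h₂ : Affine.Equation W x₂ y₂) :
    W.addXNum x₁ y₁ x₂ y₂ + W.addXNum x₁ y₁ x₂ (Affine.negY W x₂ y₂) =
      2 * (x₁ + x₂) * (x₁ * x₂) + W.b₂ * (x₁ * x₂) + W.b₄ * (x₁ + x₂) + W.b₆ := by
  rw [addXNum_eq_even_sub h₁ h₂, addXNum_eq_even_sub h₁ ((Affine.equation_neg ..).2 h₂),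
    Affine.negY, addXNumEven, b₂, b₄, b₆]
  ring

theorem addXNum_mul_addXNum_negY (h₁ : Affine.Equation W x₁ y₁) (h₂ : Affine.Equation W x₂ y₂) :
    W.addXNum x₁ y₁ x₂ y₂ * W.addXNum x₁ y₁ x₂ (Affine.negY W x₂ y₂) =
      ((x₁ * x₂) ^ 2 - W.b₄ * (x₁ * x₂) - W.b₆ * (x₁ + x₂) - W.b₈) * (x₁ - x₂) ^ 2 := by
  rw [addXNum_eq_even_sub h₁ h₂, addXNum_eq_even_sub h₁ ((Affine.equation_neg ..).2 h₂),
    Affine.negY]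
  rw [Affine.equation_iff] at h₁ h₂
  have key : ((W.a₁ * x₂ + W.a₃) * y₁ + (W.a₁ * x₁ + W.a₃) * y₂ + 2 * y₁ * y₂) *
      ((W.a₁ * x₂ + W.a₃) * y₁ + (W.a₁ * x₁ + W.a₃) * y₂ + 2 * y₁ * y₂ +
        (W.a₁ * x₁ + W.a₃) * (W.a₁ * x₂ + W.a₃)) =
      4 * (x₁ ^ 3 + W.a₂ * x₁ ^ 2 + W.a₄ * x₁ + W.a₆) *
          (x₂ ^ 3 + W.a₂ * x₂ ^ 2 + W.a₄ * x₂ + W.a₆) +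
        (x₁ ^ 3 + W.a₂ * x₁ ^ 2 + W.a₄ * x₁ + W.a₆) * (W.a₁ * x₂ + W.a₃) ^ 2 +
        (x₂ ^ 3 + W.a₂ * x₂ ^ 2 + W.a₄ * x₂ + W.a₆) * (W.a₁ * x₁ + W.a₃) ^ 2 := by
    rw [← h₁, ← h₂]
    ring
  rw [addXNumEven, b₄, b₆, b₈]
  linear_combination -key

end Identities

namespace Affine.Point

variable {F : Type*} [Field F] [DecidableEq F] {V : WeierstrassCurve.Affine F}

theorem addX_slope_eq_addXNum_div {x₁ y₁ x₂ y₂ : F} (hx : x₁ ≠ x₂) :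
    V.addX x₁ x₂ (V.slope x₁ x₂ y₁ y₂) = V.addXNum x₁ y₁ x₂ y₂ / (x₁ - x₂) ^ 2 := by
  have hx' : x₁ - x₂ ≠ 0 := sub_ne_zero.2 hx
  rw [slope_of_X_ne hx, addX, addXNum]
  field_simp
  ring

/-- `addSubMap` sends the symmetric square of the `x`-coordinates of `P` and `Q` to that of
`P + Q` and `P - Q`. -/
theorem exists_eval_addSubMap_sym2x (P Q : V.Point) :
    ∃ c : F, ∀ i, (addSubMap V i).eval (P.sym2x Q) = c * (P + Q).sym2x (P - Q) i := by
  rcases P with _ | @⟨x₁, y₁, h₁⟩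
  · refine ⟨1, fun i => ?_⟩
    rw [← zero_def, zero_add, zero_sub, sym2x_neg_right]
    rcases Q with _ | ⟨h₂⟩
    · rw [← zero_def]
      fin_cases i <;> simp [addSubMap]
    · fin_cases i <;> simp [addSubMap] <;> ring
  rcases Q with _ | @⟨x₂, y₂, h₂⟩
  · refine ⟨1, fun i => ?_⟩
    rw [← zero_def, add_zero, sub_zero]
    fin_cases i <;> simp [addSubMap] <;> ring
  by_cases hx : x₁ = x₂
  · subst hx
    have main : ∃ c : F, ∀ i, (addSubMap V i).eval ((some _ _ h₁).sym2x (some _ _ h₁)) =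
        c * (some _ _ h₁ + some _ _ h₁).sym2x 0 i := by
      have e₁ := (V.equation_iff x₁ y₁).1 h₁.1
      by_cases hy : y₁ = V.negY x₁ y₁
      · refine ⟨(addSubMap V 0).eval ((some _ _ h₁).sym2x (some _ _ h₁)), fun i => ?_⟩
        rw [add_self_of_Y_eq hy]
        rw [negY] at hy
        fin_cases i
        · simp
        · simp [addSubMap, b₂, b₄, b₆]
          linear_combination (2 * y₁ + V.a₁ * x₁ + V.a₃) * hy - 4 * e₁
        · simp [addSubMap]
          ring
      · refine ⟨(y₁ - V.negY x₁ y₁) ^ 2, fun i => ?_⟩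
        have hy' : y₁ - V.negY x₁ y₁ ≠ 0 := sub_ne_zero.2 hy
        rw [add_self_of_Y_ne hy]
        fin_cases i
        · have hU : (3 * x₁ ^ 2 + 2 * V.a₂ * x₁ + V.a₄ - V.a₁ * y₁) ^ 2 +
              V.a₁ * (3 * x₁ ^ 2 + 2 * V.a₂ * x₁ + V.a₄ - V.a₁ * y₁) * (y₁ - V.negY x₁ y₁) -
              (V.a₂ + 2 * x₁) * (y₁ - V.negY x₁ y₁) ^ 2 =
              (x₁ * x₁) ^ 2 - V.b₄ * (x₁ * x₁) - V.b₆ * (x₁ + x₁) - V.b₈ := by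
            rw [negY, b₄, b₆, b₈]
            linear_combination -(V.a₁ ^ 2 + 4 * V.a₂ + 8 * x₁) * e₁
          simp [addSubMap, addX, slope_of_Y_ne rfl hy, -negY]
          generalize y₁ - V.negY x₁ y₁ = d at *
          rw [← hU]
          field_simp
          ring
        · simp [addSubMap, b₂, b₄, b₆, negY]
          linear_combination -4 * e₁
        · simp [addSubMap]
          ring
    obtain h | h := (X_eq_iff (h₁ := h₁) (h₂ := h₂)).1 rfl
    · rw [← h, sub_self]
      exact main
    · rw [← neg_eq_iff_eq_neg.2 h, sub_neg_eq_add, add_neg_cancel, sym2x_neg_right, sym2x_comm 0]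
      exact main
  · refine ⟨(x₁ - x₂) ^ 2, fun i => ?_⟩
    have hx' : x₁ - x₂ ≠ 0 := sub_ne_zero.2 hx
    rw [sub_eq_add_neg (some _ _ h₁), neg_some, add_of_X_ne hx, add_of_X_ne hx, sym2x_some_some,
      sym2x_some_some, addX_slope_eq_addXNum_div hx, addX_slope_eq_addXNum_div hx]
    have hmul := addXNum_mul_addXNum_negY h₁.1 h₂.1
    have hadd := addXNum_add_addXNum_negY h₁.1 h₂.1
    generalize V.addXNum x₁ y₁ x₂ y₂ = m, V.addXNum x₁ y₁ x₂ (V.negY x₂ y₂) = n at *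
    fin_cases i
    · simp [addSubMap]
      field_simp
      linear_combination -hmul
    · simp [addSubMap]
      field_simp
      linear_combination -hadd
    · simp [addSubMap]
      ring
end Affine.Point

section SupDegree

open Polynomial

variable {R K : Type*} [CommRing R] [Field K]

/-- The symmetric square of the pairs `(a, b)` and `(c, d)`. -/
def symSq (a b c d : R) : Fin 3 → R := ![a * c, a * d + b * c, b * d]

theorem exists_symSq_notMem {M : Ideal R} (hM : M.IsPrime) {a b c d : R} (hab : a ∉ M ∨ b ∉ M)
    (hcd : c ∉ M ∨ d ∉ M) : ∃ i, symSq a b c d i ∉ M := by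
  by_contra! h
  have h0 : a * c ∈ M := h 0
  have h1 : a * d + b * c ∈ M := h 1
  have h2 : b * d ∈ M := h 2
  rcases hM.mem_or_mem h0 with ha | hc
  · have hb : b ∉ M := hab.resolve_left (not_not.2 ha)
    rw [M.add_mem_iff_right (M.mul_mem_right d ha)] at h1
    have hc := (hM.mem_or_mem h1).resolve_left hb
    have hd := (hM.mem_or_mem h2).resolve_left hb
    tauto
  · have hd : d ∉ M := hcd.resolve_left (not_not.2 hc)
    rw [M.add_mem_iff_left (M.mul_mem_left b hc)] at h1
    have ha := (hM.mem_or_mem h1).resolve_right hd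
    have hb := (hM.mem_or_mem h2).resolve_right hd
    tauto

theorem exists_eval_addSubMap_notMem (W : WeierstrassCurve R) [W.IsElliptic] {M : Ideal R}
    (hM : M.IsPrime) {s : Fin 3 → R} (hs : ∃ i, s i ∉ M) :
    ∃ i, (addSubMap W i).eval s ∉ M := by
  by_contra! h
  obtain ⟨i, hi⟩ := hs
  refine hi (hM.mem_of_pow_mem 4 ?_)
  rw [← addSubMapCoeff_condition W s i]
  exact M.sum_mem fun j _ => M.mul_mem_left _ (h j)

theorem notMem_or_notMem_of_isCoprime {M : Ideal R} (hM : M.IsPrime) {a b : R}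
    (hab : IsCoprime a b) : a ∉ M ∨ b ∉ M := by
  by_contra! h
  obtain ⟨u, v, huv⟩ := hab
  exact hM.ne_top ((Ideal.eq_top_iff_one M).2
    (huv ▸ M.add_mem (M.mul_mem_left u h.1) (M.mul_mem_left v h.2)))

theorem exists_sum_mul_eq_one {u : Fin 3 → R}
    (hu : ∀ M : Ideal R, M.IsPrime → ∃ i, u i ∉ M) : ∃ r : Fin 3 → R, ∑ i, r i * u i = 1 := by
  have htop : Ideal.span (Set.range u) = ⊤ := by
    by_contra hne
    obtain ⟨M, hM, hle⟩ := Ideal.exists_le_maximal _ hne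
    obtain ⟨i, hi⟩ := hu M hM.isPrime
    exact hi (hle (Ideal.subset_span ⟨i, rfl⟩))
  have h1 : (1 : R) ∈ Ideal.span (Set.range u) := htop ▸ Submodule.mem_top
  exact (Ideal.mem_span_range_iff_exists_fun).1 h1

/-- Proportional unimodular vectors differ by a unit. -/
theorem exists_isUnit_of_proportional {u v : Fin 3 → R}
    (hu : ∀ M : Ideal R, M.IsPrime → ∃ i, u i ∉ M) (hv : ∀ M : Ideal R, M.IsPrime → ∃ i, v i ∉ M)
    (huv : ∀ i j, u i * v j = u j * v i) : ∃ k : R, IsUnit k ∧ ∀ i, u i = k * v i := by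
  obtain ⟨r, hr⟩ := exists_sum_mul_eq_one hu
  obtain ⟨t, ht⟩ := exists_sum_mul_eq_one hv
  have hk : ∀ i, u i = (∑ j, t j * u j) * v i := fun i => by
    calc u i = (∑ j, t j * v j) * u i := by rw [ht, one_mul]
      _ = _ := by
        rw [Finset.sum_mul, Finset.sum_mul]
        exact Finset.sum_congr rfl fun j _ => by linear_combination t j * huv i j
  refine ⟨_, IsUnit.of_mul_eq_one (∑ j, r j * v j) ?_, hk⟩
  rw [← hr, Finset.mul_sum]
  exact Finset.sum_congr rfl fun j _ => by rw [mul_left_comm, ← hk j]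

/-- `n` is the largest degree of the entries of `u`. -/
def IsSupDegree {ι : Type*} (u : ι → K[X]) (n : ℕ) : Prop :=
  (∀ i, (u i).natDegree ≤ n) ∧ ∃ i, (u i).coeff n ≠ 0

theorem IsSupDegree.unique {ι : Type*} {u : ι → K[X]} {m n : ℕ} (hm : IsSupDegree u m)
    (hn : IsSupDegree u n) : m = n := by
  obtain ⟨i, hi⟩ := hm.2
  obtain ⟨j, hj⟩ := hn.2
  exact le_antisymm ((le_natDegree_of_ne_zero hi).trans (hn.1 i))
    ((le_natDegree_of_ne_zero hj).trans (hm.1 j))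

theorem IsSupDegree.of_isUnit {ι : Type*} {u v : ι → K[X]} {n : ℕ} (hv : IsSupDegree v n) {k : K[X]}
    (hk : IsUnit k) (huv : ∀ i, u i = k * v i) : IsSupDegree u n := by
  obtain ⟨c, hc, rfl⟩ := Polynomial.isUnit_iff.1 hk
  obtain ⟨i, hi⟩ := hv.2
  refine ⟨fun i => ?_, i, ?_⟩
  · rw [huv]
    exact (natDegree_C_mul_le _ _).trans (hv.1 i)
  · rw [huv, coeff_C_mul]
    exact mul_ne_zero hc.ne_zero hi

theorem IsSupDegree.symSq {a b c d : K[X]} {m n : ℕ} (hab : IsSupDegree ![a, b] m)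
    (hcd : IsSupDegree ![c, d] n) : IsSupDegree (symSq a b c d) (m + n) := by
  have ha : a.natDegree ≤ m := hab.1 0
  have hb : b.natDegree ≤ m := hab.1 1
  have hc : c.natDegree ≤ n := hcd.1 0
  have hd : d.natDegree ≤ n := hcd.1 1
  have hab' := hab.2
  have hcd' := hcd.2
  simp only [Fin.exists_fin_two, Matrix.cons_val_zero, Matrix.cons_val_one] at hab' hcd'
  refine ⟨fun i => ?_, ?_⟩
  · fin_cases i
    · exact natDegree_mul_le_of_le ha hc
    · exact natDegree_add_le_of_degree_le (natDegree_mul_le_of_le ha hd)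
        (natDegree_mul_le_of_le hb hc)
    · exact natDegree_mul_le_of_le hb hd
  · obtain ⟨i, hi⟩ := exists_symSq_notMem (Ideal.isPrime_bot (α := K)) (a := a.coeff m)
      (b := b.coeff m) (c := c.coeff n) (d := d.coeff n) (by simpa using hab') (by simpa using hcd')
    refine ⟨i, fun h => hi ?_⟩
    rw [Ideal.mem_bot, ← h]
    fin_cases i
    · exact (coeff_mul_add_eq_of_natDegree_le ha hc).symm
    · exact ((coeff_add ..).trans (congrArg₂ _ (coeff_mul_add_eq_of_natDegree_le ha hd)
        (coeff_mul_add_eq_of_natDegree_le hb hc))).symm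
    · exact (coeff_mul_add_eq_of_natDegree_le hb hd).symm

theorem IsSupDegree.eval_addSubMap (W : WeierstrassCurve K) [W.IsElliptic] {s : Fin 3 → K[X]}
    {n : ℕ} (hs : IsSupDegree s n) :
    IsSupDegree (fun i => (addSubMap (W.map C) i).eval s) (n + n) := by
  have hdeg (c : K) (i j : Fin 3) : (C c * s i * s j).natDegree ≤ n + n :=
    natDegree_mul_le_of_le ((natDegree_C_mul_le _ _).trans (hs.1 i)) (hs.1 j)
  have hcoeff (c : K) (i j : Fin 3) :
      (C c * s i * s j).coeff (n + n) = c * (s i).coeff n * (s j).coeff n := by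
    rw [mul_assoc, coeff_C_mul, coeff_mul_add_eq_of_natDegree_le (hs.1 i) (hs.1 j), mul_assoc]
  have h0 : (addSubMap (W.map C) 0).eval s = C 1 * s 0 * s 0 -
      C W.b₄ * s 0 * s 2 - C W.b₆ * s 1 * s 2 -
      C W.b₈ * s 2 * s 2 := by
    simp [addSubMap]; ring
  have h1 : (addSubMap (W.map C) 1).eval s = C 2 * s 1 * s 0 +
      C W.b₂ * s 0 * s 2 + C W.b₄ * s 1 * s 2 +
      C W.b₆ * s 2 * s 2 := by
    simp [addSubMap, C_ofNat]; ring
  have h2 : (addSubMap (W.map C) 2).eval s = C 1 * s 1 * s 1 -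
      C 4 * s 0 * s 2 := by
    simp [addSubMap, C_ofNat]; ring
  refine ⟨fun i => ?_, ?_⟩
  · fin_cases i
    · exact (congrArg natDegree h0).trans_le <|
        (natDegree_sub_le_of_le (natDegree_sub_le_of_le (natDegree_sub_le_of_le
        (hdeg ..) (hdeg ..)) (hdeg ..)) (hdeg ..)).trans (by simp)
    · exact (congrArg natDegree h1).trans_le <|
        (natDegree_add_le_of_degree_le (natDegree_add_le_of_degree_le
        (natDegree_add_le_of_degree_le (hdeg ..) (hdeg ..)) (hdeg ..)) (hdeg ..))
    · exact (congrArg natDegree h2).trans_le <|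
        (natDegree_sub_le_of_le (hdeg ..) (hdeg ..)).trans (by simp)
  · have hne : (fun i => (s i).coeff n) ≠ 0 := by
      obtain ⟨i, hi⟩ := hs.2
      exact fun h => hi (congrFun h i)
    obtain ⟨i, hi⟩ := Function.ne_iff.1 (addSubMap_ne_zero W hne)
    refine ⟨i, fun h => hi ?_⟩
    rw [Pi.zero_apply, ← h]
    fin_cases i
    · simp only [Fin.zero_eta, h0, coeff_sub, hcoeff]
      simp [addSubMap]; ring
    · simp only [Fin.mk_one, h1, coeff_add, hcoeff]
      simp [addSubMap]; ring
    · simp only [Fin.reduceFinMk, h2, coeff_sub, hcoeff]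
      simp [addSubMap]; ring

end SupDegree

section Height

open Polynomial

variable {K : Type*} [Field K] {W : WeierstrassCurve K} {L : Type*} [Field L]
  [Algebra K L] [Algebra K[X] L]

/-- The `x`-coordinate of `P` is `a / b`, allowing `b = 0` for the point at infinity. -/
def IsXRatio (P : Affine.Point (W.map (algebraMap K L))) (a b : K[X]) : Prop :=
  ∃ c : L, c ≠ 0 ∧ algebraMap K[X] L a = c * P.xRep 0 ∧ algebraMap K[X] L b = c * P.xRep 1

/-- The `x`-coordinate of `P` is a rational function of degree `n`. -/
def HasXHeight (P : Affine.Point (W.map (algebraMap K L))) (n : ℕ) : Prop :=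
  ∃ a b : K[X], IsCoprime a b ∧ IsXRatio P a b ∧ IsSupDegree ![a, b] n

variable {P Q : Affine.Point (W.map (algebraMap K L))}

theorem IsXRatio.neg {a b : K[X]} (h : IsXRatio P a b) : IsXRatio (-P) a b := by
  simpa only [IsXRatio, Affine.Point.xRep_neg] using h

theorem HasXHeight.neg {n : ℕ} (h : HasXHeight P n) : HasXHeight (-P) n := by
  obtain ⟨a, b, hab, hP, hn⟩ := h
  exact ⟨a, b, hab, hP.neg, hn⟩

theorem isSupDegree_max_natDegree {a b : K[X]} (hab : IsCoprime a b) :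
    IsSupDegree ![a, b] (max a.natDegree b.natDegree) := by
  refine ⟨fun i => ?_, ?_⟩
  · fin_cases i
    · exact le_max_left ..
    · exact le_max_right ..
  · by_contra! h
    have ha : a.coeff (max a.natDegree b.natDegree) = 0 := h 0
    have hb : b.coeff (max a.natDegree b.natDegree) = 0 := h 1
    rcases le_total a.natDegree b.natDegree with hle | hle
    · rw [max_eq_right hle] at ha hb
      rw [coeff_natDegree, leadingCoeff_eq_zero] at hb
      subst hb
      rw [natDegree_zero, Nat.le_zero] at hle
      rw [natDegree_zero, ← hle, coeff_natDegree, leadingCoeff_eq_zero] at ha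
      subst ha
      exact not_isCoprime_zero_zero hab
    · rw [max_eq_left hle] at ha hb
      rw [coeff_natDegree, leadingCoeff_eq_zero] at ha
      subst ha
      rw [natDegree_zero, Nat.le_zero] at hle
      rw [natDegree_zero, ← hle, coeff_natDegree, leadingCoeff_eq_zero] at hb
      subst hb
      exact not_isCoprime_zero_zero hab

variable [FaithfulSMul K[X] L]

/-- A representation of an `x`-coordinate as a fraction bounds its height. -/
theorem IsXRatio.exists_hasXHeight {a b : K[X]} (h : IsXRatio P a b) :
    ∃ n, HasXHeight P n ∧ n ≤ max a.natDegree b.natDegree := by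
  have hinj := FaithfulSMul.algebraMap_injective K[X] L
  obtain ⟨c, hc, ha, hb⟩ := h
  have h0 : a ≠ 0 ∨ b ≠ 0 := by
    by_contra! h
    apply P.xRep_ne_zero
    ext i
    fin_cases i
    · simpa [h.1, hc] using ha
    · simpa [h.2, hc] using hb
  classical
  have hd0 : EuclideanDomain.gcd a b ≠ 0 := fun h => by
    rw [EuclideanDomain.gcd_eq_zero_iff] at h
    tauto
  obtain ⟨a', ha'⟩ := EuclideanDomain.gcd_dvd_left a b
  obtain ⟨b', hb'⟩ := EuclideanDomain.gcd_dvd_right a b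
  have hab : IsCoprime a' b' := by
    refine ⟨EuclideanDomain.gcdA a b, EuclideanDomain.gcdB a b, mul_left_cancel₀ hd0 ?_⟩
    linear_combination -EuclideanDomain.gcd_eq_gcd_ab a b -
      EuclideanDomain.gcdA a b * ha' - EuclideanDomain.gcdB a b * hb'
  generalize EuclideanDomain.gcd a b = d at ha' hb' hd0
  have hd : algebraMap K[X] L d ≠ 0 := (map_ne_zero_iff _ hinj).2 hd0
  refine ⟨_, ⟨a', b', hab, ⟨c / algebraMap K[X] L d, div_ne_zero hc hd, ?_, ?_⟩,
    isSupDegree_max_natDegree hab⟩, max_le_max ?_ ?_⟩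
  · rw [div_mul_eq_mul_div, eq_div_iff hd, ← ha, ha', map_mul, mul_comm]
  · rw [div_mul_eq_mul_div, eq_div_iff hd, ← hb, hb', map_mul, mul_comm]
  · rcases eq_or_ne a' 0 with rfl | h
    · simp
    · rw [ha', natDegree_mul hd0 h]
      exact Nat.le_add_left ..
  · rcases eq_or_ne b' 0 with rfl | h
    · simp
    · rw [hb', natDegree_mul hd0 h]
      exact Nat.le_add_left ..

theorem IsXRatio.of_mul_left {a b d : K[X]} (hd : d ≠ 0) (h : IsXRatio P (d * a) (d * b)) :
    IsXRatio P a b := by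
  obtain ⟨c, hc, ha, hb⟩ := h
  have hd' : algebraMap K[X] L d ≠ 0 :=
    (map_ne_zero_iff _ (FaithfulSMul.algebraMap_injective K[X] L)).2 hd
  rw [map_mul] at ha hb
  refine ⟨c / algebraMap K[X] L d, div_ne_zero hc hd', ?_, ?_⟩
  · rw [div_mul_eq_mul_div, eq_div_iff hd', mul_comm, ha]
  · rw [div_mul_eq_mul_div, eq_div_iff hd', mul_comm, hb]

theorem HasXHeight.le_of_isXRatio {n : ℕ} {a b : K[X]} (hn : HasXHeight P n)
    (h : IsXRatio P a b) : n ≤ max a.natDegree b.natDegree := by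
  have hinj := FaithfulSMul.algebraMap_injective K[X] L
  obtain ⟨r, s, ⟨u, v, huv⟩, ⟨c, hc, hr, hs⟩, -, i, hi⟩ := hn
  obtain ⟨d, hd, ha, hb⟩ := h
  have hprop : r * b = s * a := hinj (by rw [map_mul, map_mul, hr, hs, ha, hb]; ring)
  have ha' : a = r * (u * a + v * b) := by linear_combination (-a) * huv - v * hprop
  have hb' : b = s * (u * a + v * b) := by linear_combination (-b) * huv + u * hprop
  have hk : u * a + v * b ≠ 0 := fun hk => by
    rw [hk, mul_zero] at ha' hb'
    apply P.xRep_ne_zero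
    ext i
    fin_cases i
    · simpa [ha', hd] using ha
    · simpa [hb', hd] using hb
  generalize u * a + v * b = k at ha' hb' hk
  subst ha' hb'
  have key (p : K[X]) (hp : p.coeff n ≠ 0) : n ≤ (p * k).natDegree := by
    rw [natDegree_mul (fun h => hp (by rw [h, coeff_zero])) hk]
    exact (le_natDegree_of_ne_zero hp).trans (Nat.le_add_right ..)
  fin_cases i
  · exact (key r hi).trans (le_max_left ..)
  · exact (key s hi).trans (le_max_right ..)

variable [DecidableEq L] [IsScalarTower K K[X] L]

/-- The parallelogram law. -/
theorem HasXHeight.exists_add [W.IsElliptic] {m n k : ℕ} (hP : HasXHeight P m)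
    (hQ : HasXHeight Q n) (hPQ : HasXHeight (P - Q) k) :
    ∃ l, HasXHeight (P + Q) l ∧ l + k = 2 * m + 2 * n := by
  have hinj := FaithfulSMul.algebraMap_injective K[X] L
  obtain ⟨a, b, hab, ⟨r, hr, ha, hb⟩, hm⟩ := hP
  obtain ⟨c, d, hcd, ⟨s, hs, hc, hd⟩, hn⟩ := hQ
  obtain ⟨e, f, hef, ⟨t, ht, he, hf⟩, hk⟩ := hPQ
  obtain ⟨z, hz⟩ := Affine.Point.exists_eval_addSubMap_sym2x P Q
  set u : Fin 3 → K[X] := fun i => (addSubMap (W.map C) i).eval (symSq a b c d) with hu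
  have hu_deg : IsSupDegree u (m + n + (m + n)) := (hm.symSq hn).eval_addSubMap W
  have hu_prime (M : Ideal K[X]) (hM : M.IsPrime) : ∃ i, u i ∉ M :=
    exists_eval_addSubMap_notMem _ hM (exists_symSq_notMem hM
      (notMem_or_notMem_of_isCoprime hM hab) (notMem_or_notMem_of_isCoprime hM hcd))
  have hu_map : ∀ i, algebraMap K[X] L (u i) =
      (r * s) ^ 2 * z * (P + Q).sym2x (P - Q) i := fun i => by
    rw [mul_assoc, ← hz i]
    have hC (x : K) : algebraMap K[X] L (C x) = algebraMap K L x :=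
      (IsScalarTower.algebraMap_apply K K[X] L x).symm
    have h2 : algebraMap K[X] L 2 = 2 := map_ofNat _ 2
    have h4 : algebraMap K[X] L 4 = 4 := map_ofNat _ 4
    fin_cases i <;>
    · simp [hu, addSubMap, symSq, Affine.Point.sym2x, ha, hb, hc, hd, hC, h2, h4]
      ring
  have hz0 : (r * s) ^ 2 * z ≠ 0 := fun h => by
    obtain ⟨i, hi⟩ := hu_prime ⊥ Ideal.isPrime_bot
    exact hi (hinj (by rw [hu_map, h, zero_mul, map_zero]))
  generalize (r * s) ^ 2 * z = A at hu_map hz0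
  have hu0 : algebraMap K[X] L (u 0) = A * ((P + Q).xRep 0 * (P - Q).xRep 0) := hu_map 0
  have hu1 : algebraMap K[X] L (u 1) = A * ((P + Q).xRep 0 * (P - Q).xRep 1 +
    (P + Q).xRep 1 * (P - Q).xRep 0) := hu_map 1
  have hu2 : algebraMap K[X] L (u 2) = A * ((P + Q).xRep 1 * (P - Q).xRep 1) := hu_map 2
  obtain ⟨l, ⟨g, h, hgh, ⟨v, hv, hg, hh⟩, hl⟩⟩ : ∃ l, HasXHeight (P + Q) l := by
    by_cases hY : (P - Q).xRep 1 = 0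
    · have hY0 : (P - Q).xRep 0 ≠ 0 := fun h => by
        apply (P - Q).xRep_ne_zero
        ext i
        fin_cases i
        · exact h
        · exact hY
      have hx : IsXRatio (P + Q) (u 0) (u 1) := by
        refine ⟨A * (P - Q).xRep 0, mul_ne_zero hz0 hY0, ?_, ?_⟩
        · rw [hu0]; ring
        · rw [hu1, hY]; ring
      exact hx.exists_hasXHeight.imp fun _ hn => hn.1
    · have hx : IsXRatio (P + Q) (u 1 * f - u 2 * e) (u 2 * f) := by
        refine ⟨A * t * (P - Q).xRep 1 ^ 2, by positivity, ?_, ?_⟩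
        · rw [map_sub, map_mul, map_mul, hu1, hu2, he, hf]; ring
        · rw [map_mul, hu2, hf]; ring
      exact hx.exists_hasXHeight.imp fun _ hn => hn.1
  refine ⟨l, ⟨g, h, hgh, ⟨v, hv, hg, hh⟩, hl⟩, ?_⟩
  have hw_map (i) : algebraMap K[X] L (symSq g h e f i) =
      v * t * (P + Q).sym2x (P - Q) i := by
    fin_cases i <;>
    · simp [symSq, Affine.Point.sym2x, hg, hh, he, hf]
      ring
  obtain ⟨x, hx, hux⟩ := exists_isUnit_of_proportional hu_prime (v := symSq g h e f)
    (fun M hM => exists_symSq_notMem hM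
      (notMem_or_notMem_of_isCoprime hM hgh) (notMem_or_notMem_of_isCoprime hM hef))
    (fun i j => hinj (by rw [map_mul, map_mul, hu_map, hu_map, hw_map, hw_map]; ring))
  have := hu_deg.unique ((hl.symSq hk).of_isUnit hx hux)
  lia

/-- Heights along an arithmetic progression of points are the values of a quadratic polynomial. -/
theorem HasXHeight.exists_add_zsmul [W.IsElliptic] {q N : ℕ} (hP : HasXHeight P 1)
    (hQ : HasXHeight Q q) (hQP : HasXHeight (Q - P) N) (n : ℤ) :
    ∃ k : ℕ, HasXHeight (Q + n • P) k ∧ (k : ℤ) = n ^ 2 + (q + 1 - N) * n + q := by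
  have hup : ∀ n : ℕ,
      (∃ k : ℕ, HasXHeight (Q + ((n : ℤ) - 1) • P) k ∧
        (k : ℤ) = ((n : ℤ) - 1) ^ 2 + (q + 1 - N) * ((n : ℤ) - 1) + q) ∧
      ∃ k : ℕ, HasXHeight (Q + (n : ℤ) • P) k ∧ (k : ℤ) = (n : ℤ) ^ 2 + (q + 1 - N) * n + q := by
    intro n
    induction n with
    | zero =>
      refine ⟨⟨N, ?_, by push_cast; ring⟩, q, ?_, by simp⟩
      · simpa [sub_eq_add_neg] using hQP
      · simpa using hQ
    | succ n ih =>
      obtain ⟨⟨k, hk, hk'⟩, m, hm, hm'⟩ := ih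
      push_cast
      rw [add_sub_cancel_right]
      refine ⟨⟨m, hm, hm'⟩, ?_⟩
      rw [show Q + ((n : ℤ) - 1) • P = Q + (n : ℤ) • P - P by rw [sub_smul, one_smul]; abel] at hk
      obtain ⟨l, hl, hl'⟩ := hm.exists_add hP hk
      rw [show Q + (n : ℤ) • P + P = Q + ((n : ℤ) + 1) • P by rw [add_smul, one_smul]; abel] at hl
      exact ⟨l, hl, by zify at hl'; linear_combination hl' - hk' + 2 * hm'⟩
  have hdown : ∀ n : ℕ,
      (∃ k : ℕ, HasXHeight (Q + (1 - (n : ℤ)) • P) k ∧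
        (k : ℤ) = (1 - (n : ℤ)) ^ 2 + (q + 1 - N) * (1 - (n : ℤ)) + q) ∧
      ∃ k : ℕ, HasXHeight (Q + (-(n : ℤ)) • P) k ∧
        (k : ℤ) = (-(n : ℤ)) ^ 2 + (q + 1 - N) * (-(n : ℤ)) + q := by
    intro n
    induction n with
    | zero => exact ⟨by simpa using (hup 1).2, by simpa using (hup 0).2⟩
    | succ n ih =>
      obtain ⟨⟨k, hk, hk'⟩, m, hm, hm'⟩ := ih
      push_cast
      rw [show (1 : ℤ) - (n + 1) = -n by ring]
      refine ⟨⟨m, hm, hm'⟩, ?_⟩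
      rw [show Q + (1 - (n : ℤ)) • P = Q + (-(n : ℤ)) • P - -P by
        rw [sub_smul, one_smul, neg_smul]; abel] at hk
      obtain ⟨l, hl, hl'⟩ := hm.exists_add hP.neg hk
      rw [show Q + (-(n : ℤ)) • P + -P = Q + (-((n : ℤ) + 1)) • P by
        rw [neg_smul, neg_smul, add_smul, one_smul]; abel] at hl
      exact ⟨l, hl, by zify at hl'; linear_combination hl' - hk' + 2 * hm'⟩
  obtain ⟨m, rfl | rfl⟩ := n.eq_nat_or_neg
  · exact (hup m).2
  · exact (hdown m).2

theorem HasXHeight.sub_sq_le [W.IsElliptic] {q N : ℕ} (hP : HasXHeight P 1)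
    (hQ : HasXHeight Q q) (hQP : HasXHeight (Q - P) N) :
    ((N : ℤ) - (q + 1)) ^ 2 ≤ 4 * q := by
  obtain ⟨c, hc | hc⟩ := Int.even_or_odd' ((q : ℤ) + 1 - N)
  · obtain ⟨k, -, hk⟩ := hP.exists_add_zsmul hQ hQP (-c)
    rw [hc] at hk
    rw [show (N : ℤ) - (q + 1) = -(2 * c) by lia]
    nlinarith
  · obtain ⟨k, hA, hk⟩ := hP.exists_add_zsmul hQ hQP (-c)
    obtain ⟨m, hB, hm⟩ := hP.exists_add_zsmul hQ hQP (-c - 1)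
    rw [hc] at hk hm
    have hkm : k = m := by zify; rw [hk, hm]; ring
    have hAB : HasXHeight (Q + (-c) • P - (Q + (-c - 1) • P)) 1 := by
      rw [show Q + (-c) • P - (Q + (-c - 1) • P) = P by rw [sub_smul, one_smul]; abel]
      exact hP
    obtain ⟨l, -, hl⟩ := hA.exists_add hB hAB
    have hk1 : (1 : ℤ) ≤ k := by lia
    rw [show (N : ℤ) - (q + 1) = -(2 * c + 1) by lia]
    nlinarith

end Height

section Frobenius

open Polynomial

section YPow

variable {K : Type*} [CommRing K] (W : WeierstrassCurve K)

/-- The coefficient `a₁x + a₃` of `y` in the Weierstrass equation. -/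
noncomputable def linearPoly : K[X] := C W.a₁ * X + C W.a₃

/-- The right-hand side `x³ + a₂x² + a₄x + a₆` of the Weierstrass equation. -/
noncomputable def cubicPoly : K[X] := X ^ 3 + C W.a₂ * X ^ 2 + C W.a₄ * X + C W.a₆

/-- The coordinates of `y ^ n` with respect to the basis `1, y` of the coordinate ring. -/
noncomputable def yPow : ℕ → K[X] × K[X]
  | 0 => (1, 0)
  | n + 1 => ((yPow n).2 * W.cubicPoly, (yPow n).1 - W.linearPoly * (yPow n).2)

theorem natDegree_linearPoly_le : W.linearPoly.natDegree ≤ 1 := by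
  rw [linearPoly]
  compute_degree

theorem natDegree_cubicPoly_le : W.cubicPoly.natDegree ≤ 3 := by
  rw [cubicPoly]
  compute_degree

theorem natDegree_yPow_le (n : ℕ) :
    2 * (W.yPow (n + 1)).1.natDegree ≤ 3 * (n + 1) ∧
      2 * (W.yPow (n + 1)).2.natDegree ≤ 3 * n := by
  induction n with
  | zero => simp [yPow]
  | succ n ih =>
    rw [yPow]
    have h₁ := natDegree_mul_le (p := (W.yPow (n + 1)).2) (q := W.cubicPoly)
    have h₂ := natDegree_mul_le (p := W.linearPoly) (q := (W.yPow (n + 1)).2)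
    have h₃ := natDegree_sub_le (W.yPow (n + 1)).1 (W.linearPoly * (W.yPow (n + 1)).2)
    have h₄ := W.natDegree_linearPoly_le
    have h₅ := W.natDegree_cubicPoly_le
    dsimp only
    grind

variable {R : Type*} [CommRing R] [Algebra K R] {x y : R}

theorem algebraMap_eq_aeval_X [Algebra K[X] R] [IsScalarTower K K[X] R] (p : K[X]) :
    algebraMap K[X] R p = aeval (algebraMap K[X] R X) p := by
  rw [aeval_algebraMap_apply, aeval_X_left_apply]

theorem aeval_linearPoly :
    aeval x W.linearPoly = algebraMap K R W.a₁ * x + algebraMap K R W.a₃ := by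
  simp [linearPoly]

theorem negY_eq_aeval :
    Affine.negY (W.map (algebraMap K R)) x y = -y - aeval x W.linearPoly := by
  rw [aeval_linearPoly, Affine.negY, map_a₁, map_a₃]
  ring

variable {W} in
theorem sq_eq_aeval (h : Affine.Equation (W.map (algebraMap K R)) x y) :
    y ^ 2 = aeval x W.cubicPoly - aeval x W.linearPoly * y := by
  rw [Affine.equation_iff] at h
  simp only [map_a₁, map_a₂, map_a₃, map_a₄, map_a₆] at h
  simp only [linearPoly, cubicPoly, map_add, map_mul, map_pow, aeval_X, aeval_C]
  linear_combination h

variable {W} in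
theorem pow_eq_aeval_yPow (h : Affine.Equation (W.map (algebraMap K R)) x y) (n : ℕ) :
    y ^ n = aeval x (W.yPow n).1 + aeval x (W.yPow n).2 * y := by
  induction n with
  | zero => simp [yPow]
  | succ n ih =>
    rw [pow_succ, ih, yPow]
    simp only [map_mul, map_sub]
    linear_combination aeval x (W.yPow n).2 * sq_eq_aeval h

theorem aeval_addXNumEven {u v : K[X]} :
    aeval x ((W.map C).addXNumEven u v) =
      (W.map (algebraMap K R)).addXNumEven (aeval x u) (aeval x v) := by
  simp [addXNumEven]

end YPow

section Fraction

variable {K : Type*} [Field K] [Fintype K] (W : WeierstrassCurve K)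

local notation "𝔮" => Fintype.card K

/-- The numerator of the `x`-coordinate of the sum of a generic point and its Frobenius image. -/
noncomputable def frobAddNum : K[X] :=
  (W.map C).addXNumEven (X ^ 𝔮) X -
    (W.linearPoly * (W.yPow 𝔮).1 + 2 * (W.yPow 𝔮).2 * W.cubicPoly)

/-- The numerator of the `x`-coordinate of the difference of the Frobenius image of a generic point
and that point. -/
noncomputable def frobSubNum : K[X] :=
  (W.map C).addXNumEven (X ^ 𝔮) X -
    (W.linearPoly * (W.yPow 𝔮).1 - (W.yPow 𝔮).2 * W.linearPoly ^ 2
      - 2 * (W.yPow 𝔮).2 * W.cubicPoly)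

theorem natDegree_addXNumEven_le :
    ((W.map C).addXNumEven (X ^ 𝔮) X).natDegree ≤ 2 * 𝔮 + 1 := by
  have hq : 1 < 𝔮 := Fintype.one_lt_card
  have : (W.map C).addXNumEven (X ^ 𝔮) X = X ^ (2 * 𝔮 + 1) + X ^ (𝔮 + 2)
      + C (2 * W.a₂) * X ^ (𝔮 + 1) + C W.a₄ * X ^ 𝔮 + C W.a₄ * X + C (2 * W.a₆) := by
    simp only [addXNumEven, map_a₂, map_a₄, map_a₆, map_mul, map_ofNat]
    ring
  rw [this]
  compute_degree
  all_goals lia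

theorem natDegree_yPow_card_le :
    (W.linearPoly * (W.yPow 𝔮).1).natDegree ≤ 2 * 𝔮 + 1 ∧
      ((W.yPow 𝔮).2 * W.linearPoly ^ 2).natDegree ≤ 2 * 𝔮 + 1 ∧
      (2 * (W.yPow 𝔮).2 * W.cubicPoly).natDegree ≤ 2 * 𝔮 + 1 := by
  have hq : 1 < 𝔮 := Fintype.one_lt_card
  obtain ⟨n, hn⟩ : ∃ n, 𝔮 = n + 1 := ⟨𝔮 - 1, by lia⟩
  rw [hn]
  obtain ⟨h₁, h₂⟩ := W.natDegree_yPow_le n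
  have h₃ := natDegree_mul_le (p := W.linearPoly) (q := (W.yPow (n + 1)).1)
  have h₄ := natDegree_mul_le (p := (W.yPow (n + 1)).2) (q := W.linearPoly ^ 2)
  have h₅ := natDegree_pow_le (p := W.linearPoly) (n := 2)
  have h₆ := natDegree_mul_le (p := (W.yPow (n + 1)).2) (q := W.cubicPoly)
  have h₇ := W.natDegree_linearPoly_le
  have h₈ := W.natDegree_cubicPoly_le
  have h₉ := natDegree_C_mul_le (2 : K) ((W.yPow (n + 1)).2 * W.cubicPoly)
  rw [map_ofNat, ← mul_assoc] at h₉
  refine ⟨?_, ?_, ?_⟩ <;> lia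

theorem natDegree_frobAddNum_le : W.frobAddNum.natDegree ≤ 2 * 𝔮 + 1 := by
  obtain ⟨h₁, h₂, h₃⟩ := W.natDegree_yPow_card_le
  exact natDegree_sub_le_of_le W.natDegree_addXNumEven_le
    (natDegree_add_le_of_le h₁ h₃ |>.trans (max_self _).le) |>.trans (max_self _).le

theorem natDegree_frobSubNum_le : W.frobSubNum.natDegree ≤ 2 * 𝔮 + 1 := by
  obtain ⟨h₁, h₂, h₃⟩ := W.natDegree_yPow_card_le
  refine (natDegree_sub_le_of_le W.natDegree_addXNumEven_le
    (natDegree_sub_le_of_le (natDegree_sub_le_of_le h₁ h₂) h₃)).trans ?_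
  simp

section Eval

variable {W} {R : Type*} [CommRing R] [Algebra K R] {x y : R}

theorem equation_pow_card (h : Affine.Equation (W.map (algebraMap K R)) x y) :
    Affine.Equation (W.map (algebraMap K R)) (x ^ 𝔮) (y ^ 𝔮) := by
  rw [Affine.equation_iff] at h ⊢
  have := congr_arg (FiniteField.frobeniusAlgHom K R) h
  simpa only [map_add, map_mul, map_pow, FiniteField.coe_frobeniusAlgHom, map_a₁, map_a₂, map_a₃,
    map_a₄, map_a₆, AlgHom.commutes] using this

theorem yPow_card_trace (h : Affine.Equation (W.map (algebraMap K R)) x y) :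
    2 * aeval x (W.yPow 𝔮).1 - aeval x (W.yPow 𝔮).2 * aeval x W.linearPoly =
      -aeval (x ^ 𝔮) W.linearPoly := by
  have h₁ := pow_eq_aeval_yPow h 𝔮
  have h₂ := pow_eq_aeval_yPow ((Affine.equation_neg ..).2 h) 𝔮
  have h₃ : Affine.negY (W.map (algebraMap K R)) x y ^ 𝔮 = -y ^ 𝔮 - aeval (x ^ 𝔮) W.linearPoly := by
    have : FiniteField.frobeniusAlgHom K R (Affine.negY (W.map (algebraMap K R)) x y) =
        -FiniteField.frobeniusAlgHom K R y -
          aeval (FiniteField.frobeniusAlgHom K R x) W.linearPoly := by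
      rw [aeval_linearPoly, Affine.negY]
      simp only [map_sub, map_neg, map_mul, map_a₁, map_a₃, AlgHom.commutes]
      ring
    simpa only [FiniteField.coe_frobeniusAlgHom] using this
  rw [h₃, negY_eq_aeval] at h₂
  linear_combination -h₁ - h₂

theorem aeval_frobAddNum (h : Affine.Equation (W.map (algebraMap K R)) x y) :
    aeval x W.frobAddNum = (W.map (algebraMap K R)).addXNum (x ^ 𝔮) (y ^ 𝔮) x y := by
  rw [addXNum_eq_even_sub (equation_pow_card h) h, map_a₁, map_a₃, ← aeval_linearPoly,
    ← aeval_linearPoly, pow_eq_aeval_yPow h, frobAddNum]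
  simp only [map_sub, map_add, map_mul, map_ofNat, aeval_addXNumEven, map_pow, aeval_X]
  linear_combination y * yPow_card_trace h + 2 * aeval x (W.yPow 𝔮).2 * sq_eq_aeval h

theorem aeval_frobSubNum (h : Affine.Equation (W.map (algebraMap K R)) x y) :
    aeval x W.frobSubNum = (W.map (algebraMap K R)).addXNum (x ^ 𝔮) (y ^ 𝔮) x
      (Affine.negY (W.map (algebraMap K R)) x y) := by
  rw [addXNum_eq_even_sub (equation_pow_card h) ((Affine.equation_neg ..).2 h), map_a₁, map_a₃,
    ← aeval_linearPoly, ← aeval_linearPoly, pow_eq_aeval_yPow h, frobSubNum, negY_eq_aeval]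
  simp only [map_sub, map_mul, map_ofNat, aeval_addXNumEven, map_pow, aeval_X]
  linear_combination -(y + aeval x W.linearPoly) * yPow_card_trace h
    - 2 * aeval x (W.yPow 𝔮).2 * sq_eq_aeval h

theorem sq_dvd_frobAddNum_mul_frobSubNum [Algebra K[X] R] [FaithfulSMul K[X] R]
    [IsScalarTower K K[X] R]
    (h : Affine.Equation (W.map (algebraMap K R)) (algebraMap K[X] R X) y) :
    (X ^ 𝔮 - X) ^ 2 ∣ W.frobAddNum * W.frobSubNum := by
  refine ⟨(X ^ 𝔮 * X) ^ 2 - C W.b₄ * (X ^ 𝔮 * X) - C W.b₆ * (X ^ 𝔮 + X) - C W.b₈,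
    FaithfulSMul.algebraMap_injective K[X] R ?_⟩
  rw [map_mul, algebraMap_eq_aeval_X, algebraMap_eq_aeval_X W.frobSubNum,
    aeval_frobAddNum h, aeval_frobSubNum h,
    addXNum_mul_addXNum_negY (equation_pow_card h) h]
  simp only [map_mul, map_sub, map_pow, map_add, map_b₄, map_b₆, map_b₈,
    ← algebraMap_eq, ← IsScalarTower.algebraMap_apply K K[X] R]
  ring

end Eval

end Fraction

end Frobenius

section Fibers

open Polynomial

variable {K : Type*} [Field K]

theorem fiber_eq_pair {W : WeierstrassCurve K} {a b : K} (h : Affine.Equation W a b) :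
    {b : K | Affine.Equation W a b} = {b, Affine.negY W a b} := by
  ext d
  refine ⟨fun hd => Affine.Y_eq_of_X_eq hd h rfl, ?_⟩
  rintro (rfl | rfl)
  · exact h
  · exact (Affine.equation_neg ..).2 h

variable [Fintype K] (W : WeierstrassCurve K)

local notation "𝔮" => Fintype.card K

theorem prod_X_sub_C_univ : ∏ a : K, (X - C a) = X ^ 𝔮 - X := by
  have h := FiniteField.X_pow_card_sub_X_natDegree_eq K (Fintype.one_lt_card (α := K))
  have hroots := FiniteField.roots_X_pow_card_sub_X K
  have := prod_multiset_X_sub_C_of_monic_of_roots_card_eq (p := (X ^ 𝔮 - X : K[X]))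
    (monic_X_pow_sub (degree_X_le.trans_lt (by exact_mod_cast Fintype.one_lt_card)))
    (by rw [hroots, h]; rfl)
  rw [hroots] at this
  exact this

theorem exists_algebraMap_eq_of_pow_card {F : Type*} [Field F] [Algebra K F] {y : F}
    (hy : y ^ 𝔮 = y) : ∃ b : K, algebraMap K F b = y := by
  have := congr_arg (aeval y) (prod_X_sub_C_univ (K := K))
  simp only [map_prod, map_sub, map_pow, aeval_X, aeval_C, hy, sub_self] at this
  obtain ⟨b, -, hb⟩ := Finset.prod_eq_zero_iff.1 this
  exact ⟨b, (sub_eq_zero.1 hb).symm⟩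

/-- The number of rational points with given `x`-coordinate. -/
noncomputable def fiberCard (a : K) : ℕ := {b : K | Affine.Equation W a b}.ncard

variable {W}

theorem fiberCard_le_two (a : K) : W.fiberCard a ≤ 2 := by
  by_cases h : ∃ b, Affine.Equation W a b
  · obtain ⟨b, hb⟩ := h
    rw [fiberCard, fiber_eq_pair hb]
    exact (Set.ncard_insert_le ..).trans (by rw [Set.ncard_singleton])
  · push Not at h
    simp [fiberCard, h]

theorem eval_frobAddNum {a b : K} (h : Affine.Equation W a b) : W.frobAddNum.eval a = 0 := by
  have := aeval_frobAddNum (R := K) (W := W) (x := a) (y := b) (by simpa using h)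
  rw [FiniteField.pow_card, FiniteField.pow_card, coe_aeval_eq_eval] at this
  rw [this, addXNum]
  ring

theorem eval_frobSubNum {a b : K} (h : Affine.Equation W a b) :
    W.frobSubNum.eval a = (b - Affine.negY W a b) ^ 2 := by
  have := aeval_frobSubNum (R := K) (W := W) (x := a) (y := b) (by simpa using h)
  rw [FiniteField.pow_card, FiniteField.pow_card, coe_aeval_eq_eval] at this
  rw [this, addXNum, Algebra.algebraMap_self, map_id]
  ring

theorem eval_frobAddNum_ne_zero {a : K} (h : ∀ b, ¬ Affine.Equation W a b) :
    W.frobAddNum.eval a ≠ 0 := by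
  let F := AlgebraicClosure K
  obtain ⟨y, hy⟩ : ∃ y : F, Affine.Equation (W.map (algebraMap K F)) (algebraMap K F a) y := by
    let V := W.map (algebraMap K F)
    let x := algebraMap K F a
    obtain ⟨y, hy⟩ := IsAlgClosed.exists_root (X ^ 2 + C (V.a₁ * x + V.a₃) * X
      - C (x ^ 3 + V.a₂ * x ^ 2 + V.a₄ * x + V.a₆)) (by
        rw [show degree _ = 2 by compute_degree!]
        exact two_ne_zero)
    refine ⟨y, (Affine.equation_iff ..).2 ?_⟩
    simp only [IsRoot, eval_sub, eval_add, eval_mul, eval_pow, eval_X, eval_C] at hy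
    linear_combination hy
  have hx : algebraMap K F a ^ 𝔮 = algebraMap K F a := by rw [← map_pow, FiniteField.pow_card]
  intro h0
  have := aeval_frobAddNum hy
  rw [aeval_algebraMap_apply, coe_aeval_eq_eval, h0, map_zero, hx, addXNum] at this
  obtain ⟨b, rfl⟩ := exists_algebraMap_eq_of_pow_card (y := y) (sub_eq_zero.1
    (pow_eq_zero_iff two_ne_zero |>.1 (by linear_combination -this)))
  exact h b ((Affine.map_equation _ (algebraMap K F).injective a b).1 hy)

theorem X_sub_C_pow_dvd (h : (X ^ 𝔮 - X) ^ 2 ∣ W.frobAddNum * W.frobSubNum) (a : K) :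
    (X - C a) ^ W.fiberCard a ∣ W.frobAddNum ∧
      (X - C a) ^ (2 - W.fiberCard a) ∣ W.frobSubNum := by
  have hsq : (X - C a) ^ 2 ∣ W.frobAddNum * W.frobSubNum := by
    refine (pow_dvd_pow_of_dvd ?_ 2).trans h
    rw [← prod_X_sub_C_univ]
    exact Finset.dvd_prod_of_mem _ (Finset.mem_univ a)
  have hcop {p : K[X]} (hp : p.eval a ≠ 0) : IsCoprime ((X - C a) ^ 2) p :=
    (((irreducible_X_sub_C a).coprime_iff_not_dvd).2 (by rwa [dvd_iff_isRoot])).pow_left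
  by_cases hb : ∃ b, Affine.Equation W a b
  · obtain ⟨b, hb⟩ := hb
    rw [fiberCard, fiber_eq_pair hb]
    by_cases hb' : b = Affine.negY W a b
    · rw [← hb', Set.pair_eq_singleton, Set.ncard_singleton, pow_one, dvd_iff_isRoot,
        dvd_iff_isRoot]
      exact ⟨eval_frobAddNum hb, by rw [IsRoot, eval_frobSubNum hb, ← hb', sub_self, sq, zero_mul]⟩
    · rw [Set.ncard_pair hb', pow_zero]
      refine ⟨(hcop ?_).dvd_of_dvd_mul_right hsq, one_dvd _⟩
      rw [eval_frobSubNum hb]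
      exact pow_ne_zero 2 (sub_ne_zero.2 hb')
  · push Not at hb
    have : W.fiberCard a = 0 := by simp [fiberCard, hb]
    rw [this, pow_zero]
    exact ⟨one_dvd _, (hcop (eval_frobAddNum_ne_zero hb)).dvd_of_dvd_mul_left hsq⟩

theorem prod_X_sub_C_pow_dvd {e : K → ℕ} {p : K[X]} (h : ∀ a, (X - C a) ^ e a ∣ p) :
    ∏ a, (X - C a) ^ e a ∣ p :=
  Finset.prod_dvd_of_coprime
    (fun _ _ _ _ hab => (pairwise_coprime_X_sub_C Function.injective_id hab).pow) fun a _ => h a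

theorem natDegree_prod_X_sub_C_pow (e : K → ℕ) :
    (∏ a, (X - C a) ^ e a).natDegree = ∑ a, e a := by
  rw [natDegree_prod_of_monic _ _ fun a _ => (monic_X_sub_C a).pow _]
  simp

end Fibers

section Hasse

open Polynomial

variable {K : Type*} [Field K] [Fintype K] {W : WeierstrassCurve K} [W.IsElliptic]
  {L : Type*} [Field L] [Algebra K L] [Algebra K[X] L] [FaithfulSMul K[X] L]
  [IsScalarTower K K[X] L]

local notation "𝔮" => Fintype.card K

theorem sum_fiberCard_sq_le {y : L}
    (h : Affine.Equation (W.map (algebraMap K L)) (algebraMap K[X] L X) y) :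
    (((1 + ∑ a, W.fiberCard a : ℕ) : ℤ) - (𝔮 + 1)) ^ 2 ≤ 4 * 𝔮 := by
  classical
  have hinj := FaithfulSMul.algebraMap_injective K[X] L
  have hP := (Affine.equation_iff_nonsingular ..).1 h
  have hQ := (Affine.equation_iff_nonsingular ..).1 (equation_pow_card h)
  set P := Affine.Point.some _ _ hP with hPdef
  set Q := Affine.Point.some _ _ hQ with hQdef
  have hT : (X ^ 𝔮 - X : K[X]) ≠ 0 := FiniteField.X_pow_card_sub_X_ne_zero K Fintype.one_lt_card
  have hTL : algebraMap K[X] L X ^ 𝔮 - algebraMap K[X] L X ≠ 0 := by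
    rw [← map_pow, ← map_sub]
    exact (map_ne_zero_iff _ hinj).2 hT
  have hxne := sub_ne_zero.1 hTL
  have hP1 : HasXHeight P 1 := by
    have := isSupDegree_max_natDegree (isCoprime_one_right (x := (X : K[X])))
    rw [natDegree_X, natDegree_one] at this
    exact ⟨X, 1, isCoprime_one_right, ⟨1, one_ne_zero, by simp [hPdef], by simp [hPdef]⟩, this⟩
  have hQq : HasXHeight Q 𝔮 := by
    have := isSupDegree_max_natDegree (isCoprime_one_right (x := (X ^ 𝔮 : K[X])))
    rw [natDegree_X_pow, natDegree_one, max_eq_left (Nat.zero_le _)] at this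
    exact ⟨X ^ 𝔮, 1, isCoprime_one_right, ⟨1, one_ne_zero, by simp [hQdef], by simp [hQdef]⟩, this⟩
  have hadd : IsXRatio (Q + P) W.frobAddNum ((X ^ 𝔮 - X) ^ 2) := by
    refine ⟨(algebraMap K[X] L X ^ 𝔮 - algebraMap K[X] L X) ^ 2, pow_ne_zero 2 hTL, ?_, ?_⟩
    · rw [hPdef, hQdef, Affine.Point.add_some (fun h => hxne h.1), Affine.Point.xRep_some,
        Affine.Point.addX_slope_eq_addXNum_div hxne, algebraMap_eq_aeval_X, aeval_frobAddNum h]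
      simp [mul_div_cancel₀ _ (pow_ne_zero 2 hTL)]
    · rw [hPdef, hQdef, Affine.Point.add_some (fun h => hxne h.1), Affine.Point.xRep_some]
      simp
  have hsub : IsXRatio (Q - P) W.frobSubNum ((X ^ 𝔮 - X) ^ 2) := by
    refine ⟨(algebraMap K[X] L X ^ 𝔮 - algebraMap K[X] L X) ^ 2, pow_ne_zero 2 hTL, ?_, ?_⟩
    · rw [sub_eq_add_neg Q, hPdef, hQdef, Affine.Point.neg_some,
        Affine.Point.add_some (fun h => hxne h.1), Affine.Point.xRep_some,
        Affine.Point.addX_slope_eq_addXNum_div hxne, algebraMap_eq_aeval_X, aeval_frobSubNum h]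
      simp [mul_div_cancel₀ _ (pow_ne_zero 2 hTL)]
    · rw [sub_eq_add_neg Q, hPdef, hQdef, Affine.Point.neg_some,
        Affine.Point.add_some (fun h => hxne h.1), Affine.Point.xRep_some]
      simp
  have hdvd := X_sub_C_pow_dvd (sq_dvd_frobAddNum_mul_frobSubNum h)
  obtain ⟨r, hr⟩ := prod_X_sub_C_pow_dvd fun a => (hdvd a).1
  obtain ⟨s, hs⟩ := prod_X_sub_C_pow_dvd fun a => (hdvd a).2
  have hprod : (X ^ 𝔮 - X : K[X]) ^ 2 =
      (∏ a, (X - C a) ^ W.fiberCard a) * ∏ a, (X - C a) ^ (2 - W.fiberCard a) := by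
    rw [← prod_X_sub_C_univ, ← Finset.prod_pow, ← Finset.prod_mul_distrib]
    refine Finset.prod_congr rfl fun a _ => ?_
    rw [← pow_add, Nat.add_sub_cancel' (fiberCard_le_two a)]
  have hdeg₁ := natDegree_prod_X_sub_C_pow W.fiberCard
  have hdeg₂ := natDegree_prod_X_sub_C_pow fun a => 2 - W.fiberCard a
  have hsum : ∑ a, W.fiberCard a + ∑ a, (2 - W.fiberCard a) = 2 * 𝔮 := by
    rw [← Finset.sum_add_distrib, Finset.sum_congr rfl fun a _ =>
      Nat.add_sub_cancel' (fiberCard_le_two a)]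
    simp [mul_comm]
  have h₁ := W.natDegree_frobAddNum_le
  have h₂ := W.natDegree_frobSubNum_le
  have hne := hprod ▸ pow_ne_zero 2 hT
  generalize ∏ a, (X - C a) ^ W.fiberCard a = D at *
  generalize ∏ a, (X - C a) ^ (2 - W.fiberCard a) = E at *
  have hD := left_ne_zero_of_mul hne
  have hE := right_ne_zero_of_mul hne
  rw [hr, hprod] at hadd
  rw [hs, hprod, mul_comm D] at hsub
  have hadd' := hadd.of_mul_left hD
  have hsub' := hsub.of_mul_left hE
  obtain ⟨k, hk, hk'⟩ := hsub'.exists_hasXHeight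
  obtain ⟨l, hl, hl'⟩ := hQq.exists_add hP1 hk
  have hl'' := hl.le_of_isXRatio hadd'
  have hrdeg : r.natDegree ≤ 2 * 𝔮 + 1 - D.natDegree := by
    rcases eq_or_ne r 0 with rfl | hr0
    · simp
    · rw [hr, natDegree_mul hD hr0] at h₁
      lia
  have hsdeg : s.natDegree ≤ 2 * 𝔮 + 1 - E.natDegree := by
    rcases eq_or_ne s 0 with rfl | hs0
    · simp
    · rw [hs, natDegree_mul hE hs0] at h₂
      lia
  have hkN : k = 1 + ∑ a, W.fiberCard a := by
    rw [hdeg₁] at hrdeg hk'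
    rw [hdeg₂] at hsdeg hl''
    lia
  rw [← hkN]
  exact hP1.sub_sq_le hQq hk

end Hasse

section Generic

open Polynomial

variable {K : Type*} [Field K] (W : WeierstrassCurve K)

theorem equation_functionField :
    Affine.Equation (W.map (algebraMap K (Affine.FunctionField W)))
      (algebraMap K[X] (Affine.FunctionField W) X)
      (algebraMap (Affine.CoordinateRing W) _ (Affine.CoordinateRing.mk W X)) := by
  let φ := (algebraMap (Affine.CoordinateRing W) (Affine.FunctionField W)).comp
    (Affine.CoordinateRing.mk W : _ →+* _)
  have hC (p : K[X]) : algebraMap K[X] (Affine.FunctionField W) p = φ (C p) := rfl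
  have hCC (a : K) : algebraMap K (Affine.FunctionField W) a = φ (C (C a)) := rfl
  have h : φ (X ^ 2 + C (C W.a₁ * X + C W.a₃) * X
      - C (X ^ 3 + C W.a₂ * X ^ 2 + C W.a₄ * X + C W.a₆)) = 0 :=
    (congr_arg (algebraMap (Affine.CoordinateRing W) (Affine.FunctionField W))
      AdjoinRoot.mk_self).trans (map_zero _)
  simp only [map_add, map_sub, map_mul, map_pow] at h
  rw [Affine.equation_iff]
  simp only [map_a₁, map_a₂, map_a₃, map_a₄, map_a₆, hC, hCC]
  change φ X ^ 2 + _ * φ X + _ * φ X = _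
  linear_combination h

theorem ptCount_eq [Fintype K] : ptCount K W = 1 + ∑ a, W.fiberCard a := by
  classical
  simp only [ptCount, fiberCard, ← Nat.card_coe_set_eq, Set.coe_ofPred, Affine.equation_iff]
  rw [← Nat.card_sigma]
  congr 1
  refine Nat.card_congr ⟨fun P => ⟨P.1.1, P.1.2, P.2⟩, fun P => ⟨(P.1, P.2.1), P.2.2⟩,
    fun _ => rfl, fun _ => rfl⟩

end Generic

end WeierstrassCurve

/-- **Hasse's theorem for elliptic curves**: if `K` is a finite field with `q` elements and
`W` is a smooth Weierstrass curve over `K`, then the number `N` of `K`-rational points of `W`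
satisfies `|N − (q + 1)| ≤ 2√q`, i.e. `((N : ℤ) − (q + 1))² ≤ 4q`. -/
theorem hasse_elliptic (K : Type*) [Field K] [Fintype K] (q : ℕ) (hq : Fintype.card K = q)
    (W : WeierstrassCurve K) (hW : W.Δ ≠ 0) :
    ((WeierstrassCurve.ptCount K W : ℤ) - (q + 1)) ^ 2 ≤ 4 * q := by
  have : W.IsElliptic := ⟨hW.isUnit⟩
  rw [WeierstrassCurve.ptCount_eq, ← hq]
  exact WeierstrassCurve.sum_fiberCard_sq_le W.equation_functionField
end

section
/- Existence of a Weil number for an elliptic curve: if K is a finite field with q elements and W is a smooth Weierstrass curve over K, then there exists a complex number α with α·ᾱ = q such that for every finite field extension L of K of degree n, the number of L-rational points of the base change of W to L equals qⁿ + 1 − αⁿ − ᾱⁿ. -/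
open Polynomial
open scoped Polynomial.Bivariate

/-! ### Dedekind domains from invertible maximal ideals -/

section Invertible

variable {A : Type*} [CommRing A] [IsDomain A] [IsNoetherianRing A]

theorem Ideal.exists_mul_eq_span_singleton_of_forall_isMaximal
    (h : ∀ M : Ideal A, M.IsMaximal → M ≠ ⊥ → ∃ (J : Ideal A) (x : A), x ≠ 0 ∧ M * J = span {x})
    (I : Ideal A) (hI : I ≠ ⊥) : ∃ (J : Ideal A) (x : A), x ≠ 0 ∧ I * J = span {x} := by
  induction I using IsNoetherian.induction with
  | hgt I ih =>
    by_cases htop : I = ⊤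
    · exact ⟨⊤, 1, one_ne_zero, by simp [htop]⟩
    obtain ⟨M, hM, hIM⟩ := Ideal.exists_le_maximal I htop
    obtain ⟨M', g, hg, hMg⟩ := h M hM fun h => hI (le_bot_iff.mp (h ▸ hIM))
    have hle : I * M' ≤ span {g} := hMg ▸ mul_mono_left hIM
    obtain ⟨I', hI'⟩ : ∃ I', span {g} * I' = I * M' := by
      refine ⟨(I * M').comap (LinearMap.mulLeft A g), ?_⟩
      ext z
      simp only [mem_span_singleton_mul, Submodule.mem_comap, LinearMap.mulLeft_apply]
      constructor
      · rintro ⟨w, hw, rfl⟩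
        exact hw
      · intro hz
        obtain ⟨w, rfl⟩ := mem_span_singleton'.mp (hle hz)
        exact ⟨w, by simpa [mul_comm] using hz, mul_comm _ _⟩
    have hIMM : span {g} * (I' * M) = span {g} * I := by
      rw [← mul_assoc, hI', mul_assoc, mul_comm M', hMg, mul_comm]
    have hI'M : I' * M = I := span_singleton_mul_right_injective hg hIMM
    have hII' : I < I' := by
      refine lt_of_le_of_ne (hI'M ▸ mul_le_left) fun heq => ?_
      rw [← heq] at hI'M
      obtain ⟨r, hr, hrI⟩ := Submodule.exists_sub_one_mem_and_smul_eq_zero_of_fg_of_le_smul M I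
        (IsNoetherian.noetherian I) (by rw [smul_eq_mul, mul_comm, hI'M])
      obtain ⟨a, ha, ha0⟩ := Submodule.exists_mem_ne_zero_of_ne_bot hI
      have : r = 0 := (mul_eq_zero.mp (hrI a ha)).resolve_right ha0
      rw [this, zero_sub, neg_mem_iff] at hr
      exact hM.ne_top ((eq_top_iff_one M).mpr hr)
    obtain ⟨J', x, hx, hJx⟩ := ih I' hII' fun h => hI (le_bot_iff.mp (h ▸ hII'.le))
    refine ⟨M' * J', g * x, mul_ne_zero hg hx, ?_⟩
    rw [← mul_assoc, ← hI', mul_assoc, hJx, span_singleton_mul_span_singleton]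

theorem IsDedekindDomain.of_forall_isMaximal_exists_mul_eq_span_singleton
    (h : ∀ M : Ideal A, M.IsMaximal → M ≠ ⊥ →
      ∃ (J : Ideal A) (x : A), x ≠ 0 ∧ M * J = Ideal.span {x}) :
    IsDedekindDomain A := by
  rw [isDedekindDomain_iff_mul_inv_cancel (K := FractionRing A)]
  intro I hI
  obtain ⟨a, J, ha, rfl⟩ := FractionalIdeal.exists_eq_spanSingleton_mul (K := FractionRing A) I
  have hJ : J ≠ ⊥ := by rintro rfl; simp at hI
  obtain ⟨J', x, hx, hJx⟩ := J.exists_mul_eq_span_singleton_of_forall_isMaximal h hJ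
  have ha' : algebraMap A (FractionRing A) a ≠ 0 := by simpa
  have hx' : algebraMap A (FractionRing A) x ≠ 0 := by simpa
  rw [FractionalIdeal.mul_inv_cancel_iff]
  refine ⟨FractionalIdeal.spanSingleton (nonZeroDivisors A)
    (algebraMap A (FractionRing A) a * (algebraMap A _ x)⁻¹) *
    (J' : FractionalIdeal (nonZeroDivisors A) (FractionRing A)), ?_⟩
  rw [mul_mul_mul_comm, ← FractionalIdeal.coeIdeal_mul, hJx, FractionalIdeal.coeIdeal_span_singleton,
    FractionalIdeal.spanSingleton_mul_spanSingleton, FractionalIdeal.spanSingleton_mul_spanSingleton,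
    inv_mul_cancel_left₀ ha', inv_mul_cancel₀ hx', FractionalIdeal.spanSingleton_one]

end Invertible

namespace WeierstrassCurve.Affine.CoordinateRing

variable {F : Type*} [Field F] {W : Affine F}

instance : Module.Finite F[X] W.CoordinateRing := .of_basis (CoordinateRing.basis W)

/-! ### The pole order at infinity -/

/-- The pole order at infinity of a regular function on the affine Weierstrass curve. -/
noncomputable def poleOrder (f : W.CoordinateRing) : ℕ := (Algebra.norm F[X] f).natDegree

@[simp]
lemma poleOrder_zero : poleOrder (0 : W.CoordinateRing) = 0 := by
  simp [poleOrder, Algebra.norm_zero]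

lemma poleOrder_mul {f g : W.CoordinateRing} (hf : f ≠ 0) (hg : g ≠ 0) :
    poleOrder (f * g) = poleOrder f + poleOrder g := by
  rw [poleOrder, map_mul, natDegree_mul (by simpa [Algebra.norm_eq_zero_iff])
    (by simpa [Algebra.norm_eq_zero_iff])]
  rfl

lemma poleOrder_pow (f : W.CoordinateRing) (n : ℕ) : poleOrder (f ^ n) = n * poleOrder f := by
  simp [poleOrder, natDegree_pow]

lemma finrank_quotient_span_singleton {f : W.CoordinateRing} (hf : f ≠ 0) :
    Module.finrank F (W.CoordinateRing ⧸ Ideal.span {f}) = poleOrder f :=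
  finrank_quotient_span_eq_natDegree_norm (CoordinateRing.basis W) hf

lemma poleOrder_smul_basis_le_iff {p q : F[X]} {m : ℕ} :
    poleOrder (p • (1 : W.CoordinateRing) + q • mk W Y) ≤ m ↔
      p ∈ degreeLT F (m / 2 + 1) ∧ q ∈ degreeLT F ((m - 1) / 2) := by
  rw [poleOrder, natDegree_le_iff_degree_le, degree_norm_smul_basis, max_le_iff, mem_degreeLT,
    mem_degreeLT]
  refine and_congr ?_ ?_
  · rcases eq_or_ne p 0 with rfl | hp
    · simp
    · rw [degree_eq_natDegree hp, nsmul_eq_mul]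
      norm_cast
      omega
  · rcases eq_or_ne q 0 with rfl | hq
    · simp
    · rw [degree_eq_natDegree hq, nsmul_eq_mul]
      norm_cast
      omega

variable (W) in
/-- The regular function `p(X) + q(X) Y` on the affine Weierstrass curve. -/
noncomputable def ofProd : (F[X] × F[X]) →ₗ[F] W.CoordinateRing :=
  ((LinearMap.toSpanSingleton F[X] W.CoordinateRing 1).coprod
    (LinearMap.toSpanSingleton F[X] W.CoordinateRing (mk W Y))).restrictScalars F

lemma ofProd_apply (p : F[X] × F[X]) :
    ofProd W p = p.1 • (1 : W.CoordinateRing) + p.2 • mk W Y := rfl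

lemma ofProd_injective : Function.Injective (ofProd W) :=
  (injective_iff_map_eq_zero _).mpr fun _ hp =>
    Prod.ext (smul_basis_eq_zero hp).1 (smul_basis_eq_zero hp).2

lemma ofProd_surjective : Function.Surjective (ofProd W) := fun f => by
  obtain ⟨p, q, h⟩ := exists_smul_basis_eq f
  exact ⟨(p, q), h⟩

variable (W) in
/-- The regular functions whose pole order at infinity is at most `m`. -/
noncomputable def poleLE (m : ℕ) : Submodule F W.CoordinateRing :=
  LinearMap.range (ofProd W ∘ₗ
    (degreeLT F (m / 2 + 1)).subtype.prodMap (degreeLT F ((m - 1) / 2)).subtype)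

lemma mem_poleLE {m : ℕ} {f : W.CoordinateRing} : f ∈ poleLE W m ↔ poleOrder f ≤ m := by
  obtain ⟨p, rfl⟩ := ofProd_surjective f
  conv_rhs => rw [ofProd_apply, poleOrder_smul_basis_le_iff]
  constructor
  · rintro ⟨⟨a, b⟩, h⟩
    obtain rfl := ofProd_injective h
    exact ⟨a.2, b.2⟩
  · rintro ⟨h₁, h₂⟩
    exact ⟨(⟨_, h₁⟩, ⟨_, h₂⟩), rfl⟩

instance (n : ℕ) : Module.Finite F (degreeLT F n) := .equiv (degreeLTEquiv F n).symm

instance (m : ℕ) : Module.Finite F (poleLE W m) := Module.Finite.range _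

lemma finrank_poleLE {m : ℕ} (hm : 0 < m) : Module.finrank F (poleLE W m) = m := by
  have h (n : ℕ) : Module.finrank F (degreeLT F n) = n := by
    simp [(degreeLTEquiv F n).finrank_eq]
  rw [poleLE, LinearMap.finrank_range_of_inj, Module.finrank_prod, h, h]
  · omega
  · rw [LinearMap.coe_comp]
    exact ofProd_injective.comp
      (Function.Injective.prodMap Subtype.val_injective Subtype.val_injective)

lemma natCard_poleLE [Finite F] {m : ℕ} (hm : 0 < m) :
    Nat.card (poleLE W m) = Nat.card F ^ m := by
  rw [Module.natCard_eq_pow_finrank (K := F), finrank_poleLE hm]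

lemma poleOrder_algebraMap (c : F) : poleOrder (algebraMap F W.CoordinateRing c) = 0 := by
  rw [poleOrder, IsScalarTower.algebraMap_apply F F[X], Algebra.norm_algebraMap]
  simp

lemma exists_algebraMap_eq_of_poleOrder_eq_zero {f : W.CoordinateRing} (hf : poleOrder f = 0) :
    ∃ c : F, algebraMap F W.CoordinateRing c = f := by
  obtain ⟨p, rfl⟩ := ofProd_surjective f
  have := (poleOrder_smul_basis_le_iff (W := W)).mp (ofProd_apply p ▸ hf.le)
  simp only [mem_degreeLT, Nat.zero_div, zero_add, Nat.zero_sub, Nat.cast_zero, Nat.cast_one] at this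
  obtain ⟨c, hc⟩ : ∃ c, p.1 = C c :=
    ⟨_, eq_C_of_degree_le_zero (Nat.WithBot.lt_one_iff_le_zero.mp this.1)⟩
  have h2 : p.2 = 0 := by simpa [Nat.WithBot.lt_zero_iff] using this.2
  exact ⟨c, by rw [ofProd_apply, hc, h2, zero_smul, add_zero, ← algebraMap_eq, algebraMap_smul,
    Algebra.algebraMap_eq_smul_one]⟩

end WeierstrassCurve.Affine.CoordinateRing

namespace WeierstrassCurve.Affine.CoordinateRing

variable {F : Type*} [Field F] {W : Affine F}

/-! ### The coordinate ring of a smooth curve is a Dedekind domain -/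

lemma not_dvd_polynomialY_of_sq_dvd_eval (hW : W.Δ ≠ 0) {g u : F[X]} (hg : Irreducible g)
    (hu : g ^ 2 ∣ W.polynomial.eval u) : ¬ g ∣ W.polynomialY.eval u := by
  intro hY
  have : Fact (Irreducible g) := ⟨hg⟩
  have hE : g ∣ W.polynomial.eval u := (dvd_pow_self g two_ne_zero).trans hu
  have hX : g ∣ W.polynomialX.eval u := by
    have hd : g ∣ derivative (W.polynomial.eval u) := by
      obtain ⟨t, ht⟩ := hu
      rw [ht, derivative_mul, derivative_pow]
      refine dvd_add ⟨C ((2 : ℕ) : F) * derivative g * t, by ring⟩ ⟨g * derivative t, by ring⟩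
    have key : derivative (W.polynomial.eval u) =
        W.polynomialX.eval u + W.polynomialY.eval u * derivative u := by
      simp only [polynomial, polynomialX, polynomialY, eval_add, eval_sub, eval_mul, eval_pow, eval_X,
        eval_C, derivative_add, derivative_sub, derivative_mul, derivative_pow, derivative_C,
        derivative_X, C_mul]
      simp only [map_ofNat, Nat.cast_ofNat]
      ring
    exact (dvd_add_left (hY.mul_right _)).mp (key ▸ hd)
  rw [← AdjoinRoot.mk_eq_zero] at hE hX hY
  have hns := (equation_iff_nonsingular_of_Δ_ne_zero
    (W := (W.map (AdjoinRoot.of g)).toAffine) (x := AdjoinRoot.root g) (y := AdjoinRoot.mk g u)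
    (by rw [map_Δ]; simpa using hW)).mp (by
      rw [equation_iff']
      simp [polynomial] at hE ⊢
      linear_combination hE)
  rw [nonsingular_iff'] at hns
  rcases hns.2 with h | h
  · refine h ?_
    simp only [polynomialX, map_ofNat C, eval_add, eval_sub, eval_mul, eval_pow, eval_X, eval_C,
      map_sub, map_add, map_mul, map_pow, map_ofNat, AdjoinRoot.mk_X, AdjoinRoot.mk_C, map_a₁, map_a₂,
      map_a₄, eval_ofNat] at hX ⊢
    linear_combination hX
  · refine h ?_
    simp only [polynomialY, map_ofNat C, eval_add, eval_mul, eval_X, eval_C,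
      map_add, map_mul, map_ofNat, AdjoinRoot.mk_X, AdjoinRoot.mk_C, map_a₁, map_a₃,
      eval_ofNat] at hY ⊢
    linear_combination hY

lemma algebraMap_eq_mk (p : F[X]) : algebraMap F[X] W.CoordinateRing p = mk W (C p) := rfl

lemma YClass_mul_YClass (u : F[X]) : YClass W u * YClass W (-u - (C W.a₁ * X + C W.a₃)) =
    algebraMap F[X] W.CoordinateRing (-(W.polynomial.eval u)) := by
  rw [algebraMap_eq_mk, YClass, YClass, ← map_mul]
  refine AdjoinRoot.mk_eq_mk.mpr ⟨1, ?_⟩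
  simp only [polynomial, eval_add, eval_sub, eval_mul, eval_pow, eval_X, eval_C,
    C_neg, C_add, C_sub, C_mul, C_pow]
  ring1

lemma YClass_sub_YClass (u : F[X]) : YClass W u - YClass W (-u - (C W.a₁ * X + C W.a₃)) =
    algebraMap F[X] W.CoordinateRing (-(W.polynomialY.eval u)) := by
  rw [algebraMap_eq_mk, YClass, YClass, ← map_sub]
  congr 1
  simp only [polynomialY, map_ofNat C, eval_add, eval_mul, eval_X, eval_C, eval_ofNat,
    C_neg, C_add, C_sub, C_mul]
  ring1

lemma smul_basis_eq_add_mul_YClass (p q u : F[X]) : p • (1 : W.CoordinateRing) + q • mk W Y =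
    algebraMap F[X] W.CoordinateRing (p + q * u) +
      algebraMap F[X] W.CoordinateRing q * YClass W u := by
  rw [Algebra.smul_def, Algebra.smul_def, YClass, map_sub, map_add, map_mul, ← algebraMap_eq_mk]
  ring1

lemma exists_mul_eq_span_singleton_of_isPrime (hW : W.Δ ≠ 0) (M : Ideal W.CoordinateRing)
    [hM : M.IsPrime] (hM0 : M ≠ ⊥) :
    ∃ (J : Ideal W.CoordinateRing) (x : W.CoordinateRing), x ≠ 0 ∧ M * J = Ideal.span {x} := by
  have hP0 : M.comap (algebraMap F[X] W.CoordinateRing) ≠ ⊥ := by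
    obtain ⟨f, hf, hf0⟩ := Submodule.exists_mem_ne_zero_of_ne_bot hM0
    exact Ideal.comap_ne_bot_of_integral_mem hf0 hf (Algebra.IsIntegral.isIntegral f)
  obtain ⟨g, hg⟩ := IsPrincipalIdealRing.principal (M.comap (algebraMap F[X] W.CoordinateRing))
  have hg0 : g ≠ 0 := by rintro rfl; exact hP0 (by simpa using hg)
  have hmem (p : F[X]) : algebraMap F[X] W.CoordinateRing p ∈ M ↔ g ∣ p := by
    rw [← Ideal.mem_comap, hg]; exact Ideal.mem_span_singleton
  have hgirr : Irreducible g := by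
    have : (Ideal.span {g}).IsPrime := by
      have := hM.comap (algebraMap F[X] W.CoordinateRing)
      rwa [hg] at this
    exact ((Ideal.span_singleton_prime hg0).mp this).irreducible
  have hinj : Function.Injective (algebraMap F[X] W.CoordinateRing) :=
    FaithfulSMul.algebraMap_injective _ _
  have hgR : algebraMap F[X] W.CoordinateRing g ≠ 0 :=
    (map_ne_zero_iff _ hinj).mpr hg0
  have hgM : algebraMap F[X] W.CoordinateRing g ∈ M := (hmem g).mpr dvd_rfl
  have hcop {p : F[X]} (hp : ¬ g ∣ p) : ∃ a b : F[X], a * g + b * p = 1 :=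
    (hgirr.coprime_iff_not_dvd).mpr hp
  by_cases hY : ∃ u : F[X], YClass W u ∈ M
  · obtain ⟨u, hu⟩ := hY
    set v : F[X] := -u - (C W.a₁ * X + C W.a₃) with hv
    have hprod := YClass_mul_YClass (W := W) u
    have hsub := YClass_sub_YClass (W := W) u
    rw [← hv] at hprod hsub
    obtain ⟨t, ht⟩ := (hmem _).mp (hprod ▸ M.mul_mem_right _ hu)
    have hMeq : M = Ideal.span {algebraMap F[X] W.CoordinateRing g, YClass W u} := by
      refine le_antisymm (fun f hf => ?_) (Ideal.span_le.mpr (Set.pair_subset hgM hu))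
      obtain ⟨p, q, rfl⟩ := exists_smul_basis_eq f
      rw [smul_basis_eq_add_mul_YClass p q u] at hf ⊢
      obtain ⟨r, hr⟩ := (hmem _).mp ((Ideal.add_mem_iff_left _ (M.mul_mem_left _ hu)).mp hf)
      rw [hr, map_mul]
      exact Ideal.add_mem _ (Ideal.mul_mem_right _ _ (Ideal.subset_span (by simp)))
        (Ideal.mul_mem_left _ _ (Ideal.subset_span (by simp)))
    refine ⟨Ideal.span {algebraMap F[X] W.CoordinateRing g, YClass W v},
      algebraMap F[X] W.CoordinateRing g, hgR, le_antisymm ?_ ?_⟩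
    · rw [hMeq, Ideal.span_pair_mul_span_pair, hprod, ht, Ideal.span_le]
      simp only [Set.insert_subset_iff, Set.singleton_subset_iff, SetLike.mem_coe,
        Ideal.mem_span_singleton, map_mul]
      exact ⟨⟨_, rfl⟩, ⟨_, rfl⟩, ⟨_, mul_comm _ _⟩, ⟨_, rfl⟩⟩
    · rw [Ideal.span_singleton_le_iff_mem]
      set J := Ideal.span {algebraMap F[X] W.CoordinateRing g, YClass W v}
      have hgJ : algebraMap F[X] W.CoordinateRing g ∈ J := Ideal.subset_span (by simp)
      have hvJ : YClass W v ∈ J := Ideal.subset_span (by simp)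
      have hgg := Ideal.mul_mem_mul hgM hgJ
      have hfin {s : F[X]} (hs : ¬ g ∣ s) (hsM : algebraMap F[X] W.CoordinateRing (g * s) ∈ M * J) :
          algebraMap F[X] W.CoordinateRing g ∈ M * J := by
        obtain ⟨a, b, hab⟩ := hcop hs
        have : algebraMap F[X] W.CoordinateRing g = algebraMap F[X] W.CoordinateRing a *
            (algebraMap F[X] W.CoordinateRing g * algebraMap F[X] W.CoordinateRing g) +
            algebraMap F[X] W.CoordinateRing b * algebraMap F[X] W.CoordinateRing (g * s) := by
          simp only [← map_mul, ← map_add]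
          congr 1
          linear_combination -g * hab
        rw [this]
        exact Ideal.add_mem _ (Ideal.mul_mem_left _ _ hgg) (Ideal.mul_mem_left _ _ hsM)
      by_cases h1 : g ∣ W.polynomialY.eval u
      · refine hfin (s := t) (fun h2 => not_dvd_polynomialY_of_sq_dvd_eval hW hgirr ?_ h1) ?_
        · rw [← dvd_neg, ht, sq]
          exact mul_dvd_mul_left _ h2
        · rw [← ht, ← hprod]
          exact Ideal.mul_mem_mul hu hvJ
      · refine hfin (s := -(W.polynomialY.eval u)) (by rwa [dvd_neg]) ?_
        rw [map_mul, ← hsub, mul_sub]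
        exact Ideal.sub_mem _ (mul_comm (YClass W u) _ ▸ Ideal.mul_mem_mul hu hgJ)
          (Ideal.mul_mem_mul hgM hvJ)
  · push Not at hY
    refine ⟨⊤, algebraMap F[X] W.CoordinateRing g, hgR, ?_⟩
    rw [Ideal.mul_top]
    refine le_antisymm (fun f hf => ?_) ((Ideal.span_singleton_le_iff_mem _).mpr hgM)
    obtain ⟨p, q, rfl⟩ := exists_smul_basis_eq f
    have hq : g ∣ q := by
      by_contra hq
      obtain ⟨a, b, hab⟩ := hcop hq
      refine hY (-(b * p)) ?_
      have : YClass W (-(b * p)) = algebraMap F[X] W.CoordinateRing b *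
          (p • (1 : W.CoordinateRing) + q • mk W Y) +
          algebraMap F[X] W.CoordinateRing g * mk W (C a * Y) := by
        simp only [Algebra.smul_def, YClass, algebraMap_eq_mk, ← map_mul, ← map_add,
          ← map_one (mk W)]
        congr 1
        have := congr_arg (C : F[X] → F[X][Y]) hab
        simp only [map_add, map_mul, map_one] at this
        simp only [C_neg, C_mul]
        linear_combination -(Y : F[X][Y]) * this
      rw [this]
      exact Ideal.add_mem _ (Ideal.mul_mem_left _ _ hf) (Ideal.mul_mem_right _ _ hgM)
    rw [Ideal.mem_span_singleton]
    have hqY : algebraMap F[X] W.CoordinateRing g ∣ q • mk W Y := by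
      rw [Algebra.smul_def]
      exact (_root_.map_dvd _ hq).mul_right _
    have hp : g ∣ p := by
      rw [← hmem]
      have := (Ideal.add_mem_iff_left M (M.mem_of_dvd hqY hgM)).mp hf
      rwa [Algebra.smul_def, mul_one] at this
    exact dvd_add (by rw [Algebra.smul_def]; exact (_root_.map_dvd _ hp).mul_right _) hqY

lemma isDedekindDomain (hW : W.Δ ≠ 0) : IsDedekindDomain W.CoordinateRing :=
  have : IsNoetherianRing W.CoordinateRing := isNoetherian_of_tower F[X] inferInstance
  .of_forall_isMaximal_exists_mul_eq_span_singleton fun M hM hM0 =>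
    have := hM.isPrime
    exists_mul_eq_span_singleton_of_isPrime hW M hM0

end WeierstrassCurve.Affine.CoordinateRing

/-! ### Degrees of ideals and Newton's identity for the numbers of ideals of given degree -/

namespace Ideal

open UniqueFactorizationMonoid

variable (F : Type*) {A : Type*} [Field F] [CommRing A] [Algebra F A]

/-- The degree over `F` of an ideal of an `F`-algebra. -/
noncomputable def degree (I : Ideal A) : ℕ := Module.finrank F (A ⧸ I)

lemma degree_top : degree F (⊤ : Ideal A) = 0 := Module.finrank_zero_of_subsingleton

variable [Ring.HasFiniteQuotients A]

lemma cardQuot_eq_pow_degree {I : Ideal A} (hI : I ≠ ⊥) :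
    I.cardQuot = Nat.card F ^ I.degree F := by
  have := Ring.HasFiniteQuotients.finiteQuotient hI
  have : Module.Finite F (A ⧸ I) := .of_finite
  rw [Submodule.cardQuot_apply, Module.natCard_eq_pow_finrank (K := F), degree]

lemma finite_setOf_degree_eq (d : ℕ) : {I : Ideal A | I ≠ ⊥ ∧ I.degree F = d}.Finite := by
  refine (Ring.HasFiniteQuotients.finite_cardQuot_le (R := A) (Nat.card F ^ d)).subset ?_
  rintro I ⟨hI, rfl⟩
  exact (cardQuot_eq_pow_degree F hI).le

variable (A) in
/-- The nonzero ideals of degree `d`. -/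
noncomputable def ofDegree (d : ℕ) : Finset (Ideal A) := (finite_setOf_degree_eq F d).toFinset

variable {F} in
lemma mem_ofDegree {d : ℕ} {I : Ideal A} : I ∈ ofDegree F A d ↔ I ≠ ⊥ ∧ I.degree F = d := by
  simp [ofDegree]

open Classical in
variable (A) in
/-- The nonzero prime ideals whose degree divides `d`. -/
noncomputable def primesDvd (d : ℕ) : Finset (Ideal A) :=
  (d.divisors.biUnion (ofDegree F A)).filter Prime

variable {F} in
lemma mem_primesDvd {d : ℕ} (hd : d ≠ 0) {P : Ideal A} :
    P ∈ primesDvd F A d ↔ Prime P ∧ P.degree F ∣ d := by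
  simp only [primesDvd, Finset.mem_filter, Finset.mem_biUnion, Nat.mem_divisors, mem_ofDegree]
  constructor
  · rintro ⟨⟨a, ⟨h, -⟩, -, rfl⟩, h2⟩
    exact ⟨h2, h⟩
  · rintro ⟨h1, h2⟩
    exact ⟨⟨_, ⟨h2, hd⟩, h1.ne_zero, rfl⟩, h1⟩

variable [Finite F]

lemma degree_eq_zero_iff {I : Ideal A} (hI : I ≠ ⊥) : I.degree F = 0 ↔ I = ⊤ := by
  rw [← Submodule.cardQuot_eq_one_iff, cardQuot_eq_pow_degree F hI,
    Nat.pow_eq_one, or_iff_right Finite.one_lt_card.ne']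

lemma card_ofDegree_zero [Nontrivial A] : (ofDegree F A 0).card = 1 := by
  rw [Finset.card_eq_one]
  refine ⟨⊤, ?_⟩
  ext I
  rw [mem_ofDegree, Finset.mem_singleton]
  constructor
  · rintro ⟨h1, h2⟩
    exact (degree_eq_zero_iff F h1).mp h2
  · rintro rfl
    exact ⟨top_ne_bot, degree_top F⟩

lemma degree_pos_of_prime {P : Ideal A} (hP : Prime P) : 0 < P.degree F := by
  rw [Nat.pos_iff_ne_zero, Ne, degree_eq_zero_iff F hP.ne_zero]
  exact fun h => hP.not_isUnit (isUnit_iff.mpr h)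

variable [IsDedekindDomain A]

lemma cardQuot_mul_of_infinite {A : Type*} [CommRing A] [IsDedekindDomain A] [Infinite A]
    (I J : Ideal A) : (I * J).cardQuot = I.cardQuot * J.cardQuot :=
  multiplicative_of_coprime Submodule.cardQuot I J (Submodule.cardQuot_bot _ _)
    (fun {I J} hI => by simp [isUnit_iff.mp hI, mul_top])
    (fun {I} i hI =>
      have : IsPrime I := isPrime_of_prime hI
      cardQuot_pow_of_prime hI.ne_zero)
    fun {I J} hIJ => cardQuot_mul_of_coprime <| isCoprime_iff_sup_eq.mpr
      (isUnit_iff.mp (hIJ (dvd_iff_le.mpr le_sup_left) (dvd_iff_le.mpr le_sup_right)))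

variable [Infinite A]

lemma degree_mul {I J : Ideal A} (hI : I ≠ ⊥) (hJ : J ≠ ⊥) :
    (I * J).degree F = I.degree F + J.degree F := by
  have h := cardQuot_mul_of_infinite I J
  rw [cardQuot_eq_pow_degree F hI, cardQuot_eq_pow_degree F hJ,
    cardQuot_eq_pow_degree F (mul_ne_zero hI hJ), ← pow_add] at h
  exact Nat.pow_right_injective (Finite.one_lt_card (α := F)) h

lemma degree_pow {I : Ideal A} (hI : I ≠ ⊥) (k : ℕ) : (I ^ k).degree F = k * I.degree F := by
  induction k with
  | zero => simpa using degree_top F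
  | succ k ih => rw [pow_succ, degree_mul F (pow_ne_zero k hI) hI, ih]; ring

lemma degree_multiset_prod (s : Multiset (Ideal A)) (hs : ∀ I ∈ s, I ≠ ⊥) :
    s.prod.degree F = (s.map (degree F)).sum := by
  induction s using Multiset.induction_on with
  | empty => simpa using degree_top F
  | cons I s ih =>
    rw [Multiset.prod_cons, Multiset.map_cons, Multiset.sum_cons,
      degree_mul F (hs I (by simp)) (Multiset.prod_ne_zero fun h => hs 0 (Multiset.mem_cons_of_mem h) rfl),
      ih fun J hJ => hs J (Multiset.mem_cons_of_mem hJ)]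

lemma mul_degree_le_of_pow_dvd {I P : Ideal A} (hI : I ≠ ⊥) {k : ℕ} (h : P ^ k ∣ I) :
    k * P.degree F ≤ I.degree F := by
  obtain ⟨J, rfl⟩ := h
  have hJ : J ≠ ⊥ := right_ne_zero_of_mul hI
  rcases eq_or_ne k 0 with rfl | hk
  · simp
  have hP : P ≠ ⊥ := fun h => left_ne_zero_of_mul hI (by rw [h]; exact zero_pow hk)
  rw [degree_mul F (left_ne_zero_of_mul hI) hJ, degree_pow F hP]
  exact Nat.le_add_right _ _

open Classical in
lemma degree_eq_sum_count {I : Ideal A} (hI : I ≠ ⊥) :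
    I.degree F = ∑ P ∈ (normalizedFactors I).toFinset,
      ((Finset.Icc 1 (I.degree F)).filter (fun k => P ^ k ∣ I)).card * P.degree F := by
  conv_lhs => rw [← prod_normalizedFactors_eq_self hI,
    degree_multiset_prod F _ (fun J hJ => (prime_of_normalized_factor J hJ).ne_zero),
    Finset.sum_multiset_map_count]
  refine Finset.sum_congr rfl fun P hP => ?_
  have hP' : Prime P := prime_of_normalized_factor P (Multiset.mem_toFinset.mp hP)
  rw [smul_eq_mul]
  congr 1
  have hiff (k : ℕ) : P ^ k ∣ I ↔ k ≤ (normalizedFactors I).count P := by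
    rw [Multiset.le_count_iff_replicate_le, pow_dvd_iff_le_emultiplicity,
      le_emultiplicity_iff_replicate_le_normalizedFactors hP'.irreducible hI, normalize_eq]
  have : (Finset.Icc 1 (I.degree F)).filter (fun k => P ^ k ∣ I) =
      Finset.Icc 1 ((normalizedFactors I).count P) := by
    ext k
    rw [Finset.mem_filter, Finset.mem_Icc, Finset.mem_Icc, ← hiff]
    refine ⟨fun h => ⟨h.1.1, h.2⟩, fun h => ⟨⟨h.1, ?_⟩, h.2⟩⟩
    exact (Nat.le_mul_of_pos_right k (degree_pos_of_prime F hP')).trans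
      (mul_degree_le_of_pow_dvd F hI h.2)
  rw [this, Nat.card_Icc, Nat.add_sub_cancel]

open Classical in
lemma card_filter_pow_dvd {P : Ideal A} (hP : P ≠ ⊥) (k d : ℕ) :
    ((ofDegree F A d).filter (fun I => P ^ k ∣ I)).card =
      if k * P.degree F ≤ d then (ofDegree F A (d - k * P.degree F)).card else 0 := by
  split_ifs with h
  · refine (Finset.card_nbij (fun J => P ^ k * J) ?_ ?_ ?_).symm
    · intro J hJ
      rw [Finset.mem_coe, mem_ofDegree] at hJ
      rw [Finset.mem_coe, Finset.mem_filter, mem_ofDegree, degree_mul F (pow_ne_zero k hP) hJ.1, degree_pow F hP]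
      exact ⟨⟨mul_ne_zero (pow_ne_zero k hP) hJ.1, by omega⟩, dvd_mul_right _ _⟩
    · exact fun J _ J' _ h => mul_left_cancel₀ (pow_ne_zero k hP) h
    · intro I hI
      rw [Finset.mem_coe, Finset.mem_filter, mem_ofDegree] at hI
      obtain ⟨⟨hI, hd⟩, J, rfl⟩ := hI
      have hJ : J ≠ ⊥ := right_ne_zero_of_mul hI
      refine ⟨J, ?_, rfl⟩
      rw [degree_mul F (pow_ne_zero k hP) hJ, degree_pow F hP] at hd
      rw [Finset.mem_coe, mem_ofDegree]
      exact ⟨hJ, by omega⟩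
  · rw [Finset.card_eq_zero, Finset.filter_eq_empty_iff]
    intro I hI hdvd
    rw [mem_ofDegree] at hI
    exact h (hI.2 ▸ mul_degree_le_of_pow_dvd F hI.1 hdvd)

/-- Newton's identity for the numbers of ideals of given degree. -/
theorem mul_card_ofDegree (d : ℕ) : d * (ofDegree F A d).card =
    ∑ j ∈ Finset.Icc 1 d, (∑ P ∈ primesDvd F A j, P.degree F) * (ofDegree F A (d - j)).card := by
  classical
  let S : Finset (Ideal A) := ((Finset.Icc 1 d).biUnion (ofDegree F A)).filter Prime
  have hS {P : Ideal A} : P ∈ S ↔ Prime P ∧ P.degree F ≤ d := by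
    simp only [S, Finset.mem_filter, Finset.mem_biUnion, Finset.mem_Icc, mem_ofDegree]
    constructor
    · rintro ⟨⟨a, h, -, rfl⟩, h2⟩
      exact ⟨h2, h.2⟩
    · rintro ⟨h1, h2⟩
      exact ⟨⟨_, ⟨degree_pos_of_prime F h1, h2⟩, h1.ne_zero, rfl⟩, h1⟩
  have h1 : d * (ofDegree F A d).card = ∑ I ∈ ofDegree F A d, ∑ P ∈ S, ∑ k ∈ Finset.Icc 1 d,
      if P ^ k ∣ I then P.degree F else 0 := by
    rw [mul_comm, ← smul_eq_mul, ← Finset.sum_const]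
    refine Finset.sum_congr rfl fun I hI => ?_
    obtain ⟨hI0, rfl⟩ := mem_ofDegree.mp hI
    conv_lhs => rw [degree_eq_sum_count F hI0]
    simp_rw [← Finset.sum_filter, Finset.sum_const, smul_eq_mul]
    refine Finset.sum_subset (fun P hP => ?_) fun P hP hPI => ?_
    · have := Multiset.mem_toFinset.mp hP
      refine hS.mpr ⟨prime_of_normalized_factor P this, ?_⟩
      simpa using mul_degree_le_of_pow_dvd F (k := 1) hI0
        (by simpa using dvd_of_mem_normalizedFactors this)
    · rw [Finset.card_eq_zero.mpr, zero_mul]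
      refine Finset.filter_eq_empty_iff.mpr fun k hk hdvd => hPI (Multiset.mem_toFinset.mpr ?_)
      rw [UniqueFactorizationMonoid.mem_normalizedFactors_iff hI0]
      exact ⟨(hS.mp hP).1, (dvd_pow_self P (by grind)).trans hdvd⟩
  have h2 {P : Ideal A} (hP : P ∈ S) : ∑ k ∈ Finset.Icc 1 d,
      (if k * P.degree F ≤ d then (ofDegree F A (d - k * P.degree F)).card else 0) * P.degree F =
      ∑ j ∈ Finset.Icc 1 d,
        if P.degree F ∣ j then P.degree F * (ofDegree F A (d - j)).card else 0 := by
    have hpos := degree_pos_of_prime F (hS.mp hP).1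
    simp only [ite_mul, zero_mul]
    rw [← Finset.sum_filter, ← Finset.sum_filter]
    refine Finset.sum_nbij (fun k => k * P.degree F) ?_ ?_ ?_ ?_
    · intro k hk
      simp only [Finset.mem_filter, Finset.mem_Icc] at hk ⊢
      exact ⟨⟨Nat.mul_pos hk.1.1 hpos, hk.2⟩, dvd_mul_left _ _⟩
    · exact fun k _ l _ h => Nat.eq_of_mul_eq_mul_right hpos h
    · intro j hj
      simp only [Finset.coe_filter, Finset.mem_Icc, Set.mem_ofPred_eq] at hj
      obtain ⟨⟨hj1, hjd⟩, k, rfl⟩ := hj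
      refine ⟨k, ?_, mul_comm _ _⟩
      simp only [Finset.coe_filter, Finset.mem_Icc, Set.mem_ofPred_eq]
      have := Nat.le_mul_of_pos_left k hpos
      exact ⟨⟨Nat.pos_of_mul_pos_left hj1, this.trans hjd⟩, mul_comm k _ ▸ hjd⟩
    · exact fun k _ => mul_comm _ _
  rw [h1, Finset.sum_comm]
  calc _ = ∑ P ∈ S, ∑ k ∈ Finset.Icc 1 d,
        (if k * P.degree F ≤ d then (ofDegree F A (d - k * P.degree F)).card else 0) *
          P.degree F := by
        refine Finset.sum_congr rfl fun P hP => ?_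
        rw [Finset.sum_comm]
        refine Finset.sum_congr rfl fun k _ => ?_
        rw [← card_filter_pow_dvd F (hS.mp hP).1.ne_zero, ← Finset.sum_filter, Finset.sum_const,
          smul_eq_mul]
    _ = _ := by
      rw [Finset.sum_congr rfl fun P hP => h2 hP, Finset.sum_comm]
      refine Finset.sum_congr rfl fun j hj => ?_
      rw [← Finset.sum_filter, Finset.sum_mul]
      refine Finset.sum_congr ?_ fun _ _ => rfl
      ext P
      rw [Finset.mem_Icc] at hj
      rw [Finset.mem_filter, hS, mem_primesDvd (by omega)]
      refine ⟨fun h => ⟨h.1.1, h.2⟩, fun h => ⟨⟨h.1, ?_⟩, h.2⟩⟩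
      exact (Nat.le_of_dvd hj.1 h.2).trans hj.2

end Ideal

namespace WeierstrassCurve.Affine.CoordinateRing

variable {F : Type*} [Field F] {W : Affine F}

/-! ### Homomorphisms out of the coordinate ring -/

section AlgHom

variable {S : Type*} [CommRing S] [Algebra F S]

lemma algHom_apply_smul_basis (φ : W.CoordinateRing →ₐ[F] S) (p q : F[X]) :
    φ (p • (1 : W.CoordinateRing) + q • mk W Y) =
      aeval (φ (mk W (C X))) p + aeval (φ (mk W (C X))) q * φ (mk W Y) := by
  have h (p : F[X]) : φ (algebraMap F[X] W.CoordinateRing p) = aeval (φ (mk W (C X))) p := by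
    have : φ.comp (IsScalarTower.toAlgHom F F[X] W.CoordinateRing) =
        aeval (φ (mk W (C X))) := by
      ext
      simp
    exact DFunLike.congr_fun this p
  rw [map_add, Algebra.smul_def, Algebra.smul_def, map_mul, map_mul, map_one, mul_one, h, h]

lemma algHom_ext {φ ψ : W.CoordinateRing →ₐ[F] S} (hX : φ (mk W (C X)) = ψ (mk W (C X)))
    (hY : φ (mk W Y) = ψ (mk W Y)) : φ = ψ := by
  refine AlgHom.ext fun f => ?_
  obtain ⟨p, q, rfl⟩ := exists_smul_basis_eq f
  rw [algHom_apply_smul_basis, algHom_apply_smul_basis, hX, hY]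

lemma mk_equation : mk W Y ^ 2 + algebraMap F W.CoordinateRing W.a₁ * mk W (C X) * mk W Y +
    algebraMap F W.CoordinateRing W.a₃ * mk W Y = mk W (C X) ^ 3 +
      algebraMap F W.CoordinateRing W.a₂ * mk W (C X) ^ 2 +
      algebraMap F W.CoordinateRing W.a₄ * mk W (C X) + algebraMap F W.CoordinateRing W.a₆ := by
  have h (c : F) : algebraMap F W.CoordinateRing c = mk W (C (C c)) := rfl
  simp only [h, ← map_mul, ← map_pow, ← map_add]
  refine AdjoinRoot.mk_eq_mk.mpr ⟨1, ?_⟩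
  simp only [polynomial, map_mul, map_pow, map_add]
  ring1

variable (W S) in
/-- The homomorphisms from the coordinate ring to `S` correspond to the affine points over `S`. -/
noncomputable def algHomEquiv : (W.CoordinateRing →ₐ[F] S) ≃ {P : S × S //
    P.2 ^ 2 + algebraMap F S W.a₁ * P.1 * P.2 + algebraMap F S W.a₃ * P.2 =
      P.1 ^ 3 + algebraMap F S W.a₂ * P.1 ^ 2 + algebraMap F S W.a₄ * P.1 +
        algebraMap F S W.a₆} where
  toFun φ := ⟨(φ (mk W (C X)), φ (mk W Y)), by simpa using congr_arg φ (mk_equation (W := W))⟩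
  invFun P := AdjoinRoot.liftAlgHom W.polynomial (aeval P.1.1) P.1.2 (by
    simp only [polynomial, eval₂_add, eval₂_sub, eval₂_mul, eval₂_pow, eval₂_X, eval₂_C,
      RingHom.coe_coe, map_add, map_mul, map_pow, aeval_X, aeval_C]
    linear_combination P.2)
  left_inv φ := by
    apply algHom_ext
    · exact (AdjoinRoot.liftAlgHom_of ..).trans (aeval_X _)
    · exact AdjoinRoot.liftAlgHom_root ..
  right_inv P := Subtype.ext <| Prod.ext
    ((AdjoinRoot.liftAlgHom_of ..).trans (aeval_X _)) (AdjoinRoot.liftAlgHom_root ..)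

end AlgHom

end WeierstrassCurve.Affine.CoordinateRing

instance Polynomial.hasFiniteQuotients {F : Type*} [Field F] [Finite F] :
    Ring.HasFiniteQuotients F[X] where
  finiteQuotient {I} hI := by
    obtain ⟨g, rfl⟩ := IsPrincipalIdealRing.principal I
    have hg : g ≠ 0 := by rintro rfl; simp at hI
    have : Module.Finite F (F[X] ⧸ Ideal.span {g}) :=
      .of_basis (AdjoinRoot.powerBasis hg).basis
    exact Module.finite_of_finite F

namespace WeierstrassCurve.Affine

lemma Point.card_eq_card_equation_add_one {F : Type*} [Field F] [Finite F] {W : Affine F}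
    (hW : W.Δ ≠ 0) : Nat.card W.Point = Nat.card {P : F × F // W.Equation P.1 P.2} + 1 := by
  let e : W.Point ≃ Option {P : F × F // W.Equation P.1 P.2} :=
    { toFun := fun
        | .zero => none
        | .some x y h => Option.some ⟨(x, y), h.1⟩
      invFun := fun
        | none => .zero
        | Option.some P => .some P.1.1 P.1.2 ((equation_iff_nonsingular_of_Δ_ne_zero hW).mp P.2)
      left_inv := by rintro (_ | _) <;> rfl
      right_inv := by rintro (_ | _) <;> rfl }
  rw [Nat.card_congr e, Finite.card_option]

instance Point.finite {F : Type*} [Field F] [Finite F] {W : Affine F} : Finite W.Point := by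
  refine Finite.of_injective (β := Option (F × F)) (fun
    | .zero => none
    | .some x y _ => Option.some (x, y)) ?_
  rintro (_ | _) (_ | _) h <;> simp_all

namespace CoordinateRing

variable {F : Type*} [Field F] {W : Affine F}

/-! ### Counting the ideals of the coordinate ring -/

instance : Infinite W.CoordinateRing :=
  Infinite.of_injective _ (FaithfulSMul.algebraMap_injective F[X] W.CoordinateRing)

instance [Finite F] : Ring.HasFiniteQuotients W.CoordinateRing := .of_module_finite F[X] _

lemma degree_span_singleton {f : W.CoordinateRing} (hf : f ≠ 0) :
    (Ideal.span {f}).degree F = poleOrder f := finrank_quotient_span_singleton hf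

/-- The ideal of functions vanishing at a point, which is the whole ring for the point at infinity. -/
noncomputable def pointIdeal : W.Point → Ideal W.CoordinateRing
  | .zero => ⊤
  | .some x y _ => XYIdeal W x (C y)

lemma degree_XYIdeal {x y : F} (h : W.Equation x y) : (XYIdeal W x (C y)).degree F = 1 := by
  rw [Ideal.degree, (quotientXYIdealEquiv h).toLinearEquiv.finrank_eq, Module.finrank_self]

lemma XYIdeal_ne_bot (x : F) (y : F[X]) : XYIdeal W x y ≠ ⊥ := by
  intro h
  have : XClass W x ∈ XYIdeal W x y := Ideal.subset_span (by simp)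
  rw [h] at this
  exact XClass_ne_zero x this

lemma pointIdeal_ne_bot (P : W.Point) : pointIdeal P ≠ ⊥ := by
  rcases P with _ | _
  · exact top_ne_bot
  · exact XYIdeal_ne_bot _ _

lemma degree_pointIdeal_le_one (P : W.Point) : (pointIdeal P).degree F ≤ 1 := by
  rcases P with _ | ⟨x, y, h⟩
  · exact (Ideal.degree_top F).trans_le zero_le_one
  · exact (degree_XYIdeal h.1).le

lemma eq_of_mul_pointIdeal_eq_span {I : Ideal W.CoordinateRing} {P Q : W.Point}
    {f g : W.CoordinateRing} (hf : f ≠ 0) (hg : g ≠ 0) (hP : I * pointIdeal P = Ideal.span {f})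
    (hQ : I * pointIdeal Q = Ideal.span {g}) : P = Q := by
  classical
  have hunit (P : W.Point) : ∃ u : (FractionalIdeal (nonZeroDivisors W.CoordinateRing)
      W.FunctionField)ˣ, (u : FractionalIdeal (nonZeroDivisors W.CoordinateRing) W.FunctionField) =
        pointIdeal P ∧ Point.toClass P = ClassGroup.mk W.FunctionField u := by
    rcases P with _ | ⟨x, y, h⟩
    · exact ⟨1, rfl, (map_one (ClassGroup.mk W.FunctionField)).symm⟩
    · exact ⟨XYIdeal' (W := W) h, XYIdeal'_eq h, Point.toClass_some h⟩
  obtain ⟨u, hu, huP⟩ := hunit P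
  obtain ⟨v, hv, hvQ⟩ := hunit Q
  refine Point.toClass_injective (huP.trans (Eq.trans ?_ hvQ.symm))
  refine (ClassGroup.mk_eq_mk_of_coe_ideal hu hv).mpr ⟨g, f, hg, hf, ?_⟩
  rw [← hP, ← hQ]
  ring

variable [Finite F]

lemma exists_ne_zero_mem_poleOrder_le {I : Ideal W.CoordinateRing} (hI : I ≠ ⊥) :
    ∃ f ∈ I, f ≠ 0 ∧ poleOrder f ≤ I.degree F + 1 := by
  have := Ring.HasFiniteQuotients.finiteQuotient hI
  have : Module.Finite F (W.CoordinateRing ⧸ I) := .of_finite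
  have h := LinearMap.ker_ne_bot_of_finrank_lt
    (f := ((Ideal.Quotient.mkₐ F I).toLinearMap.domRestrict (poleLE W (I.degree F + 1))))
    (by rw [finrank_poleLE (Nat.succ_pos _)]; exact Nat.lt_succ_self _)
  obtain ⟨⟨f, hf⟩, hf', hf0⟩ := Submodule.exists_mem_ne_zero_of_ne_bot h
  exact ⟨f, Ideal.Quotient.eq_zero_iff_mem.mp hf', fun h => hf0 (Subtype.ext h), mem_poleLE.mp hf⟩

variable [IsDedekindDomain W.CoordinateRing]

lemma exists_pointIdeal_eq (hW : W.Δ ≠ 0) {J : Ideal W.CoordinateRing} (hJ0 : J ≠ ⊥)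
    (hJ : J.degree F ≤ 1) : ∃ P : W.Point, pointIdeal P = J := by
  rcases Nat.le_one_iff_eq_zero_or_eq_one.mp hJ with h | h
  · exact ⟨.zero, ((Ideal.degree_eq_zero_iff F hJ0).mp h).symm⟩
  have : Nontrivial (W.CoordinateRing ⧸ J) :=
    Module.nontrivial_of_finrank_pos (R := F) (one_pos.trans_eq h.symm)
  have hsurj (a : W.CoordinateRing) : ∃ c : F, a - algebraMap F _ c ∈ J := by
    obtain ⟨c, hc⟩ := (finrank_eq_one_iff_of_nonzero' (1 : W.CoordinateRing ⧸ J) one_ne_zero).mp h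
      (Ideal.Quotient.mk J a)
    refine ⟨c, ?_⟩
    rw [← Ideal.Quotient.eq, ← hc, Algebra.smul_def, mul_one]
    rfl
  obtain ⟨x, hx⟩ := hsurj (mk W (C X))
  obtain ⟨y, hy⟩ := hsurj (mk W Y)
  have heq : W.Equation x y := by
    have hmk := congr_arg (Ideal.Quotient.mk J) (mk_equation (W := W))
    rw [← Ideal.Quotient.eq] at hx hy
    simp only [map_add, map_mul, map_pow, hx, hy] at hmk
    simp only [← map_add, ← map_mul, ← map_pow] at hmk
    rw [equation_iff]
    exact ((algebraMap W.CoordinateRing (W.CoordinateRing ⧸ J)).comp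
      (algebraMap F W.CoordinateRing)).injective hmk
  refine ⟨.some x y ((equation_iff_nonsingular_of_Δ_ne_zero hW).mp heq), ?_⟩
  have hle : XYIdeal W x (C y) ≤ J := by
    refine Ideal.span_le.mpr (Set.pair_subset ?_ ?_)
    · rw [XClass, map_sub, map_sub]
      exact hx
    · rw [YClass, map_sub]
      exact hy
  obtain ⟨J', hJ'⟩ := Ideal.dvd_iff_le.mpr hle
  have hne := hJ' ▸ XYIdeal_ne_bot (W := W) x (C y)
  have hJ'0 : J' ≠ ⊥ := right_ne_zero_of_mul hne
  have hdeg := degree_XYIdeal heq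
  rw [hJ', Ideal.degree_mul F hJ0 hJ'0, h, Nat.add_eq_left, Ideal.degree_eq_zero_iff F hJ'0] at hdeg
  rw [pointIdeal, hJ', hdeg, Ideal.mul_top]

lemma exists_mul_pointIdeal_eq_span (hW : W.Δ ≠ 0) {I : Ideal W.CoordinateRing} (hI : I ≠ ⊥) :
    ∃ P : W.Point, ∃ f ≠ 0, I * pointIdeal P = Ideal.span {f} := by
  obtain ⟨f, hfI, hf0, hf⟩ := exists_ne_zero_mem_poleOrder_le hI
  obtain ⟨J, hJ⟩ := Ideal.dvd_iff_le.mpr ((Ideal.span_singleton_le_iff_mem I).mpr hfI)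
  have hne : I * J ≠ ⊥ := by rw [← hJ]; simpa using hf0
  have hJ0 : J ≠ ⊥ := right_ne_zero_of_mul hne
  have hdeg := degree_span_singleton hf0
  rw [hJ, Ideal.degree_mul F hI hJ0] at hdeg
  obtain ⟨P, rfl⟩ := exists_pointIdeal_eq hW hJ0 (by omega)
  exact ⟨P, f, hf0, hJ.symm⟩

end CoordinateRing

end WeierstrassCurve.Affine

namespace WeierstrassCurve.Affine.CoordinateRing

variable {F : Type*} [Field F] [Finite F] {W : Affine F}

lemma ncard_mem_and_poleOrder_le {J : Ideal W.CoordinateRing} (hJ0 : J ≠ ⊥)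
    (hJ : J.degree F ≤ 1) {m : ℕ} (hm : 0 < m) :
    {f | f ∈ J ∧ poleOrder f ≤ m}.ncard = Nat.card F ^ (m - J.degree F) := by
  let φ := (Ideal.Quotient.mkₐ F J).toLinearMap.domRestrict (poleLE W m)
  let e : {f | f ∈ J ∧ poleOrder f ≤ m} ≃ LinearMap.ker φ :=
    { toFun f := ⟨⟨f.1, mem_poleLE.mpr f.2.2⟩, Ideal.Quotient.eq_zero_iff_mem.mpr f.2.1⟩
      invFun f := ⟨f.1.1, Ideal.Quotient.eq_zero_iff_mem.mp f.2, mem_poleLE.mp f.1.2⟩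
      left_inv _ := rfl
      right_inv _ := rfl }
  have hφ : LinearMap.range φ = ⊤ := by
    rw [LinearMap.range_eq_top]
    rcases Nat.le_one_iff_eq_zero_or_eq_one.mp hJ with h | h
    · rw [Ideal.degree_eq_zero_iff F hJ0] at h
      have : Subsingleton (W.CoordinateRing ⧸ J) := Ideal.Quotient.subsingleton_iff.mpr h
      exact fun x => ⟨0, Subsingleton.elim _ _⟩
    · have : Nontrivial (W.CoordinateRing ⧸ J) :=
        Module.nontrivial_of_finrank_pos (R := F) (one_pos.trans_eq h.symm)
      intro a
      obtain ⟨c, rfl⟩ :=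
        (finrank_eq_one_iff_of_nonzero' (1 : W.CoordinateRing ⧸ J) one_ne_zero).mp h a
      refine ⟨⟨algebraMap F _ c, mem_poleLE.mpr ((poleOrder_algebraMap c).trans_le m.zero_le)⟩, ?_⟩
      rw [Algebra.smul_def, mul_one]
      rfl
  have hrank := φ.finrank_range_add_finrank_ker
  rw [hφ, finrank_top, finrank_poleLE hm] at hrank
  rw [← Nat.card_coe_set_eq, Nat.card_congr e, Module.natCard_eq_pow_finrank (K := F)]
  congr 1
  rw [Ideal.degree]
  omega

lemma finite_setOf_mem_and_poleOrder_le (J : Ideal W.CoordinateRing) (m : ℕ) :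
    {f | f ∈ J ∧ poleOrder f ≤ m}.Finite := by
  have : Finite (poleLE W m) := Module.finite_of_finite F
  exact Set.Finite.subset (s := (poleLE W m : Set W.CoordinateRing)) (Set.toFinite _)
    fun f hf => mem_poleLE.mpr hf.2

lemma ncard_mem_and_poleOrder_eq {J : Ideal W.CoordinateRing} (hJ0 : J ≠ ⊥)
    (hJ : J.degree F ≤ 1) {d : ℕ} (hd : 2 ≤ d) :
    {f | f ∈ J ∧ poleOrder f = d + J.degree F}.ncard = (Nat.card F - 1) * Nat.card F ^ (d - 1) := by
  set e := J.degree F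
  have hunion : {f | f ∈ J ∧ poleOrder f ≤ d + e} =
      {f | f ∈ J ∧ poleOrder f = d + e} ∪ {f | f ∈ J ∧ poleOrder f ≤ d + e - 1} := by
    ext f
    simp only [Set.mem_ofPred_eq, Set.mem_union, ← and_or_left]
    exact and_congr_right fun _ => by omega
  have hdisj : Disjoint {f | f ∈ J ∧ poleOrder f = d + e} {f | f ∈ J ∧ poleOrder f ≤ d + e - 1} :=
    Set.disjoint_left.mpr fun f hf hf' => by have := hf.2; have := hf'.2; omega
  have hcard := congr_arg Set.ncard hunion
  rw [Set.ncard_union_eq hdisj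
      ((finite_setOf_mem_and_poleOrder_le J (d + e)).subset fun f hf => ⟨hf.1, hf.2.le⟩)
      (finite_setOf_mem_and_poleOrder_le J _), ncard_mem_and_poleOrder_le hJ0 hJ (by omega),
    ncard_mem_and_poleOrder_le hJ0 hJ (by omega)] at hcard
  change _ ^ (d + e - e) = _ + _ ^ (d + e - 1 - e) at hcard
  obtain ⟨k, rfl⟩ : ∃ k, d = k + 1 := ⟨d - 1, by omega⟩
  rw [show k + 1 + e - e = k + 1 by omega, show k + 1 + e - 1 - e = k by omega, pow_succ] at hcard
  rw [Nat.add_sub_cancel, Nat.sub_mul, one_mul, mul_comm]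
  omega

variable [IsDedekindDomain W.CoordinateRing]

open Classical in
lemma card_filter_mul_eq_span {J : Ideal W.CoordinateRing} (hJ0 : J ≠ ⊥) (hJ : J.degree F ≤ 1)
    {d : ℕ} (hd : 2 ≤ d) :
    ((Ideal.ofDegree F W.CoordinateRing d).filter
      (fun I => ∃ f ≠ 0, I * J = Ideal.span {f})).card = Nat.card F ^ (d - 1) := by
  set S := (Ideal.ofDegree F W.CoordinateRing d).filter (fun I => ∃ f ≠ 0, I * J = Ideal.span {f})
  have hS (I : S) : I.1 ≠ ⊥ ∧ I.1.degree F = d ∧ ∃ f ≠ 0, I.1 * J = Ideal.span {f} := by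
    have := Finset.mem_filter.mp I.2
    exact ⟨(Ideal.mem_ofDegree.mp this.1).1, (Ideal.mem_ofDegree.mp this.1).2, this.2⟩
  choose hI0 hId g hg0 hg using hS
  have hgdeg (I : S) : poleOrder (g I) = d + J.degree F := by
    rw [← degree_span_singleton (hg0 I), ← hg I, Ideal.degree_mul F (hI0 I) hJ0, hId]
  let Φ : S × Fˣ → {f | f ∈ J ∧ poleOrder f = d + J.degree F} := fun p =>
    ⟨algebraMap F _ (p.2 : F) * g p.1, J.mul_mem_left _ (Ideal.mul_le_right (I := p.1.1)
      (hg p.1 ▸ Ideal.mem_span_singleton_self (g p.1))), by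
      rw [poleOrder_mul (by simp) (hg0 _), poleOrder_algebraMap, zero_add, hgdeg]⟩
  have hspan (p : S × Fˣ) : p.1.1 * J = Ideal.span {(Φ p : W.CoordinateRing)} := by
    rw [hg, Ideal.span_singleton_mul_left_unit]
    exact p.2.isUnit.map (algebraMap F W.CoordinateRing)
  have hΦ : Function.Bijective Φ := by
    constructor
    · rintro ⟨I, c⟩ ⟨I', c'⟩ h
      have hII : I = I' := by
        refine Subtype.ext (mul_right_cancel₀ hJ0 ?_)
        rw [hspan (I, c), hspan (I', c'), h]
      subst hII
      have := mul_right_cancel₀ (hg0 I) (congr_arg Subtype.val h)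
      rw [Prod.mk.injEq]
      exact ⟨rfl, Units.ext (FaithfulSMul.algebraMap_injective F W.CoordinateRing this)⟩
    · rintro ⟨f, hfJ, hfd⟩
      have hf0 : f ≠ 0 := by rintro rfl; rw [poleOrder_zero] at hfd; omega
      obtain ⟨I, hI⟩ := Ideal.dvd_iff_le.mpr ((Ideal.span_singleton_le_iff_mem J).mpr hfJ)
      rw [mul_comm] at hI
      have hI0 : I ≠ ⊥ := left_ne_zero_of_mul
        (show I * J ≠ ⊥ by rw [← hI]; simpa using hf0)
      have hIS : I ∈ S := by
        refine Finset.mem_filter.mpr ⟨Ideal.mem_ofDegree.mpr ⟨hI0, ?_⟩, f, hf0, hI.symm⟩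
        have := degree_span_singleton hf0
        rw [hI, Ideal.degree_mul F hI0 hJ0, hfd] at this
        omega
      obtain ⟨u, hu⟩ := Ideal.span_singleton_eq_span_singleton.mp ((hg ⟨I, hIS⟩).symm.trans hI.symm)
      have hu0 : poleOrder (u : W.CoordinateRing) = 0 := by
        have := hgdeg ⟨I, hIS⟩
        rw [← hu, poleOrder_mul (hg0 _) u.ne_zero] at hfd
        omega
      obtain ⟨c, hc⟩ := exists_algebraMap_eq_of_poleOrder_eq_zero hu0
      have hc0 : c ≠ 0 := by rintro rfl; exact u.ne_zero (by rw [← hc, map_zero])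
      refine ⟨(⟨I, hIS⟩, Units.mk0 c hc0), Subtype.ext ?_⟩
      change algebraMap F _ c * g _ = f
      rw [hc, ← hu, mul_comm]
  have hcard := Nat.card_congr (Equiv.ofBijective Φ hΦ)
  rw [Nat.card_coe_set_eq, ncard_mem_and_poleOrder_eq hJ0 hJ hd, Nat.card_prod, Nat.card_units,
    Nat.card_eq_fintype_card, Fintype.card_coe, mul_comm] at hcard
  exact Nat.eq_of_mul_eq_mul_left (Nat.sub_pos_of_lt Finite.one_lt_card) hcard

lemma card_ofDegree (hW : W.Δ ≠ 0) {d : ℕ} (hd : 2 ≤ d) :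
    (Ideal.ofDegree F W.CoordinateRing d).card = Nat.card W.Point * Nat.card F ^ (d - 1) := by
  classical
  have := Fintype.ofFinite W.Point
  have hcover : Ideal.ofDegree F W.CoordinateRing d = Finset.univ.biUnion fun P : W.Point =>
      (Ideal.ofDegree F W.CoordinateRing d).filter
        (fun I => ∃ f ≠ 0, I * pointIdeal P = Ideal.span {f}) := by
    ext I
    simp only [Finset.mem_biUnion, Finset.mem_univ, true_and, Finset.mem_filter]
    refine ⟨fun hI => ?_, fun ⟨_, h⟩ => h.1⟩
    obtain ⟨P, f, hf⟩ := exists_mul_pointIdeal_eq_span hW (Ideal.mem_ofDegree.mp hI).1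
    exact ⟨P, hI, f, hf⟩
  rw [hcover, Finset.card_biUnion]
  · simp_rw [card_filter_mul_eq_span (pointIdeal_ne_bot _) (degree_pointIdeal_le_one _) hd]
    simp
  · intro P _ Q _ hPQ
    refine Finset.disjoint_left.mpr fun I hI hI' => hPQ ?_
    obtain ⟨f, hf0, hf⟩ := (Finset.mem_filter.mp hI).2
    obtain ⟨g, hg0, hg⟩ := (Finset.mem_filter.mp hI').2
    exact eq_of_mul_pointIdeal_eq_span hf0 hg0 hf hg

end WeierstrassCurve.Affine.CoordinateRing

/-! ### Points over finite extensions and prime ideals -/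

namespace Ideal

variable (F : Type*) {A : Type*} [Field F] [CommRing A] [Algebra F A]
  [IsDedekindDomain A]

lemma natCard_quotient_algHom {L : Type*} [Field L] [Finite L] [Algebra F L] {P : Ideal A}
    (hP : Prime P) (h : P.degree F ∣ Module.finrank F L) :
    Nat.card (A ⧸ P →ₐ[F] L) = P.degree F := by
  have := (isPrime_of_prime hP).isMaximal hP.ne_zero
  let := Quotient.field P
  exact FiniteField.natCard_algHom_of_finrank_dvd h

lemma ker_comp_mkₐ {L : Type*} [Field L] [Algebra F L] {P : Ideal A} (hP : Prime P)
    (ψ : A ⧸ P →ₐ[F] L) : RingHom.ker (ψ.comp (Quotient.mkₐ F P)) = P := by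
  have := (isPrime_of_prime hP).isMaximal hP.ne_zero
  let := Quotient.field P
  have hψ : Function.Injective ψ := RingHom.injective ψ.toRingHom
  ext f
  rw [RingHom.mem_ker, AlgHom.comp_apply, map_eq_zero_iff _ hψ]
  exact Quotient.eq_zero_iff_mem

variable [Ring.HasFiniteQuotients A] [Infinite A]

variable {F} in
lemma ker_mem_primesDvd {L : Type*} [Field L] [Finite L] [Algebra F L] (φ : A →ₐ[F] L) :
    RingHom.ker φ ∈ primesDvd F A (Module.finrank F L) := by
  have h0 : RingHom.ker φ ≠ ⊥ := fun h =>
    not_injective_infinite_finite φ ((RingHom.injective_iff_ker_eq_bot φ).mpr h)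
  have := (RingHom.ker_isPrime φ).isMaximal h0
  have : Module.Finite F L := .of_finite
  rw [mem_primesDvd Module.finrank_pos.ne']
  refine ⟨prime_of_isPrime h0 (RingHom.ker_isPrime φ), ?_⟩
  let := Quotient.field (RingHom.ker φ)
  exact FiniteField.nonempty_algHom_iff_finrank_dvd.mp ⟨kerLiftAlg φ⟩

variable (A) in
/-- The `L`-points of `A` are distributed over the primes whose degree divides `[L : F]`. -/
theorem natCard_algHom_eq_sum_degree [Finite F] (L : Type*) [Field L] [Finite L] [Algebra F L] :
    Nat.card (A →ₐ[F] L) = ∑ P ∈ primesDvd F A (Module.finrank F L), P.degree F := by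
  have : Module.Finite F L := .of_finite
  have hn : Module.finrank F L ≠ 0 := Module.finrank_pos.ne'
  have hP (P : primesDvd F A (Module.finrank F L)) := (mem_primesDvd hn).mp P.2
  have he : Function.Bijective
      fun x : (Σ P : primesDvd F A (Module.finrank F L), (A ⧸ P.1 →ₐ[F] L)) =>
        x.2.comp (Quotient.mkₐ F x.1.1) := by
    refine ⟨?_, fun φ => ⟨⟨⟨RingHom.ker φ, ker_mem_primesDvd φ⟩, kerLiftAlg φ⟩, ?_⟩⟩
    · rintro ⟨P, ψ⟩ ⟨P', ψ'⟩ h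
      obtain rfl : P = P' := Subtype.ext <| by
        rw [← ker_comp_mkₐ F (hP P).1 ψ, ← ker_comp_mkₐ F (hP P').1 ψ']
        exact congr_arg (RingHom.ker ·) h
      congr 1
      exact Quotient.algHom_ext _ h
    · exact AlgHom.ext fun f => kerLiftAlg_mk φ f
  have hcard (P : primesDvd F A (Module.finrank F L)) :
      Nat.card (A ⧸ P.1 →ₐ[F] L) = P.1.degree F :=
    natCard_quotient_algHom F (hP P).1 (hP P).2
  have hfin (P : primesDvd F A (Module.finrank F L)) : Finite (A ⧸ P.1 →ₐ[F] L) :=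
    Nat.finite_of_card_ne_zero <| by
      rw [hcard]
      exact (degree_pos_of_prime F (hP P).1).ne'
  rw [← Nat.card_congr (Equiv.ofBijective _ he), Nat.card_sigma]
  simp only [hcard]
  exact Finset.sum_coe_sort (primesDvd F A (Module.finrank F L)) (degree F)

end Ideal

/-! ### Rationality of the zeta function -/

section Newton

variable {R : Type*} [Field R] {b : ℕ → R} {α β : R}

lemma sum_range_succ_pow_mul (b : ℕ → R) (t : R) (d : ℕ) :
    ∑ i ∈ Finset.range (d + 1), t ^ (i + 1) * b (d - i) =
      t * (b d + ∑ i ∈ Finset.range d, t ^ (i + 1) * b (d - 1 - i)) := by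
  rw [Finset.sum_range_succ', mul_add, Finset.mul_sum, add_comm]
  congr 1
  · simp
  · exact Finset.sum_congr rfl fun i _ => by rw [Nat.sub_sub, add_comm 1 i]; ring

lemma sum_pow_left_mul (h0 : b 0 = 1) (h1 : b 1 = α * β - α - β)
    (h2 : ∀ d, b (d + 2) = (1 - α) * (1 - β) * (α * β) ^ (d + 1)) (d : ℕ) :
    ∑ i ∈ Finset.range (d + 2), α ^ (i + 1) * b (d + 1 - i) = (α * β) ^ (d + 1) * (α - 1) := by
  induction d with
  | zero => simp [Finset.sum_range_succ, h0, h1]; ring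
  | succ d ih =>
    rw [sum_range_succ_pow_mul, show d + 2 - 1 = d + 1 from rfl, ih, h2]
    ring

lemma sum_pow_mul_mul (h0 : b 0 = 1) (h1 : b 1 = α * β - α - β)
    (h2 : ∀ d, b (d + 2) = (1 - α) * (1 - β) * (α * β) ^ (d + 1)) (d : ℕ) :
    ∑ i ∈ Finset.range (d + 2), (α * β) ^ (i + 1) * b (d + 1 - i) =
      (d + 1) * ((1 - α) * (1 - β)) * (α * β) ^ (d + 1) - (α * β) ^ (d + 1) +
        (α * β) ^ (d + 2) := by
  induction d with
  | zero => simp [Finset.sum_range_succ, h0, h1]; ring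
  | succ d ih =>
    rw [sum_range_succ_pow_mul, show d + 2 - 1 = d + 1 from rfl, ih, h2]
    push_cast
    ring

lemma newton_sum (h0 : b 0 = 1) (h1 : b 1 = α * β - α - β)
    (h2 : ∀ d, b (d + 2) = (1 - α) * (1 - β) * (α * β) ^ (d + 1)) (d : ℕ) :
    ∑ i ∈ Finset.range (d + 1), ((α * β) ^ (i + 1) - α ^ (i + 1) - β ^ (i + 1)) * b (d - i) =
      (d + 1) * b (d + 1) := by
  cases d with
  | zero => simp [h0, h1]
  | succ d =>
    have hβ := sum_pow_left_mul h0 (α := β) (β := α) (by rw [h1]; ring)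
      (fun d => by rw [h2]; ring) d
    simp only [sub_mul, Finset.sum_sub_distrib]
    rw [sum_pow_left_mul h0 h1 h2, sum_pow_mul_mul h0 h1 h2, hβ, h2]
    push_cast
    ring

/-- Newton's identities determine the power sums. -/
lemma eq_of_newton (h0 : b 0 = 1) (h1 : b 1 = α * β - α - β)
    (h2 : ∀ d, b (d + 2) = (1 - α) * (1 - β) * (α * β) ^ (d + 1))
    {N : ℕ → R} (hN : ∀ d : ℕ, (d : R) * b d = ∑ j ∈ Finset.Icc 1 d, N j * b (d - j)) {n : ℕ} (hn : 0 < n) :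
    N n = (α * β) ^ n - α ^ n - β ^ n := by
  induction n using Nat.strong_induction_on with
  | _ n ih =>
    obtain ⟨d, rfl⟩ := Nat.exists_eq_succ_of_ne_zero hn.ne'
    have := hN (d + 1)
    rw [← Finset.Ico_add_one_right_eq_Icc, Finset.sum_Ico_eq_sum_range, Nat.add_sub_cancel,
      Nat.cast_succ, ← newton_sum h0 h1 h2, Finset.sum_range_succ, Finset.sum_range_succ,
      Nat.add_comm 1 d, Nat.sub_self, Nat.sub_self, h0, mul_one, mul_one] at this
    have hs : ∑ i ∈ Finset.range d, ((α * β) ^ (i + 1) - α ^ (i + 1) - β ^ (i + 1)) * b (d - i) =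
        ∑ i ∈ Finset.range d, N (1 + i) * b (d + 1 - (1 + i)) := by
      refine Finset.sum_congr rfl fun i hi => ?_
      rw [add_comm 1 i, Nat.add_sub_add_right,
        ih (i + 1) (Nat.succ_lt_succ (Finset.mem_range.mp hi)) i.succ_pos]
    rw [hs] at this
    exact (add_left_cancel this).symm

end Newton

namespace WeierstrassCurve.Affine.CoordinateRing

variable {F : Type*} [Field F] [Finite F] {W : Affine F}

theorem natCard_algHom (hW : W.Δ ≠ 0) {α β : ℂ} (hm : α * β = Nat.card F)
    (ha : α + β = Nat.card F + 1 - Nat.card W.Point) (L : Type*) [Field L] [Finite L]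
    [Algebra F L] : (Nat.card (W.CoordinateRing →ₐ[F] L) : ℂ) =
      Nat.card F ^ Module.finrank F L - α ^ Module.finrank F L - β ^ Module.finrank F L := by
  have := isDedekindDomain hW
  have : Module.Finite F L := .of_finite
  have hpt : Nat.card W.Point = Nat.card (W.CoordinateRing →ₐ[F] F) + 1 := by
    rw [Point.card_eq_card_equation_add_one hW, Nat.card_congr (algHomEquiv W F)]
    congr 1
    refine Nat.card_congr (Equiv.subtypeEquivRight fun P => ?_)
    rw [equation_iff]
    rfl
  have h0 : ((Ideal.ofDegree F W.CoordinateRing 0).card : ℂ) = 1 := by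
    rw [Ideal.card_ofDegree_zero, Nat.cast_one]
  have h1 : ((Ideal.ofDegree F W.CoordinateRing 1).card : ℂ) = α * β - α - β := by
    have := Ideal.mul_card_ofDegree F (A := W.CoordinateRing) 1
    rw [Finset.Icc_self, Finset.sum_singleton, Nat.sub_self, Ideal.card_ofDegree_zero, mul_one,
      one_mul] at this
    have h' := Ideal.natCard_algHom_eq_sum_degree F W.CoordinateRing F
    rw [Module.finrank_self, ← this] at h'
    rw [hpt, h'] at ha
    push_cast at ha
    linear_combination ha - hm
  have h2 (d : ℕ) : ((Ideal.ofDegree F W.CoordinateRing (d + 2)).card : ℂ) =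
      (1 - α) * (1 - β) * (α * β) ^ (d + 1) := by
    rw [card_ofDegree hW (by lia), show d + 2 - 1 = d + 1 from rfl, hm]
    push_cast
    linear_combination ((Nat.card F : ℂ) ^ (d + 1)) * (ha - hm)
  rw [Ideal.natCard_algHom_eq_sum_degree, ← hm]
  refine eq_of_newton (b := fun d => ((Ideal.ofDegree F W.CoordinateRing d).card : ℂ))
    (N := fun n => ((∑ P ∈ Ideal.primesDvd F W.CoordinateRing n, P.degree F : ℕ) : ℂ))
    h0 h1 h2 (fun d => ?_) Module.finrank_pos
  exact_mod_cast Ideal.mul_card_ofDegree F (A := W.CoordinateRing) d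

end WeierstrassCurve.Affine.CoordinateRing

namespace WeierstrassCurve.Affine.CoordinateRing

variable {F : Type*} [Field F] {W : Affine F}

/-! ### The auxiliary function in the Stepanov–Bombieri method -/

lemma poleOrder_mul_le (f g : W.CoordinateRing) :
    poleOrder (f * g) ≤ poleOrder f + poleOrder g := by
  rcases eq_or_ne f 0 with rfl | hf
  · simp
  rcases eq_or_ne g 0 with rfl | hg
  · simp
  exact (poleOrder_mul hf hg).le

/-- A sum of functions with pairwise distinct pole orders vanishes only trivially. -/
lemma eq_zero_of_sum_eq_zero {ι : Type*} [Fintype ι] {f : ι → W.CoordinateRing}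
    (hf : ∀ i j, f i ≠ 0 → f j ≠ 0 → poleOrder (f i) = poleOrder (f j) → i = j)
    (h : ∑ i, f i = 0) : f = 0 := by
  classical
  by_contra hf0
  obtain ⟨i₀, hi₀⟩ := Function.ne_iff.mp hf0
  obtain ⟨i, hi, hmax⟩ := Finset.exists_max_image (Finset.univ.filter (f · ≠ 0))
    (fun i => poleOrder (f i)) ⟨i₀, by simpa using hi₀⟩
  simp only [Finset.mem_filter, Finset.mem_univ, true_and] at hi hmax
  have hlt (j : ι) (hj : f j ≠ 0) (hij : j ≠ i) : poleOrder (f j) < poleOrder (f i) :=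
    (hmax j hj).lt_of_ne fun h => hij (hf j i hj hi h)
  rw [← Finset.add_sum_erase _ _ (Finset.mem_univ i)] at h
  rcases Nat.eq_zero_or_pos (poleOrder (f i)) with h0 | hpos
  · rw [Finset.sum_eq_zero, add_zero] at h
    · exact hi h
    · intro j hj
      by_contra hj0
      have := hlt j hj0 (Finset.ne_of_mem_erase hj)
      lia
  · have hmem : ∑ j ∈ Finset.univ.erase i, f j ∈ poleLE W (poleOrder (f i) - 1) := by
      refine Submodule.sum_mem _ fun j hj => mem_poleLE.mpr ?_
      by_cases hj0 : f j = 0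
      · simp [hj0]
      · have := hlt j hj0 (Finset.ne_of_mem_erase hj)
        lia
    rw [eq_neg_of_add_eq_zero_right h, Submodule.neg_mem_iff, mem_poleLE] at hmem
    lia

lemma poleOrder_mk_C_X : poleOrder (mk W (C X)) = 2 := by
  have h : mk W (C X) = (X : F[X]) • (1 : W.CoordinateRing) + (0 : F[X]) • mk W Y := by
    rw [zero_smul, add_zero, ← algebraMap_eq_mk, Algebra.algebraMap_eq_smul_one]
  rw [poleOrder, h]
  refine natDegree_eq_of_degree_eq_some ?_
  rw [degree_norm_smul_basis, degree_X, degree_zero]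
  rfl

lemma poleOrder_mk_Y : poleOrder (mk W Y) = 3 := by
  have h : mk W Y = (0 : F[X]) • (1 : W.CoordinateRing) + (1 : F[X]) • mk W Y := by
    rw [zero_smul, zero_add, one_smul]
  rw [poleOrder, h]
  refine natDegree_eq_of_degree_eq_some ?_
  rw [degree_norm_smul_basis, degree_one, degree_zero]
  rfl

lemma poleOrder_mk_negPolynomial_le : poleOrder (mk W W.negPolynomial) ≤ 3 := by
  have h : mk W W.negPolynomial =
      (-(C W.a₁ * X + C W.a₃) : F[X]) • (1 : W.CoordinateRing) + (-1 : F[X]) • mk W Y := by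
    rw [neg_smul, neg_smul, one_smul, ← Algebra.algebraMap_eq_smul_one, algebraMap_eq_mk,
      negPolynomial, map_sub, map_neg]
    ring
  rw [h, poleOrder_smul_basis_le_iff]
  refine ⟨mem_degreeLT.mpr ?_, mem_degreeLT.mpr ?_⟩
  · rw [degree_neg]
    exact degree_linear_le.trans_lt (by norm_num)
  · rw [degree_neg, degree_one]
    norm_num

lemma mk_C_X_ne_zero : mk W (C X) ≠ 0 := fun h => by
  simpa [h] using poleOrder_mk_C_X (W := W)

lemma mk_Y_ne_zero : mk W Y ≠ 0 := fun h => by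
  simpa [h] using poleOrder_mk_Y (W := W)

/-- The monomial `X ^ i * η ^ ε`, where `ε` is `0` or `1`. -/
noncomputable def monomial (η : W.CoordinateRing) (k : ℕ × Bool) : W.CoordinateRing :=
  mk W (C X) ^ k.1 * η ^ k.2.toNat

lemma monomial_mk_Y_ne_zero (k : ℕ × Bool) : monomial (mk W Y) k ≠ 0 :=
  mul_ne_zero (pow_ne_zero _ mk_C_X_ne_zero) (pow_ne_zero _ mk_Y_ne_zero)

lemma poleOrder_monomial_mk_Y (k : ℕ × Bool) :
    poleOrder (monomial (mk W Y) k) = 2 * k.1 + 3 * k.2.toNat := by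
  rw [monomial, poleOrder_mul (pow_ne_zero _ mk_C_X_ne_zero) (pow_ne_zero _ mk_Y_ne_zero),
    poleOrder_pow, poleOrder_pow, poleOrder_mk_C_X, poleOrder_mk_Y, mul_comm, mul_comm 3]

lemma poleOrder_monomial_le {η : W.CoordinateRing} (hη : poleOrder η ≤ 3) (k : ℕ × Bool) :
    poleOrder (monomial η k) ≤ 2 * k.1 + 3 * k.2.toNat := by
  refine (poleOrder_mul_le _ _).trans ?_
  rw [poleOrder_pow, poleOrder_pow, poleOrder_mk_C_X, mul_comm, mul_comm 3]
  gcongr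

section Auxiliary

variable [Finite F] (p : ℕ) [Fact p.Prime] [CharP F p] {e a : ℕ}

instance : CharP W.CoordinateRing p := charP_of_injective_algebraMap' F p

lemma exists_sum_pow_mul_eq_zero {ι : Type*} [Fintype ι] (t : ι → W.CoordinateRing) {l m : ℕ}
    (ht : ∀ k, poleOrder (t k) ≤ m) (hl : 0 < l)
    (h : p ^ e * l + m < Fintype.card ι * l) :
    ∃ f : ι → W.CoordinateRing, f ≠ 0 ∧ (∀ k, poleOrder (f k) ≤ l) ∧
      ∑ k, f k ^ p ^ e * t k = 0 := by
  have hp : 0 < p ^ e := pow_pos (Fact.out : p.Prime).pos e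
  have (m : ℕ) : Finite (poleLE W m) := Module.finite_of_finite F
  let φ (f : ι → poleLE W l) : poleLE W (p ^ e * l + m) :=
    ⟨∑ k, (f k : W.CoordinateRing) ^ p ^ e * t k, Submodule.sum_mem _ fun k _ => by
      rw [mem_poleLE]
      refine (poleOrder_mul_le _ _).trans ?_
      rw [poleOrder_pow]
      gcongr
      · exact mem_poleLE.mp (f k).2
      · exact ht k⟩
  have hφ : ¬ Function.Injective φ := fun hinj => by
    have := Nat.card_le_card_of_injective φ hinj
    rw [Nat.card_fun, natCard_poleLE hl, natCard_poleLE (by positivity), ← pow_mul,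
      Nat.pow_le_pow_iff_right Finite.one_lt_card, Nat.card_eq_fintype_card, mul_comm l] at this
    lia
  rw [Function.not_injective_iff] at hφ
  obtain ⟨f, g, hfg, hne⟩ := hφ
  refine ⟨fun k => f k - g k, fun h0 => hne (funext fun k => Subtype.ext ?_), fun k => ?_, ?_⟩
  · exact sub_eq_zero.mp (congr_fun h0 k)
  · exact mem_poleLE.mp (Submodule.sub_mem _ (f k).2 (g k).2)
  · simp only [sub_pow_char_pow, sub_mul, Finset.sum_sub_distrib]
    exact sub_eq_zero.mpr (congr_arg Subtype.val hfg)

/-- There is a nonzero function of small pole order that vanishes at all points at which the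
Frobenius endomorphism maps the second coordinate to `η`. -/
theorem exists_auxiliary {η : W.CoordinateRing} (hη : poleOrder η ≤ 3)
    (hQ : Nat.card F = (p ^ e) ^ 2) (he : 5 ≤ p ^ e) :
    ∃ G : W.CoordinateRing, G ≠ 0 ∧ poleOrder G ≤ Nat.card F + 6 * p ^ e ∧
      ∀ {Ω : Type*} [Field Ω] [Algebra F Ω] (φ : W.CoordinateRing →ₐ[F] Ω),
        φ (mk W (C X)) ^ Nat.card F = φ (mk W (C X)) → φ (mk W Y) ^ Nat.card F = φ η →
          φ G = 0 := by
  obtain ⟨Q, hQ0⟩ : ∃ Q, p ^ e = Q := ⟨_, rfl⟩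
  obtain ⟨a, ha, ha'⟩ : ∃ a, Q + 3 ≤ 2 * a ∧ 2 * a ≤ Q + 4 := ⟨(Q + 4) / 2, by lia, by lia⟩
  let m (k : Fin a × Bool) : ℕ × Bool := (k.1, k.2)
  have hm (k : Fin a × Bool) : 2 * (m k).1 + 3 * (m k).2.toNat ≤ Q + 5 := by
    have h1 := k.1.2
    have h2 := k.2.toNat_le
    simp only [m]
    lia
  obtain ⟨f, hf0, hf, hsum⟩ := exists_sum_pow_mul_eq_zero (e := e) p (fun k => monomial η (m k))
    (l := Q - 1) (m := Q + 5) (fun k => (poleOrder_monomial_le hη _).trans (hm k)) (by lia) (by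
      rw [hQ0, Fintype.card_prod, Fintype.card_fin, Fintype.card_bool]
      obtain ⟨r, rfl⟩ : ∃ r, Q = r + 5 := ⟨Q - 5, by lia⟩
      rw [show r + 5 - 1 = r + 4 by lia]
      nlinarith)
  rw [hQ0] at hsum hQ he
  refine ⟨∑ k, f k * monomial (mk W Y) (m k) ^ Q, fun h => hf0 ?_, ?_, ?_⟩
  · have := eq_zero_of_sum_eq_zero (fun i j hi hj hij => ?_) h
    · ext1 k
      exact (mul_eq_zero.mp (congr_fun this k)).resolve_right
        (pow_ne_zero _ (monomial_mk_Y_ne_zero _))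
    · rw [poleOrder_mul (left_ne_zero_of_mul hi) (right_ne_zero_of_mul hi),
        poleOrder_mul (left_ne_zero_of_mul hj) (right_ne_zero_of_mul hj), poleOrder_pow,
        poleOrder_pow, poleOrder_monomial_mk_Y, poleOrder_monomial_mk_Y] at hij
      have hij' := congr_arg (· / Q) hij
      have hQpos : 0 < Q := by lia
      simp only [Nat.add_mul_div_left _ _ hQpos] at hij'
      rw [Nat.div_eq_of_lt ((hf i).trans_lt (by lia)),
        Nat.div_eq_of_lt ((hf j).trans_lt (by lia))] at hij'
      obtain ⟨i, x⟩ := i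
      obtain ⟨j, y⟩ := j
      simp only [m, zero_add] at hij'
      rw [Prod.mk.injEq, Fin.ext_iff]
      cases x <;> cases y <;> simp at hij' ⊢ <;> lia
  · rw [← mem_poleLE]
    refine Submodule.sum_mem _ fun k _ => mem_poleLE.mpr ?_
    refine (poleOrder_mul_le _ _).trans ?_
    rw [poleOrder_pow, poleOrder_monomial_mk_Y, hQ]
    have h1 := hf k
    have h2 := Nat.mul_le_mul_left Q (hm k)
    have h3 : Q * (Q + 5) = Q ^ 2 + 5 * Q := by ring
    lia
  · intro Ω _ _ φ hX hY
    have : CharP Ω p := charP_of_injective_algebraMap' F p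
    refine pow_eq_zero_iff (n := Q) (by lia) |>.mp ?_
    have hmon (k : ℕ × Bool) : (φ (monomial (mk W Y) k) ^ Q) ^ Q = φ (monomial η k) := by
      rw [← pow_mul, ← sq, ← hQ, monomial, monomial, map_mul, map_mul, map_pow, map_pow, map_pow,
        mul_pow, ← pow_mul, ← pow_mul, mul_comm k.1, mul_comm k.2.toNat, pow_mul, pow_mul, hX, hY]
    rw [map_sum, ← hQ0, sum_pow_char_pow, hQ0, ← map_zero φ, ← hsum, map_sum]
    refine Finset.sum_congr rfl fun k _ => ?_
    rw [map_mul, map_mul, map_pow, map_pow, mul_pow, hmon]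

end Auxiliary

end WeierstrassCurve.Affine.CoordinateRing

/-! ### Solutions of quadratic equations over finite fields -/

section Quadratic

variable {F : Type*} [Field F] {b c : F}

lemma eq_or_eq_of_sq_add_mul_eq {y z : F} (hy : y ^ 2 + b * y = c) (hz : z ^ 2 + b * z = c) :
    z = y ∨ z = -y - b := by
  have : (z - y) * (z - (-y - b)) = 0 := by linear_combination hz - hy
  exact (mul_eq_zero.mp this).imp sub_eq_zero.mp sub_eq_zero.mp

variable [Finite F]

lemma FiniteField.exists_algebraMap_eq_of_pow_card_eq {Ω : Type*} [Field Ω] [Algebra F Ω] {y : Ω}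
    (hy : y ^ Nat.card F = y) : ∃ z : F, algebraMap F Ω z = y := by
  have := Fintype.ofFinite F
  rw [Nat.card_eq_fintype_card] at hy
  have h : (X ^ Fintype.card F - X : F[X]).Splits := by
    have := FiniteField.isSplittingField_sub F F
    simpa using this.splits
  have h0 : (X ^ Fintype.card F - X : F[X]) ≠ 0 :=
    FiniteField.X_pow_card_sub_X_ne_zero F Fintype.one_lt_card
  obtain ⟨z, hz⟩ := h.mem_range_of_isRoot (i := algebraMap F Ω) (x := y) h0 (by simp [hy])
  exact ⟨z, hz⟩

lemma two_le_add_ncard {Ω : Type*} [Field Ω] [Algebra F Ω] [IsAlgClosed Ω] {u v : F} {M : ℕ}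
    (h2 : u = 0 → v = 0 → 2 ≤ M) (h1 : ∀ y, y ^ 2 + b * y = c → u + v * y = 0 → 1 ≤ M)
    (h : ∀ y : Ω, y ^ 2 + algebraMap F Ω b * y = algebraMap F Ω c →
      y ^ Nat.card F = -y - algebraMap F Ω b → algebraMap F Ω u + algebraMap F Ω v * y = 0) :
    2 ≤ M + {y | y ^ 2 + b * y = c}.ncard := by
  have := Fintype.ofFinite F
  rcases Set.eq_empty_or_nonempty {y | y ^ 2 + b * y = c} with h0 | ⟨y, hy⟩
  · obtain ⟨y, hy⟩ := IsAlgClosed.exists_root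
      (C 1 * X ^ 2 + C (algebraMap F Ω b) * X + C (-algebraMap F Ω c))
      (by rw [degree_quadratic one_ne_zero]; norm_num)
    have hy' : y ^ 2 + algebraMap F Ω b * y = algebraMap F Ω c := by
      simp [IsRoot] at hy
      linear_combination hy
    have hnot (z : F) : algebraMap F Ω z ≠ y := by
      rintro rfl
      have : z ∈ {y | y ^ 2 + b * y = c} := (algebraMap F Ω).injective (by simpa using hy')
      rwa [h0] at this
    have hfrob : y ^ Nat.card F = -y - algebraMap F Ω b := by
      refine (eq_or_eq_of_sq_add_mul_eq hy' ?_).resolve_left fun hy1 => ?_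
      · have := congr_arg (FiniteField.frobeniusAlgHom F Ω) hy'
        rw [map_add, map_mul, map_pow] at this
        simpa [Nat.card_eq_fintype_card] using this
      · obtain ⟨z, hz⟩ := FiniteField.exists_algebraMap_eq_of_pow_card_eq hy1
        exact hnot z hz
    have huv := h y hy' hfrob
    have hv : v = 0 := by
      by_contra hv
      have hv' : algebraMap F Ω v ≠ 0 := by simpa using hv
      refine hnot (-u / v) ?_
      rw [map_div₀, map_neg, div_eq_iff hv']
      linear_combination -huv
    exact (h2 (by simpa [hv] using huv) hv).trans (Nat.le_add_right _ _)
  · have hy : y ^ 2 + b * y = c := hy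
    by_cases hyb : -y - b = y
    · have := h1 y hy (by
        have := h (algebraMap F Ω y) (by simpa using congr_arg (algebraMap F Ω) hy) (by
          rw [← map_pow, Nat.card_eq_fintype_card, FiniteField.pow_card, ← map_neg, ← map_sub, hyb])
        exact (algebraMap F Ω).injective (by simpa using this))
      have hpos : 0 < {y | y ^ 2 + b * y = c}.ncard := (Set.ncard_pos).mpr ⟨y, hy⟩
      lia
    · have hsub : {y, -y - b} ⊆ {y | y ^ 2 + b * y = c} := by
        rintro z (rfl | rfl)
        · exact hy
        · change _ = _
          linear_combination hy
      have := Set.ncard_le_ncard hsub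
      rw [Set.ncard_pair (Ne.symm hyb)] at this
      lia

end Quadratic

lemma Polynomial.sum_rootMultiplicity_le {F : Type*} [Field F] [Fintype F] (f : F[X]) :
    ∑ x, f.rootMultiplicity x ≤ f.natDegree := by
  classical
  simp only [← count_roots]
  rw [Multiset.sum_count_eq_card (by simp)]
  exact card_roots' f

namespace WeierstrassCurve.Affine.CoordinateRing

variable {F : Type*} [Field F] {W : Affine F}

lemma two_le_rootMultiplicity_norm {u v : F[X]} {x : F}
    (hG : Algebra.norm F[X] (u • (1 : W.CoordinateRing) + v • mk W Y) ≠ 0)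
    (hu : u.eval x = 0) (hv : v.eval x = 0) :
    2 ≤ (Algebra.norm F[X] (u • (1 : W.CoordinateRing) + v • mk W Y)).rootMultiplicity x := by
  rw [le_rootMultiplicity_iff hG, norm_smul_basis]
  obtain ⟨u, rfl⟩ := dvd_iff_isRoot.mpr hu
  obtain ⟨v, rfl⟩ := dvd_iff_isRoot.mpr hv
  exact ⟨u ^ 2 - u * v * (C W.a₁ * X + C W.a₃) -
    v ^ 2 * (X ^ 3 + C W.a₂ * X ^ 2 + C W.a₄ * X + C W.a₆), by ring⟩

lemma one_le_rootMultiplicity_norm {u v : F[X]} {x y : F}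
    (hG : Algebra.norm F[X] (u • (1 : W.CoordinateRing) + v • mk W Y) ≠ 0)
    (hy : y ^ 2 + (W.a₁ * x + W.a₃) * y = x ^ 3 + W.a₂ * x ^ 2 + W.a₄ * x + W.a₆)
    (h : u.eval x + v.eval x * y = 0) :
    1 ≤ (Algebra.norm F[X] (u • (1 : W.CoordinateRing) + v • mk W Y)).rootMultiplicity x := by
  rw [Nat.one_le_iff_ne_zero, ← Nat.pos_iff_ne_zero, rootMultiplicity_pos hG, norm_smul_basis,
    IsRoot]
  simp only [eval_sub, eval_add, eval_mul, eval_pow, eval_X, eval_C]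
  linear_combination (u.eval x - v.eval x * y - v.eval x * (W.a₁ * x + W.a₃)) * h +
    v.eval x ^ 2 * hy

variable [Finite F]

lemma natCard_algHom_self (W : Affine F) [Fintype F] :
    Nat.card (W.CoordinateRing →ₐ[F] F) = ∑ x : F, {y : F | y ^ 2 + (W.a₁ * x + W.a₃) * y =
      x ^ 3 + W.a₂ * x ^ 2 + W.a₄ * x + W.a₆}.ncard := by
  have e : (W.CoordinateRing →ₐ[F] F) ≃ Σ x : F, {y : F | y ^ 2 + (W.a₁ * x + W.a₃) * y =
      x ^ 3 + W.a₂ * x ^ 2 + W.a₄ * x + W.a₆} :=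
    (algHomEquiv W F).trans <| (Equiv.subtypeEquivRight fun P => by
      simp only [Algebra.algebraMap_self, RingHom.id_apply, Set.mem_ofPred_eq]
      rw [add_mul, add_assoc]).trans <|
    Equiv.subtypeProdEquivSigmaSubtype fun x y : F => y ∈ {y : F | y ^ 2 + (W.a₁ * x + W.a₃) * y =
      x ^ 3 + W.a₂ * x ^ 2 + W.a₄ * x + W.a₆}
  rw [Nat.card_congr e, Nat.card_sigma]
  rfl

section Bound

variable (p : ℕ) [Fact p.Prime] [CharP F p] {e : ℕ}

theorem le_natCard_algHom_self (hQ : Nat.card F = (p ^ e) ^ 2) (he : 5 ≤ p ^ e) :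
    Nat.card F ≤ Nat.card (W.CoordinateRing →ₐ[F] F) + 6 * p ^ e := by
  have := Fintype.ofFinite F
  obtain ⟨G, hG0, hG, hvan⟩ := exists_auxiliary p (poleOrder_mk_negPolynomial_le (W := W)) hQ he
  obtain ⟨u, v, rfl⟩ := exists_smul_basis_eq G
  have hN := Algebra.norm_ne_zero_iff (R := F[X]).mpr hG0
  have key (x : F) : 2 ≤
      (Algebra.norm F[X] (u • (1 : W.CoordinateRing) + v • mk W Y)).rootMultiplicity x +
        {y : F | y ^ 2 + (W.a₁ * x + W.a₃) * y =
          x ^ 3 + W.a₂ * x ^ 2 + W.a₄ * x + W.a₆}.ncard := by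
    refine two_le_add_ncard (Ω := AlgebraicClosure F)
      (two_le_rootMultiplicity_norm hN) (fun y => one_le_rootMultiplicity_norm hN)
      fun y hy hfrob => ?_
    have hxy : y ^ 2 + algebraMap F _ W.a₁ * algebraMap F _ x * y + algebraMap F _ W.a₃ * y =
        algebraMap F (AlgebraicClosure F) x ^ 3 + algebraMap F _ W.a₂ * algebraMap F _ x ^ 2 +
          algebraMap F _ W.a₄ * algebraMap F _ x + algebraMap F _ W.a₆ := by
      simp only [map_add, map_mul, map_pow] at hy
      linear_combination hy
    let P := (algHomEquiv W (AlgebraicClosure F)).symm ⟨(algebraMap F _ x, y), hxy⟩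
    have hP := (algHomEquiv W (AlgebraicClosure F)).apply_symm_apply ⟨(algebraMap F _ x, y), hxy⟩
    have hX : P (mk W (C X)) = algebraMap F _ x := congr_arg (·.1.1) hP
    have hY : P (mk W Y) = y := congr_arg (·.1.2) hP
    have hη : P (mk W W.negPolynomial) = -y - algebraMap F _ (W.a₁ * x + W.a₃) := by
      rw [negPolynomial, map_sub, map_neg, map_sub, map_neg, hY, ← algebraMap_eq_mk]
      have := algHom_apply_smul_basis P (C W.a₁ * X + C W.a₃) 0
      rw [zero_smul, add_zero, ← Algebra.algebraMap_eq_smul_one] at this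
      rw [this, hX]
      simp
    have h := hvan P (by
      rw [hX, ← map_pow, Nat.card_eq_fintype_card, FiniteField.pow_card]) (by rw [hY, hfrob, hη])
    rw [algHom_apply_smul_basis, hX, hY] at h
    simpa [aeval_algebraMap_apply] using h
  have h := Finset.sum_le_sum fun x (_ : x ∈ Finset.univ) => key x
  rw [Finset.sum_const, Finset.sum_add_distrib, ← natCard_algHom_self, Finset.card_univ,
    ← Nat.card_eq_fintype_card, smul_eq_mul] at h
  have h' := (sum_rootMultiplicity_le _).trans hG
  lia

end Bound

end WeierstrassCurve.Affine.CoordinateRing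

/-! ### The Hasse bound -/

lemma sq_le_of_forall_pow_add_pow_le {a q c : ℝ} (hq : 0 < q) {m : ℕ}
    (h : ∀ x y : ℝ, x * y = q → x + y = a →
      ∀ k, m ≤ k → x ^ (2 * k) + y ^ (2 * k) ≤ c * q ^ k) : a ^ 2 ≤ 4 * q := by
  by_contra! hlt
  obtain ⟨s, hs, hs2⟩ : ∃ s, 0 < s ∧ s ^ 2 = a ^ 2 - 4 * q :=
    ⟨√(a ^ 2 - 4 * q), Real.sqrt_pos.mpr (by linarith), Real.sq_sqrt (by linarith)⟩
  obtain ⟨x, y, hxy, hsum, hx⟩ : ∃ x y : ℝ, x * y = q ∧ x + y = a ∧ q < x ^ 2 := by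
    rcases lt_or_ge 0 a with ha | ha
    · exact ⟨(a + s) / 2, (a - s) / 2, by linear_combination -hs2 / 4, by ring,
        by nlinarith [mul_pos ha hs]⟩
    · exact ⟨(a - s) / 2, (a + s) / 2, by linear_combination -hs2 / 4, by ring,
        by nlinarith [mul_nonneg (neg_nonneg.mpr ha) hs.le, sq_nonneg s]⟩
  obtain ⟨k, hk⟩ := pow_unbounded_of_one_lt c ((one_lt_div hq).mpr hx)
  have h1 := h x y hxy hsum (k + m) (Nat.le_add_left m k)
  have h2 : (x ^ 2 / q) ^ k ≤ (x ^ 2 / q) ^ (k + m) :=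
    pow_le_pow_right₀ ((one_lt_div hq).mpr hx).le (Nat.le_add_right k m)
  have h3 := hk.trans_le h2
  rw [div_pow, lt_div_iff₀ (by positivity), ← pow_mul] at h3
  have h4 : 0 ≤ y ^ (2 * (k + m)) := (even_two_mul _).pow_nonneg y
  linarith

namespace WeierstrassCurve.Affine.CoordinateRing

variable {F : Type*} [Field F]

lemma natCard_algHom_baseChange (W : WeierstrassCurve F) (L : Type*) [Field L] [Algebra F L] :
    Nat.card ((W.baseChange L).toAffine.CoordinateRing →ₐ[L] L) =
      Nat.card (W.toAffine.CoordinateRing →ₐ[F] L) := by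
  rw [Nat.card_congr (algHomEquiv (W.baseChange L).toAffine L),
    Nat.card_congr (algHomEquiv W.toAffine L)]
  rfl

variable [Finite F] {W : Affine F}

/-- The **Hasse bound** for the trace of Frobenius. -/
theorem sq_le_four_mul_card (hW : W.Δ ≠ 0) :
    ((Nat.card F + 1 - Nat.card W.Point : ℝ)) ^ 2 ≤ 4 * Nat.card F := by
  obtain ⟨p, hp⟩ := CharP.exists F
  have := Fact.mk (CharP.char_is_prime F p)
  have := Fintype.ofFinite F
  obtain ⟨r, -, hr⟩ := FiniteField.card F p
  rw [← Nat.card_eq_fintype_card] at hr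
  have hF : 2 ≤ Nat.card F := Finite.one_lt_card
  refine sq_le_of_forall_pow_add_pow_le (c := 6) (m := 3) (by positivity)
    fun x y hxy hsum k hk => ?_
  have : NeZero (2 * k) := ⟨by lia⟩
  let L := FiniteField.Extension F p (2 * k)
  have : CharP L p := charP_of_injective_algebraMap' F p
  have hL : Nat.card L = (p ^ (r * k)) ^ 2 := by
    rw [FiniteField.natCard_extension, hr]
    ring
  have h5 : 5 ≤ p ^ (r * k) := by
    rw [pow_mul, ← hr]
    calc 5 ≤ 2 ^ 3 := by norm_num
      _ ≤ Nat.card F ^ 3 := Nat.pow_le_pow_left hF 3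
      _ ≤ Nat.card F ^ k := Nat.pow_le_pow_right (by lia) hk
  have h1 := le_natCard_algHom_self p (W := (WeierstrassCurve.baseChange W L).toAffine) hL h5
  have h2 := natCard_algHom hW (α := x) (β := y) (by exact_mod_cast hxy) (by exact_mod_cast hsum) L
  rw [natCard_algHom_baseChange, FiniteField.natCard_extension, pow_mul p, ← hr] at h1
  rw [FiniteField.finrank_extension] at h2
  have h3 : (Nat.card (W.CoordinateRing →ₐ[F] L) : ℝ) =
    Nat.card F ^ (2 * k) - x ^ (2 * k) - y ^ (2 * k) := by exact_mod_cast h2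
  have h4 : (Nat.card F ^ (2 * k) : ℝ) ≤
    Nat.card (W.CoordinateRing →ₐ[F] L) + 6 * Nat.card F ^ k := by exact_mod_cast h1
  linarith

end WeierstrassCurve.Affine.CoordinateRing

/-- **Existence of a Weil number for an elliptic curve**: if `K` is a finite field with `q`
elements and `W` is a smooth Weierstrass curve over `K`, then there exists `α ∈ ℂ` with
`α·ᾱ = q` such that for every finite field extension `L` of `K` of degree `n`, the number of
`L`-rational points of the base change of `W` to `L` equals `qⁿ + 1 − αⁿ − ᾱⁿ`. -/
theorem exists_weil_number (K : Type*) [Field K] [Fintype K] (q : ℕ)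
    (hq : Fintype.card K = q) (W : WeierstrassCurve K) (hW : W.Δ ≠ 0) :
    ∃ α : ℂ, α * (starRingEnd ℂ) α = q ∧
      ∀ (L : Type*) [Field L] [Fintype L] [Algebra K L] (n : ℕ), 0 < n →
        Module.finrank K L = n →
        (WeierstrassCurve.ptCount L (W.baseChange L) : ℂ)
          = q ^ n + 1 - α ^ n - ((starRingEnd ℂ) α) ^ n := by
  rw [← Nat.card_eq_fintype_card] at hq
  subst hq
  have hbound := WeierstrassCurve.Affine.CoordinateRing.sq_le_four_mul_card
    (W := W.toAffine) hW
  set a : ℝ := Nat.card K + 1 - Nat.card W.toAffine.Point with ha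
  have hs := Real.sq_sqrt (sub_nonneg.mpr hbound)
  let α : ℂ := ⟨a / 2, √(4 * Nat.card K - a ^ 2) / 2⟩
  have hmul : α * (starRingEnd ℂ) α = Nat.card K := by
    rw [Complex.mul_conj, ← Complex.ofReal_natCast, Complex.ofReal_inj, Complex.normSq_mk]
    linear_combination hs / 4
  have hadd : α + (starRingEnd ℂ) α = Nat.card K + 1 - Nat.card W.toAffine.Point := by
    rw [Complex.add_conj, mul_div_cancel₀ _ two_ne_zero, ha]
    push_cast
    rfl
  refine ⟨α, hmul, fun L _ _ _ n _ hn => ?_⟩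
  have h := WeierstrassCurve.Affine.CoordinateRing.natCard_algHom hW hmul hadd L
  rw [Nat.card_congr (WeierstrassCurve.Affine.CoordinateRing.algHomEquiv W.toAffine L), hn] at h
  change ((1 + Nat.card _ : ℕ) : ℂ) = _
  rw [Nat.cast_add]
  change _ + (Nat.card {P : L × L // P.2 ^ 2 + algebraMap K L W.a₁ * P.1 * P.2 +
    algebraMap K L W.a₃ * P.2 = P.1 ^ 3 + algebraMap K L W.a₂ * P.1 ^ 2 +
      algebraMap K L W.a₄ * P.1 + algebraMap K L W.a₆} : ℂ) = _
  rw [h]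
  push_cast
  ring
end

section
/- For g beyond (q − √q)/2 Ihara's bound improves on Hasse–Weil: for all real numbers q ≥ 2 and g with g > (q − √q)/2, one has (√((8q+1)g² + 4(q²−q)g) − g)/2 < 2g√q. -/
/-- For `g` beyond `(q − √q)/2` Ihara's bound improves on Hasse–Weil: for all real `q ≥ 2`
and `g > (q − √q)/2`, one has `(√((8q+1)g² + 4(q²−q)g) − g)/2 < 2g√q`. -/
theorem ihara_improves_hasse_weil (q g : ℝ) (hq : 2 ≤ q)
    (hg : (q - Real.sqrt q) / 2 < g) :
    (Real.sqrt ((8 * q + 1) * g ^ 2 + 4 * (q ^ 2 - q) * g) - g) / 2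
      < 2 * g * Real.sqrt q := by
  obtain ⟨s, hs⟩ : ∃ s, s = Real.sqrt q := ⟨_, rfl⟩
  have hs1 : 1 < s := by rw [hs, Real.lt_sqrt zero_le_one]; linarith
  obtain rfl : q = s ^ 2 := by rw [hs, Real.sq_sqrt (by linarith)]
  rw [← hs] at hg ⊢
  have hgap : 0 < 2 * g - s * (s - 1) := by linarith
  have hg0 : 0 < g := by nlinarith
  have hlt : Real.sqrt ((8 * s ^ 2 + 1) * g ^ 2 + 4 * ((s ^ 2) ^ 2 - s ^ 2) * g)
      < g * (1 + 4 * s) := by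
    rw [Real.sqrt_lt' (by positivity)]
    have hpos : 0 < 4 * s * (s + 1) * g * (2 * g - s * (s - 1)) := by positivity
    linarith
  linarith
end

section
/- The hermitian curve x^{q+1} + y^{q+1} + z^{q+1} = 0 has q³ + 1 rational points over 𝔽_{q²}: if q is a prime power and K is a finite field with q² elements, then the number of nonzero triples (x,y,z) ∈ K³ with x^{q+1} + y^{q+1} + z^{q+1} = 0 equals (q³ + 1)(q² − 1); equivalently, the corresponding projective plane curve has exactly q³ + 1 points rational over K. -/
open Finset

/-- In a finite cyclic group of order `m * n`, every element killed by `n` is an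
`m`-th power. -/
theorem IsCyclic.mem_powMonoidHom_range_of_pow_eq_one {G : Type*} [CommGroup G] [IsCyclic G]
    [Finite G] {m n : ℕ} (hG : Nat.card G = m * n) {u : G} (hu : u ^ n = 1) :
    u ∈ (powMonoidHom m : G →* G).range := by
  have hpos : 0 < m * n := hG ▸ Nat.card_pos
  have hle : (powMonoidHom m : G →* G).range ≤ (powMonoidHom n : G →* G).ker := by
    rintro _ ⟨v, rfl⟩
    simp only [MonoidHom.mem_ker, powMonoidHom_apply, ← pow_mul, ← hG, pow_card_eq_one']
  have hcard : Nat.card (powMonoidHom n : G →* G).ker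
      ≤ Nat.card (powMonoidHom m : G →* G).range := by
    rw [IsCyclic.card_powMonoidHom_ker, IsCyclic.card_powMonoidHom_range, hG,
      Nat.gcd_mul_right_left, Nat.gcd_mul_left_left,
      Nat.mul_div_cancel_left _ (Nat.pos_of_mul_pos_right hpos)]
  rw [Subgroup.eq_of_le_of_card_ge hle hcard]
  exact hu

section HermitianCurve

variable {K : Type*} [Field K] [Fintype K] {q : ℕ}

/-- In a field with `q²` elements, `x ↦ x ^ q` is compatible with subtraction. -/
theorem sub_pow_of_card_eq_sq (hq : IsPrimePow q) (hK : Fintype.card K = q ^ 2) (a b : K) :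
    (a - b) ^ q = a ^ q - b ^ q := by
  obtain ⟨p, n, hp, -, rfl⟩ := hq
  have : Fact p.Prime := ⟨hp.nat_prime⟩
  have : CharP K p := charP_of_card_eq_prime_pow (hK.trans (pow_mul p n 2).symm)
  exact sub_pow_char_pow a b n

theorem pow_succ_pow_of_card_eq_sq (hK : Fintype.card K = q ^ 2) (x : K) :
    (x ^ (q + 1)) ^ q = x ^ (q + 1) := by
  rw [← pow_mul, add_mul, pow_add, one_mul, ← sq, ← hK, FiniteField.pow_card, pow_succ, mul_comm]

variable [DecidableEq K]

/-- The fibres of the norm `x ↦ x ^ (q + 1)` from `𝔽_{q²}` over elements of `𝔽_q`. -/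
theorem card_filter_pow_succ_eq (hK : Fintype.card K = q ^ 2) {a : K} (ha : a ^ q = a) :
    (#{x : K | x ^ (q + 1) = a} : ℤ) = (q + 1) - q * if a = 0 then 1 else 0 := by
  classical
  split_ifs with h0
  · have : ({x : K | x ^ (q + 1) = a} : Finset K) = {0} := by
      ext x; simp [h0]
    simp [this]
  · have hq : 1 < q := by
      have := hK ▸ Fintype.one_lt_card (α := K)
      by_contra! h
      interval_cases q <;> simp at this
    have hunits : Nat.card Kˣ = (q + 1) * (q - 1) := by
      rw [Nat.card_units, Nat.card_eq_fintype_card, hK, ← Nat.sq_sub_sq, one_pow]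
    have hu : (Units.mk0 a h0) ^ (q - 1) = 1 := by
      ext
      apply mul_right_cancel₀ h0
      simp [← pow_succ, Nat.sub_add_cancel hq.le, ha]
    obtain ⟨v, hv⟩ := IsCyclic.mem_powMonoidHom_range_of_pow_eq_one hunits hu
    have hfib := MonoidHom.card_fiber_eq_of_mem_range (powMonoidHom (q + 1) : Kˣ →* Kˣ)
      ⟨v, hv⟩ ⟨1, map_one _⟩
    have hker := IsCyclic.card_powMonoidHom_ker (G := Kˣ) (q + 1)
    rw [hunits, Nat.gcd_mul_right_left] at hker
    have hker' : #{g : Kˣ | powMonoidHom (q + 1) g = 1} = q + 1 := by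
      rw [Nat.card_eq_fintype_card, Fintype.card_subtype] at hker
      simpa only [MonoidHom.mem_ker] using hker
    have himage : ({x : K | x ^ (q + 1) = a} : Finset K)
        = ({g : Kˣ | powMonoidHom (q + 1) g = Units.mk0 a h0} : Finset Kˣ).map
            ⟨Units.val, Units.val_injective⟩ := by
      ext x
      simp only [mem_filter, mem_univ, true_and, mem_map, powMonoidHom_apply,
        Function.Embedding.coeFn_mk]
      constructor
      · intro hx
        have hx0 : x ≠ 0 := by rintro rfl; simp at hx; exact h0 hx.symm
        exact ⟨Units.mk0 x hx0, by ext; simpa using hx, rfl⟩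
      · rintro ⟨g, hg, rfl⟩
        simpa using congrArg Units.val hg
    rw [himage, card_map, hfib, hker']
    simp

/-- The number of points of the affine hermitian curve `x ^ (q + 1) + y ^ (q + 1) = a`. -/
theorem sum_card_filter_pow_succ_eq_sub (hq : IsPrimePow q) (hK : Fintype.card K = q ^ 2)
    {a : K} (ha : a ^ q = a) :
    ∑ x : K, (#{y : K | y ^ (q + 1) = a - x ^ (q + 1)} : ℤ)
      = q ^ 2 * (q + 1) - q * #{x : K | x ^ (q + 1) = a} := by
  have h (x : K) : (#{y : K | y ^ (q + 1) = a - x ^ (q + 1)} : ℤ)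
      = (q + 1) - q * if x ^ (q + 1) = a then 1 else 0 := by
    rw [card_filter_pow_succ_eq hK (by
      rw [sub_pow_of_card_eq_sq hq hK, ha, pow_succ_pow_of_card_eq_sq hK])]
    simp only [sub_eq_zero, eq_comm (a := a)]
  simp only [h, sum_sub_distrib, ← mul_sum, sum_boole, sum_const, card_univ, hK, nsmul_eq_mul]
  push_cast
  ring

/-- The number of affine points of the cone over the hermitian curve. -/
theorem card_filter_hermitian (hq : IsPrimePow q) (hK : Fintype.card K = q ^ 2) :
    (#{v : K × K × K | v.1 ^ (q + 1) + v.2.1 ^ (q + 1) + v.2.2 ^ (q + 1) = 0} : ℤ)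
      = q ^ 5 - q ^ 3 + q ^ 2 := by
  have hzero : (0 : K) ^ q = 0 := zero_pow hq.ne_zero
  have hslice : (#{v : K × K × K | v.1 ^ (q + 1) + v.2.1 ^ (q + 1) + v.2.2 ^ (q + 1) = 0} : ℤ)
      = ∑ x : K, ∑ y : K, (#{z : K | z ^ (q + 1) = (0 - x ^ (q + 1)) - y ^ (q + 1)} : ℤ) := by
    simp only [← sum_boole, Fintype.sum_prod_type]
    refine sum_congr rfl fun x _ => sum_congr rfl fun y _ => sum_congr rfl fun z _ => ?_
    congr 1
    rw [eq_iff_iff]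
    constructor <;> intro h <;> linear_combination h
  have hfix (x : K) : (0 - x ^ (q + 1)) ^ q = 0 - x ^ (q + 1) := by
    rw [sub_pow_of_card_eq_sq hq hK, hzero, pow_succ_pow_of_card_eq_sq hK]
  rw [hslice, sum_congr rfl fun x _ => sum_card_filter_pow_succ_eq_sub hq hK (hfix x),
    sum_sub_distrib, ← mul_sum _ _ (q : ℤ), sum_card_filter_pow_succ_eq_sub hq hK hzero,
    card_filter_pow_succ_eq hK hzero]
  simp only [sum_const, card_univ, hK, nsmul_eq_mul, if_true]
  push_cast
  ring

end HermitianCurve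

/-- The hermitian curve `x^(q+1) + y^(q+1) + z^(q+1) = 0` has `q³ + 1` rational points over
`𝔽_{q²}`: if `q` is a prime power and `K` is a finite field with `q²` elements, then the
number of nonzero triples `(x, y, z) ∈ K³` with `x^(q+1) + y^(q+1) + z^(q+1) = 0` equals
`(q³ + 1)(q² − 1)`. -/
theorem hermitian_curve_count (q : ℕ) (hq : IsPrimePow q) (K : Type*) [Field K] [Fintype K]
    (hK : Fintype.card K = q ^ 2) :
    Nat.card {v : K × K × K // v ≠ 0 ∧
      v.1 ^ (q + 1) + v.2.1 ^ (q + 1) + v.2.2 ^ (q + 1) = 0}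
      = (q ^ 3 + 1) * (q ^ 2 - 1) := by
  classical
  have hset : ({v : K × K × K | v ≠ 0 ∧
      v.1 ^ (q + 1) + v.2.1 ^ (q + 1) + v.2.2 ^ (q + 1) = 0} : Finset (K × K × K))
      = ({v : K × K × K | v.1 ^ (q + 1) + v.2.1 ^ (q + 1) + v.2.2 ^ (q + 1) = 0} :
          Finset (K × K × K)).erase 0 := by
    ext v
    simp
  have hcard := card_filter_hermitian hq hK
  have hpos : 1 ≤ q ^ 2 := Nat.one_le_pow _ _ hq.pos
  rw [Nat.card_eq_fintype_card, Fintype.card_subtype, hset]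
  zify [hpos]
  rw [cast_card_erase_of_mem (by simp), hcard]
  ring
end

section
/- Gauss's count for the cubic Fermat curve, inert case: let p be a prime with p ≢ 1 (mod 3). Then the number of nonzero triples (x,y,z) ∈ (ℤ/pℤ)³ with x³ + y³ + z³ = 0 equals (p + 1)(p − 1); equivalently, the projective curve x³ + y³ + z³ = 0 has exactly p + 1 points over 𝔽_p. -/
/-- Cubing is a bijection of `ℤ/pℤ` when `p` is a prime with `p ≢ 1 (mod 3)`. -/
theorem ZMod.bijective_pow_three {p : ℕ} [Fact p.Prime] (hp : p % 3 ≠ 1) :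
    Function.Bijective fun x : ZMod p => x ^ 3 := by
  have hprime : p.Prime := Fact.out
  obtain ⟨k, hk⟩ : ∃ k : ℕ, ∀ x : ZMod p, (x ^ 3) ^ k = x := by
    by_cases h3 : p = 3
    · subst h3
      exact ⟨1, fun x => by rw [pow_one, ZMod.pow_card]⟩
    · have h0 : p % 3 ≠ 0 := fun h =>
        h3 ((Nat.prime_dvd_prime_iff_eq Nat.prime_three hprime).1 (Nat.dvd_of_mod_eq_zero h)).symm
      have hpos := hprime.two_le
      refine ⟨(2 * p - 1) / 3, fun x => ?_⟩
      rw [← pow_mul, show 3 * ((2 * p - 1) / 3) = p + (p - 1) by omega, pow_add, ZMod.pow_card,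
        ← pow_succ', Nat.sub_add_cancel hprime.one_le, ZMod.pow_card]
  exact Finite.injective_iff_bijective.1 (Function.LeftInverse.injective (g := (· ^ k)) hk)

/-- **Gauss's count for the cubic Fermat curve, inert case**: let `p` be a prime with
`p ≢ 1 (mod 3)`.  Then the number of nonzero triples `(x, y, z) ∈ (ℤ/pℤ)³` with
`x³ + y³ + z³ = 0` equals `(p + 1)(p − 1)`; equivalently, the projective curve
`x³ + y³ + z³ = 0` has exactly `p + 1` points over `𝔽_p`. -/
theorem gauss_fermat_cubic_inert (p : ℕ) [Fact p.Prime] (hp : p % 3 ≠ 1) :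
    Nat.card {v : ZMod p × ZMod p × ZMod p // v ≠ 0 ∧
      v.1 ^ 3 + v.2.1 ^ 3 + v.2.2 ^ 3 = 0}
      = (p + 1) * (p - 1) := by
  have hbij := ZMod.bijective_pow_three hp
  let f : {v : ZMod p × ZMod p × ZMod p // v ≠ 0 ∧ v.1 ^ 3 + v.2.1 ^ 3 + v.2.2 ^ 3 = 0} →
      {w : ZMod p × ZMod p // w ≠ 0} := fun v => ⟨(v.1.1, v.1.2.1), by
    obtain ⟨⟨x, y, z⟩, hne, h⟩ := v
    intro hxy
    obtain ⟨rfl, rfl⟩ : x = 0 ∧ y = 0 := by simpa using hxy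
    exact hne (by simpa using h)⟩
  have hf : Function.Bijective f := by
    constructor
    · rintro ⟨⟨x, y, z⟩, hne, h⟩ ⟨⟨x', y', z'⟩, hne', h'⟩ heq
      obtain ⟨rfl, rfl⟩ : x = x' ∧ y = y' := by simpa [f] using heq
      obtain rfl : z = z' := hbij.1 (add_left_cancel (h.trans h'.symm))
      rfl
    · rintro ⟨⟨x, y⟩, hne⟩
      obtain ⟨z, hz⟩ := hbij.2 (-(x ^ 3 + y ^ 3))
      refine ⟨⟨(x, y, z), fun h => hne ?_, ?_⟩, rfl⟩
      · simp_all
      · simp only at hz ⊢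
        rw [hz, add_neg_cancel]
  rw [Nat.card_congr (Equiv.ofBijective f hf), Nat.card_eq_fintype_card,
    Fintype.card_subtype_compl, Fintype.card_subtype_eq, Fintype.card_prod, ZMod.card,
    ← Nat.mul_self_sub_mul_self_eq, one_mul]
end

section
/- Gauss's count for the cubic Fermat curve, split case: let p be a prime with p ≡ 1 (mod 3). Then there exist integers a and b with 4p = a² + 27b² and a ≡ 1 (mod 3), such that the number of nonzero triples (x,y,z) ∈ (ℤ/pℤ)³ with x³ + y³ + z³ = 0 equals (p + 1 + a)(p − 1); equivalently, the projective curve x³ + y³ + z³ = 0 has exactly p + 1 + a points over 𝔽_p. Moreover |a| ≤ 2√p, i.e. a² ≤ 4p. -/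
open Finset

/-- Elements of `ℤ[ω]`, for `ω` a root of `X² + X + 1`, have the form `c + d ω`. -/
lemma exists_eq_add_mul_of_mem_adjoin {R : Type*} [CommRing R] {ω : R} (hω : ω ^ 2 + ω + 1 = 0)
    {z : R} (hz : z ∈ Algebra.adjoin ℤ {ω}) : ∃ c d : ℤ, z = c + d * ω := by
  induction hz using Algebra.adjoin_induction with
  | mem x hx => exact ⟨0, 1, by simpa using hx⟩
  | algebraMap r => exact ⟨r, 0, by simp⟩
  | add x y _ _ hx hy =>
    obtain ⟨c, d, rfl⟩ := hx
    obtain ⟨c', d', rfl⟩ := hy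
    exact ⟨c + c', d + d', by push_cast; ring⟩
  | mul x y _ _ hx hy =>
    obtain ⟨c, d, rfl⟩ := hx
    obtain ⟨c', d', rfl⟩ := hy
    exact ⟨c * c' - d * d', c * d' + d * c' - d * d', by
      push_cast; linear_combination (d * d' : R) * hω⟩

section FiniteField

variable {F : Type*} [Field F] [Fintype F]

lemma exists_pow_eq_of_mulChar_eq_one {R : Type*} [CommRing R] {χ : MulChar F R}
    {u : F} (hu : u ≠ 0) (h : χ u = 1) : ∃ y : F, y ^ orderOf χ = u := by
  obtain ⟨g, hg⟩ := IsCyclic.exists_generator (α := Fˣ)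
  obtain ⟨k, hk⟩ := (mem_powers_iff_mem_zpowers.mpr (hg (Units.mk0 u hu)) :)
  have hk' : (g : F) ^ k = u := by simpa using congrArg Units.val hk
  have hχk : χ ^ k = 1 := by
    rw [MulChar.eq_iff hg, MulChar.pow_apply_coe, ← map_pow, hk', h, MulChar.one_apply_coe]
  obtain ⟨m, rfl⟩ := orderOf_dvd_of_pow_eq_one hχk
  exact ⟨(g : F) ^ m, by rw [← pow_mul, mul_comm, hk']⟩

variable [DecidableEq F]

/-- Given a primitive cube root of unity, a nonzero cube has exactly three cube roots. -/
lemma card_cube_roots_of_cube {ζ : F} (hζ : IsPrimitiveRoot ζ 3) {y : F} (hy : y ≠ 0) :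
    #{x : F | x ^ 3 = y ^ 3} = 3 := by
  have h : #(Polynomial.nthRootsFinset 3 (1 : F)) = 3 := hζ.card_nthRootsFinset
  conv_rhs => rw [← h]
  refine card_bij' (fun x _ => x / y) (fun x _ => x * y) ?_ ?_ ?_ ?_
  · intro x hx
    simp only [mem_filter, mem_univ, true_and] at hx
    rw [Polynomial.mem_nthRootsFinset (by norm_num), div_pow, hx, div_self (pow_ne_zero _ hy)]
  · intro x hx
    rw [Polynomial.mem_nthRootsFinset (by norm_num)] at hx
    simp [mul_pow, hx]
  · intro x _
    field_simp
  · intro x _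
    field_simp

lemma card_cube_roots_eq {χ : MulChar F ℂ} (hχ : orderOf χ = 3) {ζ : F}
    (hζ : IsPrimitiveRoot ζ 3) (u : F) :
    (#{x : F | x ^ 3 = u} : ℂ) = 1 + χ u + χ⁻¹ u := by
  rcases eq_or_ne u 0 with rfl | hu
  · simp [MulChar.map_zero, filter_eq']
  by_cases hcube : ∃ y : F, y ^ 3 = u
  · obtain ⟨y, rfl⟩ := hcube
    have hy : y ≠ 0 := by rintro rfl; simp at hu
    have h1 : χ (y ^ 3) = 1 := by
      rw [map_pow, ← MulChar.pow_apply' χ (by norm_num), ← hχ, pow_orderOf_eq_one,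
        MulChar.one_apply hy.isUnit]
    rw [card_cube_roots_of_cube hζ hy, MulChar.inv_apply_eq_inv', h1]
    norm_num
  · have h0 : #{x : F | x ^ 3 = u} = 0 := by
      simpa [filter_eq_empty_iff] using hcube
    have h1 : χ u ≠ 1 := fun h => hcube (hχ ▸ exists_pow_eq_of_mulChar_eq_one hu h)
    have h3 : χ u ^ 3 = 1 := by
      rw [← MulChar.pow_apply' χ (by norm_num), ← hχ, pow_orderOf_eq_one,
        MulChar.one_apply hu.isUnit]
    have hne : χ u ≠ 0 := by rintro h; simp [h] at h3
    have h2 : χ u ^ 2 + χ u + 1 = 0 := by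
      have : (χ u - 1) * (χ u ^ 2 + χ u + 1) = 0 := by linear_combination h3
      exact (mul_eq_zero.mp this).resolve_left (sub_ne_zero.mpr h1)
    rw [h0, MulChar.inv_apply_eq_inv']
    field_simp
    push_cast
    linear_combination -h2

/-- The number of affine solutions of `x³ + y³ = 1`. -/
lemma card_add_cubes_eq_one {χ : MulChar F ℂ} (hχ : orderOf χ = 3) {ζ : F}
    (hζ : IsPrimitiveRoot ζ 3) :
    (#{v : F × F | v.1 ^ 3 + v.2 ^ 3 = 1} : ℂ) =
      Fintype.card F - 2 + jacobiSum χ χ + jacobiSum χ⁻¹ χ⁻¹ := by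
  have hχ1 : χ ≠ 1 := by rintro rfl; simp at hχ
  have hχ1' : χ⁻¹ ≠ 1 := inv_ne_one.mpr hχ1
  have hneg : χ (-1) = 1 :=
    MulChar.val_neg_one_eq_one_of_odd_order (n := 3) (by decide) (hχ ▸ pow_orderOf_eq_one χ)
  have hfib : (#{v : F × F | v.1 ^ 3 + v.2 ^ 3 = 1} : ℂ) =
      ∑ u : F, (#{x : F | x ^ 3 = u} : ℂ) * (#{y : F | y ^ 3 = 1 - u} : ℂ) := by
    rw [card_eq_sum_card_fiberwise (f := fun v => v.1 ^ 3) (t := univ) (by simp)]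
    push_cast
    refine sum_congr rfl fun u _ => ?_
    rw [← Nat.cast_mul, ← card_product]
    congr 2
    ext ⟨x, y⟩
    simp only [mem_filter, mem_univ, true_and, mem_product]
    constructor
    · rintro ⟨h, rfl⟩
      exact ⟨rfl, by linear_combination h⟩
    · rintro ⟨rfl, h⟩
      exact ⟨by linear_combination h, rfl⟩
  have hflip (φ : MulChar F ℂ) : ∑ u : F, φ (1 - u) = ∑ u, φ u :=
    (Equiv.subLeft 1).sum_comp φ
  rw [hfib]
  simp_rw [card_cube_roots_eq hχ hζ]
  have hJ : jacobiSum χ⁻¹ χ = -1 := by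
    rw [jacobiSum_comm, jacobiSum_nontrivial_inv hχ1, hneg]
  have hJ' : jacobiSum χ χ⁻¹ = -1 := by rw [jacobiSum_nontrivial_inv hχ1, hneg]
  calc _ = ∑ u : F, (1 + χ u + χ⁻¹ u + χ (1 - u) + χ⁻¹ (1 - u) + χ u * χ (1 - u)
        + χ u * χ⁻¹ (1 - u) + χ⁻¹ u * χ (1 - u) + χ⁻¹ u * χ⁻¹ (1 - u)) :=
        sum_congr rfl fun u _ => by ring
    _ = Fintype.card F + jacobiSum χ χ + jacobiSum χ χ⁻¹ + jacobiSum χ⁻¹ χ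
        + jacobiSum χ⁻¹ χ⁻¹ := by
        simp only [sum_add_distrib, hflip, MulChar.sum_eq_zero_of_ne_one hχ1,
          MulChar.sum_eq_zero_of_ne_one hχ1', jacobiSum]
        simp
    _ = _ := by rw [hJ, hJ']; ring

/-- Counting the nonzero zeros of `x³ + y³ + z³` by the points at infinity and the affine part. -/
lemma card_fermat_cubic {ζ : F} (hζ : IsPrimitiveRoot ζ 3) :
    #{v : F × F × F | v ≠ 0 ∧ v.1 ^ 3 + v.2.1 ^ 3 + v.2.2 ^ 3 = 0} =
      (3 + #{v : F × F | v.1 ^ 3 + v.2 ^ 3 = 1}) * (Fintype.card F - 1) := by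
  have hunits : #{t : F | t ≠ 0} = Fintype.card F - 1 := by
    rw [filter_ne', card_erase_of_mem (mem_univ _), card_univ]
  have hthree : #{x : F | x ^ 3 = (-1) ^ 3} = 3 := card_cube_roots_of_cube hζ (by simp)
  rw [← card_filter_add_card_filter_not (fun v : F × F × F => v.2.2 = 0), add_mul, ← hunits]
  congr 1
  · conv_rhs => rw [← hthree]
    rw [← card_product]
    refine card_bij' (fun v _ => (v.1 / v.2.1, v.2.1)) (fun w _ => (w.1 * w.2, w.2, 0)) ?_ ?_ ?_ ?_
    · rintro ⟨x, y, z⟩ h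
      simp only [mem_filter, mem_univ, true_and, mem_product] at h ⊢
      obtain ⟨⟨h0, h1⟩, rfl⟩ := h
      have hy : y ≠ 0 := by
        rintro rfl
        apply h0
        have hx : x = 0 := by simpa using h1
        simp [hx]
      refine ⟨?_, hy⟩
      field_simp
      linear_combination h1
    · rintro ⟨x, y⟩ h
      simp only [mem_filter, mem_univ, true_and, mem_product] at h ⊢
      exact ⟨⟨by simp [h.2], by linear_combination y ^ 3 * h.1⟩, trivial⟩
    · rintro ⟨x, y, z⟩ h
      simp only [mem_filter, mem_univ, true_and] at h
      obtain ⟨⟨h0, h1⟩, rfl⟩ := h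
      have hy : y ≠ 0 := by
        rintro rfl
        apply h0
        have hx : x = 0 := by simpa using h1
        simp [hx]
      simp [hy]
    · rintro ⟨x, y⟩ h
      simp only [mem_filter, mem_univ, true_and, mem_product] at h
      simp [h.2]
  · rw [← card_product]
    refine card_bij' (fun v _ => ((-v.1 / v.2.2, -v.2.1 / v.2.2), v.2.2))
      (fun w _ => (-w.1.1 * w.2, -w.1.2 * w.2, w.2)) ?_ ?_ ?_ ?_
    · rintro ⟨x, y, z⟩ h
      simp only [mem_filter, mem_univ, true_and, mem_product] at h ⊢
      obtain ⟨⟨-, h1⟩, hz⟩ := h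
      refine ⟨?_, hz⟩
      field_simp
      linear_combination -h1
    · rintro ⟨⟨x, y⟩, z⟩ h
      simp only [mem_filter, mem_univ, true_and, mem_product] at h ⊢
      exact ⟨⟨by simp [h.2], by linear_combination -z ^ 3 * h.1⟩, h.2⟩
    · rintro ⟨x, y, z⟩ h
      simp only [mem_filter, mem_univ, true_and] at h
      simp [h.2]
    · rintro ⟨⟨x, y⟩, z⟩ h
      simp only [mem_filter, mem_univ, true_and, mem_product] at h
      simp [h.2]

end FiniteField

/-- The Jacobi sum of a cubic character with itself: its trace is `a` and its norm is
`(a² + 27 b²) / 4`. -/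
lemma exists_cubic_jacobiSum {F : Type*} [Field F] [Fintype F] {χ : MulChar F ℂ}
    (hχ : orderOf χ = 3) :
    ∃ a b : ℤ, 4 * (Fintype.card F : ℤ) = a ^ 2 + 27 * b ^ 2 ∧ a % 3 = 1 ∧
      jacobiSum χ χ + jacobiSum χ⁻¹ χ⁻¹ = a := by
  obtain ⟨ω, hω⟩ : ∃ ω : ℂ, IsPrimitiveRoot ω 3 := ⟨_, Complex.isPrimitiveRoot_exp 3 (by norm_num)⟩
  have hχ1 : χ ≠ 1 := by rintro rfl; simp at hχ
  have hχ3 : χ ^ 3 = 1 := hχ ▸ pow_orderOf_eq_one χ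
  have hχ2 : χ * χ ≠ 1 := by
    rw [← sq]
    exact pow_ne_one_of_lt_orderOf (by norm_num) (by omega)
  have hω2 : ω ^ 2 + ω + 1 = 0 := by
    have h := hω.geom_sum_eq_zero (by norm_num)
    simp only [sum_range_succ, sum_range_zero] at h
    linear_combination h
  have hconj : star ω = -1 - ω := by
    have hn : ‖ω‖ = 1 := hω.norm'_eq_one (by norm_num)
    have h1 : star ω = ω⁻¹ := (Complex.inv_eq_conj hn).symm
    rw [h1]
    exact inv_eq_of_mul_eq_one_right (by linear_combination -hω2)
  obtain ⟨z, hz, hJ⟩ := exists_jacobiSum_eq_neg_one_add (by norm_num) hχ3 hχ3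
    (hχ ▸ MulChar.orderOf_dvd_card_sub_one F χ) hω
  obtain ⟨c, d, rfl⟩ := exists_eq_add_mul_of_mem_adjoin hω2 hz
  have hJ' : jacobiSum χ⁻¹ χ⁻¹ = star (jacobiSum χ χ) := by
    simp only [jacobiSum, star_sum, star_mul', MulChar.star_apply']
  have hprod := jacobiSum_mul_jacobiSum_inv (F' := ℂ) (by
    rw [ringChar.eq_zero]
    exact (CharP.ringChar_ne_zero_of_finite F).symm) hχ1 hχ1 hχ2
  have e1 : jacobiSum χ χ = (-1 + 3 * d) + 3 * (d - c) * ω := by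
    rw [hJ]
    linear_combination (c + d * ω - 3 * d : ℂ) * hω2
  have e2 : jacobiSum χ⁻¹ χ⁻¹ = (-1 + 3 * d) + 3 * (d - c) * (-1 - ω) := by
    rw [hJ', e1]
    simp [← hconj]
  refine ⟨2 * (-1 + 3 * d) - 3 * (d - c), d - c, ?_, by omega, ?_⟩
  · rw [e1, e2] at hprod
    have : (4 * (Fintype.card F : ℂ)) =
        (2 * (-1 + 3 * d) - 3 * (d - c)) ^ 2 + 27 * (d - c) ^ 2 := by
      rw [← hprod]
      linear_combination (-36 * (d - c) ^ 2 : ℂ) * hω2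
    exact_mod_cast this
  · rw [e1, e2]
    push_cast
    ring

/-- **Gauss's count for the cubic Fermat curve, split case**: let `p` be a prime with
`p ≡ 1 (mod 3)`.  Then there exist integers `a`, `b` with `4p = a² + 27b²` and
`a ≡ 1 (mod 3)` such that the number of nonzero triples `(x, y, z) ∈ (ℤ/pℤ)³` with
`x³ + y³ + z³ = 0` equals `(p + 1 + a)(p − 1)`; moreover `a² ≤ 4p`. -/
theorem gauss_fermat_cubic_split (p : ℕ) [Fact p.Prime] (hp : p % 3 = 1) :
    ∃ a b : ℤ, 4 * (p : ℤ) = a ^ 2 + 27 * b ^ 2 ∧ a % 3 = 1 ∧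
      (Nat.card {v : ZMod p × ZMod p × ZMod p // v ≠ 0 ∧
        v.1 ^ 3 + v.2.1 ^ 3 + v.2.2 ^ 3 = 0} : ℤ)
        = ((p : ℤ) + 1 + a) * ((p : ℤ) - 1) ∧
      a ^ 2 ≤ 4 * (p : ℤ) := by
  have hp1 : 3 ∣ p - 1 := by omega
  have hpos : 1 ≤ p := by omega
  obtain ⟨χ, hχ⟩ := MulChar.exists_mulChar_orderOf (ZMod p) (R := ℂ) (n := 3)
    (by rwa [ZMod.card]) (Complex.isPrimitiveRoot_exp 3 (by norm_num))
  obtain ⟨ζ, hζ⟩ : ∃ ζ : ZMod p, IsPrimitiveRoot ζ 3 := by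
    have : Fact (Nat.Prime 3) := ⟨Nat.prime_three⟩
    obtain ⟨u, hu⟩ := exists_prime_orderOf_dvd_card (G := (ZMod p)ˣ) 3 (by rwa [ZMod.card_units])
    exact ⟨u, IsPrimitiveRoot.coe_units_iff.mpr (hu ▸ IsPrimitiveRoot.orderOf u)⟩
  obtain ⟨a, b, h4, ha, hsum⟩ := exists_cubic_jacobiSum hχ
  rw [ZMod.card] at h4
  refine ⟨a, b, h4, ha, ?_, by nlinarith [sq_nonneg b]⟩
  have haff := card_add_cubes_eq_one hχ hζ
  rw [add_assoc, hsum, ZMod.card] at haff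
  have haff' : (#{v : ZMod p × ZMod p | v.1 ^ 3 + v.2 ^ 3 = 1} : ℤ) = p - 2 + a := by
    exact_mod_cast haff
  rw [Nat.card_eq_fintype_card, Fintype.card_subtype, card_fermat_cubic hζ, ZMod.card]
  push_cast [hpos]
  rw [haff']
  ring
end

section
/- Mass formula for elliptic curves with given j-invariant: let K be a finite field with q elements and let j₀ ∈ K. Then the number of smooth Weierstrass curves W over K (tuples (a₁,a₂,a₃,a₄,a₆) ∈ K⁵ with Δ(W) ≠ 0) whose j-invariant equals j₀ is exactly (q − 1)·q³. (Since the group of Weierstrass coordinate changes over K has order (q − 1)q³, acts on this set with orbits the K-isomorphism classes and stabilizers the automorphism groups, this is equivalent to the statement that Σ_{E/K, j(E)=j₀} 1/#Aut_K(E) = 1, the sum being over K-isomorphism classes of elliptic curves over K with j-invariant j₀.) -/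
namespace WeierstrassCurve

variable {K : Type*} [Field K]

/-- A set of Weierstrass curves parametrised by `Kˣ × K³` has `(q - 1) * q ^ 3` elements. -/
lemma card_subtype_of_parametrization [Fintype K] (P : WeierstrassCurve K → Prop)
    (φ : WeierstrassCurve K → K × K × K × K) (ψ : K → K → K → K → WeierstrassCurve K)
    (hφ : ∀ W, P W → (φ W).1 ≠ 0)
    (hψφ : ∀ W, P W → ψ (φ W).1 (φ W).2.1 (φ W).2.2.1 (φ W).2.2.2 = W)
    (hψ : ∀ x y z w, x ≠ 0 → P (ψ x y z w))
    (hφψ : ∀ x y z w, x ≠ 0 → φ (ψ x y z w) = (x, y, z, w)) :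
    Nat.card {W : WeierstrassCurve K // P W} = (Fintype.card K - 1) * Fintype.card K ^ 3 := by
  classical
  let e : {W : WeierstrassCurve K // P W} ≃ Kˣ × K × K × K :=
    { toFun := fun W ↦ (Units.mk0 _ (hφ W.1 W.2), (φ W.1).2)
      invFun := fun p ↦ ⟨ψ p.1 p.2.1 p.2.2.1 p.2.2.2, hψ _ _ _ _ p.1.ne_zero⟩
      left_inv := fun W ↦ Subtype.ext (hψφ W.1 W.2)
      right_inv := fun ⟨x, y, z, w⟩ ↦ by
        have h := hφψ x y z w x.ne_zero
        ext <;> simp [h] }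
  rw [Nat.card_congr e, Nat.card_eq_fintype_card]
  simp only [Fintype.card_prod, Fintype.card_units]
  ring

lemma smooth_and_j_iff (W : WeierstrassCurve K) (j : K) :
    (W.Δ ≠ 0 ∧ W.c₄ ^ 3 / W.Δ = j) ↔ W.Δ ≠ 0 ∧ W.c₄ ^ 3 = j * W.Δ :=
  and_congr_right fun h ↦ div_eq_iff h

section CharTwo

variable [Fintype K] [CharP K 2]

lemma card_j_eq_zero_of_char_two :
    Nat.card {W : WeierstrassCurve K // W.Δ ≠ 0 ∧ W.c₄ ^ 3 = 0 * W.Δ}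
      = (Fintype.card K - 1) * Fintype.card K ^ 3 := by
  refine card_subtype_of_parametrization _ (fun W ↦ (W.a₃, W.a₂, W.a₄, W.a₆))
    (fun x y z w ↦ ⟨0, y, x, z, w⟩) ?_ ?_ ?_ ?_
  · rintro W ⟨hΔ, hj⟩ h
    have h₁ : W.a₁ = 0 := by simpa [c₄_of_char_two] using hj
    exact hΔ (by rw [Δ_of_char_two, h₁, show W.a₃ = 0 from h]; ring)
  · rintro W ⟨-, hj⟩
    have h₁ : W.a₁ = 0 := by simpa [c₄_of_char_two] using hj
    ext <;> simp [h₁]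
  · intro x y z w hx
    simp [Δ_of_char_two, c₄_of_char_two, hx]
  · intros; rfl

lemma card_j_ne_zero_of_char_two {j : K} (hj₀ : j ≠ 0) :
    Nat.card {W : WeierstrassCurve K // W.Δ ≠ 0 ∧ W.c₄ ^ 3 = j * W.Δ}
      = (Fintype.card K - 1) * Fintype.card K ^ 3 := by
  refine card_subtype_of_parametrization _ (fun W ↦ (W.a₁, W.a₂, W.a₃, W.a₄))
    (fun a₁ a₂ a₃ a₄ ↦ ⟨a₁, a₂, a₃, a₄,
      ((a₁ ^ 12 / j - a₃ ^ 4 - a₁ ^ 3 * a₃ ^ 3) / a₁ ^ 4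
        + a₁ * a₃ * a₄ - a₂ * a₃ ^ 2 + a₄ ^ 2) / a₁ ^ 2⟩) ?_ ?_ ?_ ?_
  · rintro W ⟨hΔ, hj⟩ h
    rw [c₄_of_char_two, show W.a₁ = 0 from h] at hj
    simp_all
  · rintro W ⟨hΔ, hj⟩
    have h₁ : W.a₁ ≠ 0 := by
      intro h
      rw [c₄_of_char_two, h] at hj
      simp_all
    have h2 : (2 : K) = 0 := CharP.cast_eq_zero K 2
    ext <;> try rfl
    simp only [c₄_of_char_two, Δ_of_char_two, b₈] at hj
    field_simp
    linear_combination hj + 2 * j * W.a₁ ^ 4 * W.a₂ * W.a₆ * h2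
  · intro a₁ a₂ a₃ a₄ h₁
    have h2 : (2 : K) = 0 := CharP.cast_eq_zero K 2
    have h4 : (4 : K) = 0 := by linear_combination 2 * h2
    have key : Δ (⟨a₁, a₂, a₃, a₄, ((a₁ ^ 12 / j - a₃ ^ 4 - a₁ ^ 3 * a₃ ^ 3) / a₁ ^ 4
        + a₁ * a₃ * a₄ - a₂ * a₃ ^ 2 + a₄ ^ 2) / a₁ ^ 2⟩ : WeierstrassCurve K)
        = a₁ ^ 12 / j := by
      simp only [Δ_of_char_two, b₈, h4]
      field_simp
      ring
    rw [key, c₄_of_char_two]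
    refine ⟨by positivity, ?_⟩
    field_simp
  · intros; rfl

end CharTwo

section CharThree

variable [Fintype K] [CharP K 3]

lemma card_j_eq_zero_of_char_three :
    Nat.card {W : WeierstrassCurve K // W.Δ ≠ 0 ∧ W.c₄ ^ 3 = 0 * W.Δ}
      = (Fintype.card K - 1) * Fintype.card K ^ 3 := by
  have h3 : (3 : K) = 0 := CharP.cast_eq_zero K 3
  refine card_subtype_of_parametrization _ (fun W ↦ (W.b₄, W.a₁, W.a₃, W.a₆))
    (fun b₄ a₁ a₃ a₆ ↦ ⟨a₁, -a₁ ^ 2, a₃, a₁ * a₃ - b₄, a₆⟩) ?_ ?_ ?_ ?_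
  · rintro W ⟨hΔ, hj⟩ h
    have hb : W.b₂ = 0 := by simpa [c₄_of_char_three] using hj
    exact hΔ (by rw [Δ_of_char_three, hb, show W.b₄ = 0 from h]; ring)
  · rintro W ⟨-, hj⟩
    have hb : W.b₂ = 0 := by simpa [c₄_of_char_three] using hj
    rw [b₂_of_char_three] at hb
    ext <;> simp only [b₄_of_char_three]
    · linear_combination -hb
    · ring
  · intro b₄ a₁ a₃ a₆ hb
    have h8 : (8 : K) = -1 := by linear_combination 3 * h3
    simp [Δ_of_char_three, c₄_of_char_three, b₂_of_char_three, b₄_of_char_three, h8, hb]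
  · intros
    simp [b₄_of_char_three]

lemma card_j_ne_zero_of_char_three {j : K} (hj₀ : j ≠ 0) :
    Nat.card {W : WeierstrassCurve K // W.Δ ≠ 0 ∧ W.c₄ ^ 3 = j * W.Δ}
      = (Fintype.card K - 1) * Fintype.card K ^ 3 := by
  have h3 : (3 : K) = 0 := CharP.cast_eq_zero K 3
  have h8 : (8 : K) = -1 := by linear_combination 3 * h3
  refine card_subtype_of_parametrization _ (fun W ↦ (W.b₂, W.a₁, W.a₃, W.a₄))
    (fun b₂ a₁ a₃ a₄ ↦ ⟨a₁, b₂ - a₁ ^ 2, a₃, a₄,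
      (b₂ ^ 2 * (-a₄ + a₁ * a₃) ^ 2 + (-a₄ + a₁ * a₃) ^ 3 - b₂ ^ 6 / j) / b₂ ^ 3 - a₃ ^ 2⟩)
    ?_ ?_ ?_ ?_
  · rintro W ⟨hΔ, hj⟩ h
    rw [c₄_of_char_three, show W.b₂ = 0 from h] at hj
    simp_all
  · rintro W ⟨hΔ, hj⟩
    have hb : W.b₂ ≠ 0 := by
      intro h
      rw [c₄_of_char_three, h] at hj
      simp_all
    ext <;> try rfl
    · simp [b₂_of_char_three]
    · simp only [c₄_of_char_three, Δ_of_char_three, b_relation_of_char_three, b₄_of_char_three,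
        b₆_of_char_three, h8] at hj
      field_simp
      linear_combination -hj
  · intro b₂ a₁ a₃ a₄ hb
    have key : Δ (⟨a₁, b₂ - a₁ ^ 2, a₃, a₄,
        (b₂ ^ 2 * (-a₄ + a₁ * a₃) ^ 2 + (-a₄ + a₁ * a₃) ^ 3 - b₂ ^ 6 / j) / b₂ ^ 3 - a₃ ^ 2⟩ :
        WeierstrassCurve K) = b₂ ^ 6 / j := by
      simp only [Δ_of_char_three, b_relation_of_char_three, b₂_of_char_three, b₄_of_char_three,
        b₆_of_char_three, h8]
      field_simp
      ring
    rw [key, c₄_of_char_three, b₂_of_char_three]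
    refine ⟨by positivity, ?_⟩
    field_simp
    ring
  · intros
    simp [b₂_of_char_three]

end CharThree

section CharNeTwoThree

/-- The Weierstrass curve with given `a₁`, `a₂`, `a₃` and given invariants `c₄` and `c₆`,
over a field in which `6` is invertible. -/
def ofC (c₄ c₆ a₁ a₂ a₃ : K) : WeierstrassCurve K where
  a₁ := a₁
  a₂ := a₂
  a₃ := a₃
  a₄ := (((a₁ ^ 2 + 4 * a₂) ^ 2 - c₄) / 24 - a₁ * a₃) / 2
  a₆ := ((-(a₁ ^ 2 + 4 * a₂) ^ 3 + 36 * (a₁ ^ 2 + 4 * a₂) * (((a₁ ^ 2 + 4 * a₂) ^ 2 - c₄) / 24)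
    - c₆) / 216 - a₃ ^ 2) / 4

lemma ofC_c₄ (h2 : (2 : K) ≠ 0) (h3 : (3 : K) ≠ 0) (c₄ c₆ a₁ a₂ a₃ : K) :
    (ofC c₄ c₆ a₁ a₂ a₃).c₄ = c₄ := by
  have h24 : (24 : K) ≠ 0 := by
    rw [show (24 : K) = 2 ^ 3 * 3 by norm_num]; positivity
  simp only [ofC, WeierstrassCurve.c₄, b₂, b₄]
  field_simp
  ring

lemma ofC_c₆ (h2 : (2 : K) ≠ 0) (h3 : (3 : K) ≠ 0) (c₄ c₆ a₁ a₂ a₃ : K) :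
    (ofC c₄ c₆ a₁ a₂ a₃).c₆ = c₆ := by
  have h24 : (24 : K) ≠ 0 := by
    rw [show (24 : K) = 2 ^ 3 * 3 by norm_num]; positivity
  have h216 : (216 : K) ≠ 0 := by
    rw [show (216 : K) = 2 ^ 3 * 3 ^ 3 by norm_num]; positivity
  have h4 : (4 : K) ≠ 0 := by
    rw [show (4 : K) = 2 ^ 2 by norm_num]; positivity
  simp only [ofC, WeierstrassCurve.c₆, b₂, b₄, b₆]
  field_simp
  ring

lemma ofC_eq_self (h2 : (2 : K) ≠ 0) (h3 : (3 : K) ≠ 0) (W : WeierstrassCurve K) :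
    ofC W.c₄ W.c₆ W.a₁ W.a₂ W.a₃ = W := by
  have h24 : (24 : K) ≠ 0 := by
    rw [show (24 : K) = 2 ^ 3 * 3 by norm_num]; positivity
  have h216 : (216 : K) ≠ 0 := by
    rw [show (216 : K) = 2 ^ 3 * 3 ^ 3 by norm_num]; positivity
  have h4 : (4 : K) ≠ 0 := by
    rw [show (4 : K) = 2 ^ 2 by norm_num]; positivity
  ext <;> try rfl
  · simp only [ofC, WeierstrassCurve.c₄, b₂, b₄]
    field_simp
    ring
  · simp only [ofC, WeierstrassCurve.c₄, WeierstrassCurve.c₆, b₂, b₄, b₆]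
    field_simp
    ring

lemma smooth_and_j_iff_c₄_c₆ (h2 : (2 : K) ≠ 0) (h3 : (3 : K) ≠ 0) (W : WeierstrassCurve K)
    (j : K) : (W.Δ ≠ 0 ∧ W.c₄ ^ 3 = j * W.Δ) ↔
      W.c₄ ^ 3 ≠ W.c₆ ^ 2 ∧ (j - 1728) * W.c₄ ^ 3 = j * W.c₆ ^ 2 := by
  have h1728 : (1728 : K) ≠ 0 := by
    rw [show (1728 : K) = 2 ^ 6 * 3 ^ 3 by norm_num]; positivity
  have hc := W.c_relation
  refine and_congr (not_congr ⟨fun h ↦ ?_, fun h ↦ ?_⟩) ⟨fun h ↦ ?_, fun h ↦ ?_⟩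
  · linear_combination 1728 * h - hc
  · exact mul_left_cancel₀ h1728 (by linear_combination hc + h)
  · linear_combination -1728 * h - j * hc
  · exact mul_left_cancel₀ h1728 (by linear_combination -h - j * hc)

variable [Fintype K]

lemma card_j_of_two_ne_zero_of_three_ne_zero (h2 : (2 : K) ≠ 0) (h3 : (3 : K) ≠ 0) (j : K) :
    Nat.card {W : WeierstrassCurve K // W.Δ ≠ 0 ∧ W.c₄ ^ 3 = j * W.Δ}
      = (Fintype.card K - 1) * Fintype.card K ^ 3 := by
  have h1728 : (1728 : K) ≠ 0 := by
    rw [show (1728 : K) = 2 ^ 6 * 3 ^ 3 by norm_num]; positivity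
  simp only [smooth_and_j_iff_c₄_c₆ h2 h3]
  rcases eq_or_ne j 0 with rfl | hj₀
  · have hc₄ (W : WeierstrassCurve K) (h : (0 - 1728) * W.c₄ ^ 3 = 0 * W.c₆ ^ 2) :
        W.c₄ = 0 := by simpa [h1728] using h
    refine card_subtype_of_parametrization _ (fun W ↦ (W.c₆, W.a₁, W.a₂, W.a₃))
      (fun c a₁ a₂ a₃ ↦ ofC 0 c a₁ a₂ a₃) ?_ ?_ ?_ ?_
    · rintro W ⟨hΔ, hj⟩ h
      exact hΔ (by rw [hc₄ W hj, show W.c₆ = 0 from h]; ring)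
    · rintro W ⟨-, hj⟩
      simpa only [hc₄ W hj] using ofC_eq_self h2 h3 W
    · intro c a₁ a₂ a₃ hc
      simp [ofC_c₄ h2 h3, ofC_c₆ h2 h3, eq_comm (a := (0 : K)), hc]
    · intro c a₁ a₂ a₃ _
      simp only [ofC_c₆ h2 h3]
      rfl
  rcases eq_or_ne j 1728 with rfl | hj₁
  · have hc₆ (W : WeierstrassCurve K)
        (h : ((1728 : K) - 1728) * W.c₄ ^ 3 = 1728 * W.c₆ ^ 2) : W.c₆ = 0 := by
      simpa [h1728] using h
    refine card_subtype_of_parametrization _ (fun W ↦ (W.c₄, W.a₁, W.a₂, W.a₃))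
      (fun c a₁ a₂ a₃ ↦ ofC c 0 a₁ a₂ a₃) ?_ ?_ ?_ ?_
    · rintro W ⟨hΔ, hj⟩ h
      exact hΔ (by rw [hc₆ W hj, show W.c₄ = 0 from h]; ring)
    · rintro W ⟨-, hj⟩
      simpa only [hc₆ W hj] using ofC_eq_self h2 h3 W
    · intro c a₁ a₂ a₃ hc
      simp [ofC_c₄ h2 h3, ofC_c₆ h2 h3, hc]
    · intro c a₁ a₂ a₃ _
      simp only [ofC_c₄ h2 h3]
      rfl
  have hj₂ : j - 1728 ≠ 0 := sub_ne_zero.mpr hj₁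
  have hc₄ (W : WeierstrassCurve K) (hΔ : W.c₄ ^ 3 ≠ W.c₆ ^ 2)
      (h : (j - 1728) * W.c₄ ^ 3 = j * W.c₆ ^ 2) : W.c₄ ≠ 0 := by
    intro h0
    simp_all
  have hc₆ (W : WeierstrassCurve K) (hΔ : W.c₄ ^ 3 ≠ W.c₆ ^ 2)
      (h : (j - 1728) * W.c₄ ^ 3 = j * W.c₆ ^ 2) : W.c₆ ≠ 0 := by
    intro h0
    simp_all
  refine card_subtype_of_parametrization _ (fun W ↦ (W.c₆ / W.c₄, W.a₁, W.a₂, W.a₃))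
    (fun t a₁ a₂ a₃ ↦ ofC (t ^ 2 * j / (j - 1728)) (t ^ 3 * j / (j - 1728)) a₁ a₂ a₃) ?_ ?_ ?_ ?_
  · rintro W ⟨hΔ, hj⟩
    exact div_ne_zero (hc₆ W hΔ hj) (hc₄ W hΔ hj)
  · rintro W ⟨hΔ, hj⟩
    have h₄ := hc₄ W hΔ hj
    have e₄ : (W.c₆ / W.c₄) ^ 2 * j / (j - 1728) = W.c₄ := by
      field_simp
      linear_combination -hj
    have e₆ : (W.c₆ / W.c₄) ^ 3 * j / (j - 1728) = W.c₆ := by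
      field_simp
      linear_combination -W.c₆ * hj
    simpa only [e₄, e₆] using ofC_eq_self h2 h3 W
  · intro t a₁ a₂ a₃ ht
    simp only [ofC_c₄ h2 h3, ofC_c₆ h2 h3]
    constructor
    · intro h
      field_simp at h
      exact h1728 (by linear_combination h)
    · field_simp
  · intro t a₁ a₂ a₃ ht
    simp only [ofC_c₄ h2 h3, ofC_c₆ h2 h3]
    refine Prod.ext ?_ rfl
    field_simp

end CharNeTwoThree

end WeierstrassCurve

/-- **Mass formula for elliptic curves with given j-invariant**: let `K` be a finite field
with `q` elements and `j₀ ∈ K`.  Then the number of smooth Weierstrass curves over `K`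
(tuples `(a₁,a₂,a₃,a₄,a₆) ∈ K⁵` with `Δ ≠ 0`) whose j-invariant `c₄³/Δ` equals `j₀` is
exactly `(q − 1)·q³`.  Equivalently, `Σ_{E/K, j(E)=j₀} 1/#Aut_K(E) = 1`. -/
theorem mass_formula_j_invariant (K : Type*) [Field K] [Fintype K] (q : ℕ)
    (hq : Fintype.card K = q) (j₀ : K) :
    Nat.card {W : WeierstrassCurve K // W.Δ ≠ 0 ∧ W.c₄ ^ 3 / W.Δ = j₀}
      = (q - 1) * q ^ 3 := by
  subst hq
  simp only [WeierstrassCurve.smooth_and_j_iff]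
  by_cases h2 : (2 : K) = 0
  · have : CharP K 2 := CharTwo.of_one_ne_zero_of_two_eq_zero one_ne_zero h2
    rcases eq_or_ne j₀ 0 with rfl | hj
    · exact WeierstrassCurve.card_j_eq_zero_of_char_two
    · exact WeierstrassCurve.card_j_ne_zero_of_char_two hj
  by_cases h3 : (3 : K) = 0
  · have : CharP K 3 := ringChar.of_eq
      (CharP.ringChar_of_prime_eq_zero Nat.prime_three (mod_cast h3))
    rcases eq_or_ne j₀ 0 with rfl | hj
    · exact WeierstrassCurve.card_j_eq_zero_of_char_three
    · exact WeierstrassCurve.card_j_ne_zero_of_char_three hj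
  exact WeierstrassCurve.card_j_of_two_ne_zero_of_three_ne_zero h2 h3 j₀
end
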